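/- arXiv:1012.1699 — 3 statements merged into one kernel-verified Lean document; each statement's English description precedes it below -/
import Mathlib

section
/- Let n ≥ 2 and let G be a closed subgroup of the orthogonal group O(n) that acts transitively on the unit sphere S^{n−1} ⊆ ℝⁿ. Then for every 2-dimensional linear subspace L ⊆ ℝⁿ there exists g ∈ G such that g(v) = −v for every v ∈ L. -/
set_option linter.unusedSectionVars false

namespace TransitiveSphere

open Filter Topology

section LieAlgebra

variable {A : Type*} [NormedRing A] [StarRing A]

/-- A compact subgroup of the unitary group of a normed star ring. -/
structure IsCompactUnitaryGroup (Γ : Set A) : Prop where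
  one_mem : 1 ∈ Γ
  mul_mem : ∀ {g h}, g ∈ Γ → h ∈ Γ → g * h ∈ Γ
  star_mem : ∀ {g}, g ∈ Γ → star g ∈ Γ
  star_mul_self : ∀ {g}, g ∈ Γ → star g * g = 1
  isCompact : IsCompact Γ

namespace IsCompactUnitaryGroup

variable {Γ : Set A}

lemma mul_star_self (hΓ : IsCompactUnitaryGroup Γ) {g : A} (hg : g ∈ Γ) : g * star g = 1 := by
  simpa using hΓ.star_mul_self (hΓ.star_mem hg)

lemma pow_mem (hΓ : IsCompactUnitaryGroup Γ) {g : A} (hg : g ∈ Γ) (m : ℕ) : g ^ m ∈ Γ := by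
  induction m with
  | zero => simpa using hΓ.one_mem
  | succ m ih => rw [pow_succ]; exact hΓ.mul_mem ih hg

end IsCompactUnitaryGroup

variable [NormedAlgebra ℝ A]

/-- The Lie algebra of a group of units: generators of its one-parameter subgroups. -/
def lieAlg (Γ : Set A) : Set A := {X | ∀ t : ℝ, NormedSpace.exp (t • X) ∈ Γ}

lemma exp_mem_of_mem_lieAlg {Γ : Set A} {X : A} (hX : X ∈ lieAlg Γ) : NormedSpace.exp X ∈ Γ := by
  simpa using hX 1

lemma smul_mem_lieAlg {Γ : Set A} {X : A} (hX : X ∈ lieAlg Γ) (c : ℝ) : c • X ∈ lieAlg Γ := by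
  intro t
  rw [smul_smul]
  exact hX _

lemma norm_pow_sub_pow_le {a b : A} (ha : ‖a‖ ≤ 1) (hb : ‖b‖ ≤ 1) (m : ℕ) :
    ‖a ^ m - b ^ m‖ ≤ m * ‖a - b‖ := by
  rcases subsingleton_or_nontrivial A with h | h
  · simp [Subsingleton.elim a b]
  induction m with
  | zero => simp
  | succ m ih =>
    rcases m.eq_zero_or_pos with rfl | hm
    · simp
    have hb' : ‖b ^ m‖ ≤ 1 := (norm_pow_le' b hm).trans (pow_le_one₀ (norm_nonneg _) hb)
    calc ‖a ^ (m + 1) - b ^ (m + 1)‖ = ‖(a ^ m - b ^ m) * a + b ^ m * (a - b)‖ := by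
          congr 1; noncomm_ring
      _ ≤ ‖a ^ m - b ^ m‖ * ‖a‖ + ‖b ^ m‖ * ‖a - b‖ :=
          (norm_add_le _ _).trans (add_le_add (norm_mul_le _ _) (norm_mul_le _ _))
      _ ≤ (m * ‖a - b‖) * 1 + 1 * ‖a - b‖ := by gcongr
      _ = ((m + 1 : ℕ) : ℝ) * ‖a - b‖ := by push_cast; ring

variable [CStarRing A] [FiniteDimensional ℝ A]

lemma norm_le_one_of_star_mul_self {a : A} (h : star a * a = 1) : ‖a‖ ≤ 1 := by
  rcases subsingleton_or_nontrivial A with hA | hA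
  · simp [Subsingleton.elim a 0]
  have h1 := CStarRing.norm_star_mul_self (x := a)
  rw [h, CStarRing.norm_one] at h1
  nlinarith [norm_nonneg a]

lemma hasDerivAt_exp_smul_zero (X : A) :
    HasDerivAt (fun t : ℝ => NormedSpace.exp (t • X)) X 0 := by
  have := FiniteDimensional.complete ℝ A
  simpa using hasDerivAt_exp_smul_const (𝕂 := ℝ) X (0 : ℝ)

/-- Difference quotients of the exponential along a null sequence. -/
lemma tendsto_slope_exp (X : A) {ε : ℕ → ℝ} (hε : ∀ k, 0 < ε k) (hε0 : Tendsto ε atTop (𝓝 0)) :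
    Tendsto (fun k => (ε k)⁻¹ • (NormedSpace.exp (ε k • X) - 1)) atTop (𝓝 X) := by
  have h := (hasDerivAt_exp_smul_zero X).tendsto_slope_zero
  have h2 : Tendsto ε atTop (𝓝[≠] 0) :=
    tendsto_nhdsWithin_iff.2 ⟨hε0, Eventually.of_forall fun k => (hε k).ne'⟩
  simpa [Function.comp_def] using h.comp h2

variable [StarModule ℝ A] {Γ : Set A}

lemma star_exp_mul_exp {X : A} (hX : star X = -X) :
    star (NormedSpace.exp X) * NormedSpace.exp X = 1 := by
  have := FiniteDimensional.complete ℝ A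
  let := NormedAlgebra.restrictScalars ℚ ℝ A
  have : X ∈ skewAdjoint A := hX
  exact (Unitary.mem_iff.1 (NormedSpace.exp_mem_unitary_of_mem_skewAdjoint this)).1

lemma star_exp_of_skew {X : A} (hX : star X = -X) :
    star (NormedSpace.exp X) = NormedSpace.exp (-X) := by
  have := FiniteDimensional.complete ℝ A
  let := NormedAlgebra.restrictScalars ℚ ℝ A
  rw [NormedSpace.star_exp, hX]

/-- A limit of difference quotients of group elements is skew-adjoint. -/
lemma star_eq_neg_of_tendsto (hΓ : IsCompactUnitaryGroup Γ) {g : ℕ → A} (hg : ∀ k, g k ∈ Γ)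
    {ε : ℕ → ℝ} (hε : ∀ k, 0 < ε k) (hε0 : Tendsto ε atTop (𝓝 0)) {Y : A}
    (hY : Tendsto (fun k => (ε k)⁻¹ • (g k - 1)) atTop (𝓝 Y)) : star Y = -Y := by
  have h1 : Tendsto (fun k => star ((ε k)⁻¹ • (g k - 1))) atTop (𝓝 (star Y)) :=
    (continuous_star.tendsto Y).comp hY
  have h2 : Tendsto (fun k => -((ε k)⁻¹ • (g k - 1)) -
      ε k • (star ((ε k)⁻¹ • (g k - 1)) * ((ε k)⁻¹ • (g k - 1)))) atTop
      (𝓝 (-Y - (0 : ℝ) • (star Y * Y))) := hY.neg.sub (hε0.smul (h1.mul hY))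
  rw [zero_smul, sub_zero] at h2
  refine tendsto_nhds_unique h1 (h2.congr fun k => ?_)
  have h := hΓ.star_mul_self (hg k)
  have e : ε k ≠ 0 := (hε k).ne'
  simp only [star_smul, star_sub, star_one, smul_mul_smul_comm, sub_mul, mul_sub, h, mul_one,
    one_mul, smul_smul, star_trivial]
  have : ε k * ((ε k)⁻¹ * (ε k)⁻¹) = (ε k)⁻¹ := by field_simp
  rw [this]
  module

/-- Limits of difference quotients of group elements lie in the Lie algebra. -/
lemma mem_lieAlg_of_tendsto (hΓ : IsCompactUnitaryGroup Γ) {g : ℕ → A} (hg : ∀ k, g k ∈ Γ)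
    {ε : ℕ → ℝ} (hε : ∀ k, 0 < ε k) (hε0 : Tendsto ε atTop (𝓝 0)) {Y : A}
    (hY : Tendsto (fun k => (ε k)⁻¹ • (g k - 1)) atTop (𝓝 Y)) : Y ∈ lieAlg Γ := by
  have := FiniteDimensional.complete ℝ A
  let := NormedAlgebra.restrictScalars ℚ ℝ A
  have hskew := star_eq_neg_of_tendsto hΓ hg hε hε0 hY
  have hskew' : ∀ t : ℝ, star (t • Y) = -(t • Y) := fun t => by simp [star_smul, hskew]
  have key : ∀ t : ℝ, 0 ≤ t → NormedSpace.exp (t • Y) ∈ Γ := by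
    intro t ht
    let m : ℕ → ℕ := fun k => ⌊t / ε k⌋₊
    have hm1 : ∀ k, m k * ε k ≤ t := fun k => by
      have := Nat.floor_le (div_nonneg ht (hε k).le)
      exact (le_div_iff₀ (hε k)).1 this
    have hm2 : ∀ k, t - ε k ≤ m k * ε k := fun k => by
      have := Nat.lt_floor_add_one (t / ε k)
      have := (div_lt_iff₀ (hε k)).1 this
      simp only [m]; linarith
    have hm : Tendsto (fun k => (m k : ℝ) * ε k) atTop (𝓝 t) := by
      refine tendsto_of_tendsto_of_tendsto_of_le_of_le ?_ tendsto_const_nhds hm2 hm1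
      simpa using hε0.const_sub t
    have h1 : Tendsto (fun k => NormedSpace.exp (((m k : ℝ) * ε k) • Y)) atTop
        (𝓝 (NormedSpace.exp (t • Y))) := (hm.smul_const Y).exp
    have h2 : Tendsto (fun k => g k ^ m k - NormedSpace.exp (((m k : ℝ) * ε k) • Y)) atTop
        (𝓝 0) := by
      have h3 : Tendsto (fun k => t * ‖(ε k)⁻¹ • (g k - 1) -
          (ε k)⁻¹ • (NormedSpace.exp (ε k • Y) - 1)‖) atTop (𝓝 0) := by
        simpa using ((hY.sub (tendsto_slope_exp Y hε hε0)).norm.const_mul t)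
      refine squeeze_zero_norm (fun k => ?_) h3
      have e : NormedSpace.exp (((m k : ℝ) * ε k) • Y) = NormedSpace.exp (ε k • Y) ^ m k := by
        rw [← NormedSpace.exp_nsmul, mul_smul, Nat.cast_smul_eq_nsmul]
      rw [e]
      refine (norm_pow_sub_pow_le (norm_le_one_of_star_mul_self (hΓ.star_mul_self (hg k)))
        (norm_le_one_of_star_mul_self (star_exp_mul_exp (hskew' _))) _).trans ?_
      rw [← smul_sub, sub_sub_sub_cancel_right, norm_smul, Real.norm_of_nonneg
        (inv_nonneg.2 (hε k).le), ← mul_assoc]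
      gcongr
      rw [← div_eq_mul_inv, le_div_iff₀ (hε k)]
      exact hm1 k
    have h3 := h2.add h1
    simp only [sub_add_cancel, zero_add] at h3
    exact hΓ.isCompact.isClosed.mem_of_tendsto h3
      (Eventually.of_forall fun k => hΓ.pow_mem (hg k) _)
  intro t
  rcases le_total 0 t with ht | ht
  · exact key t ht
  · have := hΓ.star_mem (key (-t) (by linarith))
    rwa [star_exp_of_skew (hskew' _), ← neg_smul, neg_neg] at this

lemma pos_inv_succ (k : ℕ) : (0 : ℝ) < 1 / ((k : ℝ) + 1) := by positivity

lemma star_eq_neg_of_mem_lieAlg (hΓ : IsCompactUnitaryGroup Γ) {X : A} (hX : X ∈ lieAlg Γ) :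
    star X = -X :=
  star_eq_neg_of_tendsto hΓ (fun _ => hX _) pos_inv_succ tendsto_one_div_add_atTop_nhds_zero_nat
    (tendsto_slope_exp X pos_inv_succ tendsto_one_div_add_atTop_nhds_zero_nat)

lemma add_mem_lieAlg (hΓ : IsCompactUnitaryGroup Γ) {X Y : A} (hX : X ∈ lieAlg Γ)
    (hY : Y ∈ lieAlg Γ) : X + Y ∈ lieAlg Γ := by
  set ε : ℕ → ℝ := fun k => 1 / ((k : ℝ) + 1)
  have hε : ∀ k, 0 < ε k := pos_inv_succ
  have hε0 : Tendsto ε atTop (𝓝 0) := tendsto_one_div_add_atTop_nhds_zero_nat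
  refine mem_lieAlg_of_tendsto hΓ (fun k => hΓ.mul_mem (hX (ε k)) (hY (ε k))) hε hε0 ?_
  have hx := tendsto_slope_exp X hε hε0
  have hy := tendsto_slope_exp Y hε hε0
  have h := (hx.add hy).add (hε0.smul (hx.mul hy))
  rw [zero_smul, add_zero] at h
  refine h.congr fun k => ?_
  have : ε k * ((ε k)⁻¹ * (ε k)⁻¹) = (ε k)⁻¹ := by have := (hε k).ne'; field_simp
  rw [smul_mul_smul_comm, smul_smul, this, ← smul_add, ← smul_add]
  congr 1
  noncomm_ring

lemma zero_mem_lieAlg (hΓ : IsCompactUnitaryGroup Γ) : (0 : A) ∈ lieAlg Γ := by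
  intro t; simpa using hΓ.one_mem

lemma conj_mem_lieAlg (hΓ : IsCompactUnitaryGroup Γ) {g X : A} (hg : g ∈ Γ)
    (hX : X ∈ lieAlg Γ) : g * X * star g ∈ lieAlg Γ := by
  have := FiniteDimensional.complete ℝ A
  let := NormedAlgebra.restrictScalars ℚ ℝ A
  intro t
  let u : Aˣ := ⟨g, star g, hΓ.mul_star_self hg, hΓ.star_mul_self hg⟩
  have : t • (g * X * star g) = u * (t • X) * ↑u⁻¹ := by
    simp [u]
  rw [this, NormedSpace.exp_units_conj]
  exact hΓ.mul_mem (hΓ.mul_mem hg (hX t)) (hΓ.star_mem hg)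

/-- The Lie algebra as a real subspace. -/
def lieSubmodule (hΓ : IsCompactUnitaryGroup Γ) : Submodule ℝ A where
  carrier := lieAlg Γ
  add_mem' := add_mem_lieAlg hΓ
  zero_mem' := zero_mem_lieAlg hΓ
  smul_mem' c _ hX := smul_mem_lieAlg hX c

lemma commutator_mem_lieAlg (hΓ : IsCompactUnitaryGroup Γ) {X Y : A} (hX : X ∈ lieAlg Γ)
    (hY : Y ∈ lieAlg Γ) : X * Y - Y * X ∈ lieAlg Γ := by
  set ε : ℕ → ℝ := fun k => 1 / ((k : ℝ) + 1)
  have hε : ∀ k, 0 < ε k := pos_inv_succ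
  have hε0 : Tendsto ε atTop (𝓝 0) := tendsto_one_div_add_atTop_nhds_zero_nat
  have hX' : -X ∈ lieAlg Γ := (lieSubmodule hΓ).neg_mem hX
  have hx := tendsto_slope_exp X hε hε0
  have hx' := tendsto_slope_exp (-X) hε hε0
  have hs := star_eq_neg_of_mem_lieAlg hΓ hX
  have h := ((hx.mul_const Y).add (hx'.const_mul Y)).add (hε0.smul ((hx.mul_const Y).mul hx'))
  have hcl : IsClosed (lieSubmodule hΓ : Set A) := (lieSubmodule hΓ).closed_of_finiteDimensional
  have e : X * Y + Y * -X + (0 : ℝ) • (X * Y * -X) = X * Y - Y * X := by simp; abel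
  rw [e] at h
  refine hcl.mem_of_tendsto h (Eventually.of_forall fun k => ?_)
  have h1 : (ε k)⁻¹ • (NormedSpace.exp (ε k • X) * Y * star (NormedSpace.exp (ε k • X)) - Y) ∈
      lieSubmodule hΓ :=
    (lieSubmodule hΓ).smul_mem _ ((lieSubmodule hΓ).sub_mem (conj_mem_lieAlg hΓ (hX _) hY) hY)
  refine (congrArg (· ∈ lieSubmodule hΓ) ?_).mpr h1
  have : ε k * ((ε k)⁻¹ * (ε k)⁻¹) = (ε k)⁻¹ := by have := (hε k).ne'; field_simp
  rw [star_exp_of_skew (by simp [star_smul, hs]), ← smul_neg, smul_mul_assoc,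
    smul_mul_smul_comm, smul_smul, this, mul_smul_comm, ← smul_add, ← smul_add]
  congr 1
  noncomm_ring

end LieAlgebra

end TransitiveSphere

namespace TransitiveSphere

open Filter Topology Matrix
open scoped Matrix.Norms.L2Operator

variable {ι : Type*} [Fintype ι] [DecidableEq ι]

/-- A compact group of real orthogonal matrices, regarded as complex matrices, that acts
transitively on the real unit sphere. -/
structure IsTransitiveGroup (Γ : Set (Matrix ι ι ℂ)) : Prop extends IsCompactUnitaryGroup Γ where
  transpose_eq : ∀ {g}, g ∈ Γ → gᵀ = gᴴ
  transitive : ∀ {x y : ι → ℂ}, star x = x → star y = y → x ⬝ᵥ x = 1 → y ⬝ᵥ y = 1 →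
    ∃ g ∈ Γ, g *ᵥ x = y

lemma star_mulVec_of_transpose_eq {M : Matrix ι ι ℂ} (h : Mᵀ = Mᴴ) (v : ι → ℂ) :
    star (M *ᵥ v) = M *ᵥ star v := by
  rw [star_mulVec, ← h, vecMul_transpose]

lemma pow_mulVec_of_mulVec_eq_smul {M : Matrix ι ι ℂ} {v : ι → ℂ} {c : ℂ} (h : M *ᵥ v = c • v)
    (m : ℕ) : M ^ m *ᵥ v = c ^ m • v := by
  induction m with
  | zero => simp
  | succ m ih => rw [pow_succ, ← mulVec_mulVec, h, mulVec_smul, ih, smul_smul, pow_succ']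

lemma exp_mulVec_of_mulVec_eq_smul {M : Matrix ι ι ℂ} {v : ι → ℂ} {c : ℂ} (h : M *ᵥ v = c • v) :
    NormedSpace.exp M *ᵥ v = Complex.exp c • v := by
  let L : Matrix ι ι ℂ →ₗ[ℂ] (ι → ℂ) :=
    { toFun := fun N => N *ᵥ v
      map_add' := fun a b => add_mulVec a b v
      map_smul' := fun a b => smul_mulVec a b v }
  have h1 := (NormedSpace.exp_series_hasSum_exp' (𝕂 := ℂ) M).map L
    (LinearMap.continuous_of_finiteDimensional L)
  have h2 := (NormedSpace.exp_series_hasSum_exp' (𝕂 := ℂ) c).smul_const v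
  rw [Complex.exp_eq_exp_ℂ]
  refine h1.unique (h2.congr_fun ?_)
  intro m
  simp [L, pow_mulVec_of_mulVec_eq_smul h, smul_smul, smul_mulVec]

lemma dotProduct_mulVec_self_of_transpose_eq_neg {M : Matrix ι ι ℂ} (h : Mᵀ = -M) (x : ι → ℂ) :
    x ⬝ᵥ (M *ᵥ x) = 0 := by
  have h1 : x ⬝ᵥ (M *ᵥ x) = -(x ⬝ᵥ (M *ᵥ x)) := by
    conv_lhs => rw [dotProduct_mulVec, ← mulVec_transpose, h, neg_mulVec, neg_dotProduct,
      dotProduct_comm]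
  exact self_eq_neg.1 h1

namespace IsTransitiveGroup

variable {Γ : Set (Matrix ι ι ℂ)}

lemma transpose_eq_of_mem_lieAlg (hΓ : IsTransitiveGroup Γ) {X : Matrix ι ι ℂ}
    (hX : X ∈ lieAlg Γ) : Xᵀ = Xᴴ := by
  have h := tendsto_slope_exp X pos_inv_succ tendsto_one_div_add_atTop_nhds_zero_nat
  have h1 := (continuous_id.matrix_transpose.tendsto X).comp h
  have h2 := (continuous_id.matrix_conjTranspose.tendsto X).comp h
  refine tendsto_nhds_unique h1 (h2.congr fun k => ?_)
  simp only [Function.comp_apply, id, conjTranspose_smul, transpose_smul, conjTranspose_sub,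
    transpose_sub, hΓ.transpose_eq (hX _), star_trivial]
  simp

lemma conjTranspose_eq_neg (hΓ : IsTransitiveGroup Γ) {X : Matrix ι ι ℂ}
    (hX : X ∈ lieAlg Γ) : Xᴴ = -X :=
  star_eq_neg_of_mem_lieAlg hΓ.toIsCompactUnitaryGroup hX

lemma transpose_eq_neg (hΓ : IsTransitiveGroup Γ) {X : Matrix ι ι ℂ}
    (hX : X ∈ lieAlg Γ) : Xᵀ = -X := by
  rw [hΓ.transpose_eq_of_mem_lieAlg hX, hΓ.conjTranspose_eq_neg hX]

/-- Infinitesimal transitivity on the sphere. -/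
theorem exists_mem_lieAlg_mulVec_eq (hΓ : IsTransitiveGroup Γ) {x u : ι → ℂ} (hx : star x = x)
    (hu : star u = u) (hxx : x ⬝ᵥ x = 1) (huu : u ⬝ᵥ u = 1) (hux : u ⬝ᵥ x = 0) :
    ∃ X ∈ lieAlg Γ, X *ᵥ x = u := by
  have hxu : x ⬝ᵥ u = 0 := by rw [dotProduct_comm, hux]
  set t : ℕ → ℝ := fun k => 1 / ((k : ℝ) + 1)
  have ht : ∀ k, 0 < t k := pos_inv_succ
  have ht1 : ∀ k, t k ≤ 1 := fun k => by
    rw [div_le_one (by positivity)]; linarith [(Nat.cast_nonneg k : (0 : ℝ) ≤ k)]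
  have ht0 : Tendsto t atTop (𝓝 0) := tendsto_one_div_add_atTop_nhds_zero_nat
  set y : ℕ → ι → ℂ := fun k => (Real.cos (t k) : ℂ) • x + (Real.sin (t k) : ℂ) • u
  have hystar : ∀ k, star (y k) = y k := fun k => by
    simp only [y, star_add, star_smul, hx, hu]
    simp only [RCLike.star_def, Complex.conj_ofReal]
  have hyy : ∀ k, y k ⬝ᵥ y k = 1 := fun k => by
    simp only [y, add_dotProduct, dotProduct_add, smul_dotProduct, dotProduct_smul, hxx, huu, hux,
      hxu, smul_eq_mul, mul_one, mul_zero, add_zero, zero_add]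
    norm_cast
    nlinarith [Real.sin_sq_add_cos_sq (t k)]
  have hyx : ∀ k, y k ≠ x := fun k h => by
    have h1 : u ⬝ᵥ y k = 0 := by rw [h, hux]
    simp only [y, dotProduct_add, dotProduct_smul, huu, hux, smul_eq_mul, mul_zero, mul_one,
      zero_add] at h1
    have := Real.sin_pos_of_pos_of_lt_pi (ht k)
      (lt_of_le_of_lt (ht1 k) (by linarith [Real.pi_gt_three]))
    exact this.ne' (by exact_mod_cast h1)
  have hycont : Tendsto y atTop (𝓝 x) := by
    have h1 : Tendsto (fun k => (Real.cos (t k) : ℂ)) atTop (𝓝 1) := by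
      have := ((Complex.continuous_ofReal.comp Real.continuous_cos).tendsto 0).comp ht0
      simpa [Function.comp_def] using this
    have h2 : Tendsto (fun k => (Real.sin (t k) : ℂ)) atTop (𝓝 0) := by
      have := ((Complex.continuous_ofReal.comp Real.continuous_sin).tendsto 0).comp ht0
      simpa [Function.comp_def] using this
    have h3 := (h1.smul_const x).add (h2.smul_const u)
    rwa [one_smul, zero_smul, add_zero] at h3
  have hmv : ∀ v : ι → ℂ, Continuous fun g : Matrix ι ι ℂ => g *ᵥ v := fun v => by fun_prop
  have hmin : ∀ k, ∃ g ∈ Γ, g *ᵥ x = y k ∧ ∀ h ∈ Γ, h *ᵥ x = y k → ‖g - 1‖ ≤ ‖h - 1‖ := by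
    intro k
    have hc : IsCompact (Γ ∩ {g | g *ᵥ x = y k}) :=
      hΓ.isCompact.inter_right (isClosed_eq (hmv x) continuous_const)
    obtain ⟨g0, hg0, hg0'⟩ := hΓ.transitive hx (hystar k) hxx (hyy k)
    obtain ⟨g, hg, hgm⟩ := hc.exists_isMinOn ⟨g0, hg0, hg0'⟩
      (f := fun g => ‖g - 1‖) (by fun_prop)
    exact ⟨g, hg.1, hg.2, fun h hh hh' => hgm ⟨hh, hh'⟩⟩
  choose g hg hgx hgmin using hmin
  obtain ⟨h, hh, φ, hφ, hgh⟩ := hΓ.isCompact.tendsto_subseq hg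
  have hhx : h *ᵥ x = x := by
    refine tendsto_nhds_unique (((hmv x).tendsto h).comp hgh) ?_
    refine (hycont.comp hφ.tendsto_atTop).congr fun k => ?_
    simp [hgx]
  have hhx' : hᴴ *ᵥ x = x := by
    conv_lhs => rw [← hhx]
    rw [mulVec_mulVec, show hᴴ * h = 1 from hΓ.star_mul_self hh, one_mulVec]
  have hε0 : Tendsto (fun k => ‖g (φ k) - 1‖) atTop (𝓝 0) := by
    have h1 : Tendsto (fun k => ‖g (φ k) * hᴴ - 1‖) atTop (𝓝 ‖h * hᴴ - 1‖) :=
      ((hgh.mul_const hᴴ).sub_const 1).norm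
    rw [show h * hᴴ = 1 from hΓ.mul_star_self hh, sub_self, norm_zero] at h1
    refine squeeze_zero (fun _ => norm_nonneg _) (fun k => ?_) h1
    refine hgmin _ _ (hΓ.mul_mem (hg _) (hΓ.star_mem hh)) ?_
    rw [← mulVec_mulVec, hhx', hgx]
  have hεpos : ∀ k, 0 < ‖g k - 1‖ := fun k => by
    rw [norm_pos_iff, sub_ne_zero]
    intro h1
    have := hgx k
    rw [h1, one_mulVec] at this
    exact hyx k this.symm
  have := FiniteDimensional.proper ℂ (Matrix ι ι ℂ)
  obtain ⟨Y, -, ψ, hψ, hY⟩ := (isCompact_closedBall (0 : Matrix ι ι ℂ) 1).tendsto_subseq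
    (x := fun k => ‖g (φ k) - 1‖⁻¹ • (g (φ k) - 1)) (fun k => by
      rw [mem_closedBall_zero_iff, norm_smul, norm_inv, norm_norm,
        inv_mul_cancel₀ (hεpos _).ne'])
  set s : ℕ → ℕ := fun k => φ (ψ k)
  set ε : ℕ → ℝ := fun k => ‖g (s k) - 1‖ with hεdef
  have hε : ∀ k, 0 < ε k := fun k => hεpos _
  have hε0' : Tendsto ε atTop (𝓝 0) := hε0.comp hψ.tendsto_atTop
  have hY' : Tendsto (fun k => (ε k)⁻¹ • (g (s k) - 1)) atTop (𝓝 Y) := hY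
  have hYmem : Y ∈ lieAlg Γ :=
    mem_lieAlg_of_tendsto hΓ.toIsCompactUnitaryGroup (fun k => hg _) hε hε0' hY'
  have hYx : Y *ᵥ x ≠ 0 := by
    intro h0
    have hexp : ∀ r : ℝ, NormedSpace.exp (r • Y) *ᵥ x = x := fun r => by
      rw [exp_mulVec_of_mulVec_eq_smul (c := 0) (by rw [smul_mulVec, h0]; simp)]
      simp
    have hn := tendsto_slope_exp (-Y) hε hε0'
    have hlim := (hY'.add hn).add (hε0'.smul (hY'.mul hn))
    rw [zero_smul, add_zero, add_neg_cancel] at hlim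
    have hlim' := hlim.norm
    rw [norm_zero] at hlim'
    refine absurd (ge_of_tendsto hlim' (Eventually.of_forall fun k => ?_)) (not_le.2 one_pos)
    have e : ε k * ((ε k)⁻¹ * (ε k)⁻¹) = (ε k)⁻¹ := by have := (hε k).ne'; field_simp
    have e2 : (ε k)⁻¹ • (g (s k) - 1) + (ε k)⁻¹ • (NormedSpace.exp (ε k • -Y) - 1) +
        ε k • ((ε k)⁻¹ • (g (s k) - 1) * (ε k)⁻¹ • (NormedSpace.exp (ε k • -Y) - 1)) =
        (ε k)⁻¹ • (g (s k) * NormedSpace.exp (ε k • -Y) - 1) := by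
      rw [smul_mul_smul_comm, smul_smul, e, ← smul_add, ← smul_add]
      congr 1
      noncomm_ring
    rw [e2, norm_smul, norm_inv, Real.norm_of_nonneg (hε k).le, ← div_eq_inv_mul,
      le_div_iff₀ (hε k), one_mul]
    rw [smul_neg, ← neg_smul]
    refine hgmin _ _ (hΓ.mul_mem (hg _) (hYmem _)) ?_
    rw [← mulVec_mulVec, hexp, hgx]
  have hYr := hΓ.transpose_eq_of_mem_lieAlg hYmem
  have hspan : Y *ᵥ x = (x ⬝ᵥ (Y *ᵥ x)) • x + (u ⬝ᵥ (Y *ᵥ x)) • u := by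
    have hc : Continuous fun v : ι → ℂ => (x ⬝ᵥ v) • x + (u ⬝ᵥ v) • u := by
      simp only [dotProduct]; fun_prop
    have hL := ((hmv x).tendsto Y).comp hY'
    refine tendsto_nhds_unique hL (((hc.tendsto _).comp hL).congr fun k => ?_)
    simp only [Function.comp_apply, smul_mulVec, sub_mulVec, one_mulVec, hgx, y]
    simp only [dotProduct_smul, dotProduct_sub, dotProduct_add, hxx, hux, hxu, huu, smul_eq_mul]
    ext i
    simp
    ring
  rw [dotProduct_mulVec_self_of_transpose_eq_neg (hΓ.transpose_eq_neg hYmem), zero_smul,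
    zero_add] at hspan
  set r := u ⬝ᵥ (Y *ᵥ x) with hr
  have hr0 : r ≠ 0 := fun h0 => hYx (by rw [hspan, h0, zero_smul])
  have hrr : (r.re : ℂ) = r := by
    rw [← Complex.conj_eq_iff_re]
    have : star r = r := by
      rw [hr, ← star_dotProduct_star, star_mulVec_of_transpose_eq hYr, hx, hu, dotProduct_comm]
    simpa using this
  refine ⟨r.re⁻¹ • Y, smul_mem_lieAlg hYmem _, ?_⟩
  rw [smul_mulVec, hspan]
  ext i
  have : (r.re : ℂ) ≠ 0 := by rw [hrr]; exact hr0
  simp only [Pi.smul_apply, smul_eq_mul, Complex.real_smul, Complex.ofReal_inv]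
  rw [← mul_assoc, ← hrr]
  simp only [Complex.ofReal_re]
  rw [inv_mul_cancel₀ this, one_mul]

end IsTransitiveGroup

end TransitiveSphere

namespace TransitiveSphere

open Filter Topology Matrix
open scoped Matrix.Norms.L2Operator ComplexOrder

section Core

variable {V : Type*} [AddCommGroup V] [Module ℂ V] [FiniteDimensional ℂ V]

lemma iSup_iInf_eigenspace_eq_top (c : InnerProductSpace.Core ℂ V) {κ : Type*}
    (T : κ → Module.End ℂ V) (hT : ∀ i u v, c.inner (T i u) v = c.inner u (T i v))
    (hc : ∀ i j, Commute (T i) (T j)) :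
    ⨆ χ : κ → ℝ, ⨅ i, Module.End.eigenspace (T i) (χ i : ℂ) = ⊤ := by
  let := c.toNormedAddCommGroup
  let := InnerProductSpace.ofCore c.toCore
  have hs : ∀ i, (T i).IsSymmetric := fun i u v => hT i u v
  have h := LinearMap.IsSymmetric.iSup_iInf_eq_top_of_commute hs (fun i j _ => hc i j)
  rw [eq_top_iff, ← h]
  refine iSup_le fun χ => ?_
  by_cases hb : ⨅ i, Module.End.eigenspace (T i) (χ i) = ⊥
  · rw [hb]; exact bot_le
  · obtain ⟨v, hv, hv0⟩ := Submodule.exists_mem_ne_zero_of_ne_bot hb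
    refine le_trans ?_ (le_iSup _ fun i => (χ i).re)
    refine iInf_mono fun i => ?_
    have : (starRingEnd ℂ) (χ i) = χ i :=
      (hs i).conj_eigenvalue_eq_self
        (Module.End.hasEigenvalue_of_hasEigenvector ⟨(Submodule.mem_iInf _).1 hv i, hv0⟩)
    rw [Complex.conj_eq_iff_re.1 this]

lemma exists_add_orthogonal_of_core (c : InnerProductSpace.Core ℂ V) (W : Submodule ℂ V) (v : V) :
    ∃ w ∈ W, ∃ p, v = w + p ∧ ∀ w' ∈ W, c.inner w' p = 0 := by
  let := c.toNormedAddCommGroup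
  let := InnerProductSpace.ofCore c.toCore
  obtain ⟨w, hw, p, hp, h⟩ := W.exists_add_mem_mem_orthogonal v
  exact ⟨w, hw, p, h, fun w' hw' => (Submodule.mem_orthogonal W p).1 hp w' hw'⟩

end Core

variable {ι : Type*} [Fintype ι]

/-- The squared Hermitian norm of a complex vector. -/
def nsq (u : ι → ℂ) : ℝ := (star u ⬝ᵥ u).re

lemma star_dotProduct_self_eq (u : ι → ℂ) : star u ⬝ᵥ u = (nsq u : ℂ) := by
  refine (Complex.conj_eq_iff_re.1 ?_).symm
  have := star_dotProduct_star u (star u)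
  rw [star_star] at this
  rw [starRingEnd_apply, ← this]

lemma nsq_nonneg (u : ι → ℂ) : 0 ≤ nsq u := by
  have := dotProduct_star_self_nonneg (star u)
  rw [star_star, dotProduct_comm, star_dotProduct_self_eq] at this
  exact_mod_cast this

lemma nsq_eq_zero {u : ι → ℂ} : nsq u = 0 ↔ u = 0 := by
  rw [← dotProduct_star_self_eq_zero (v := u), star_dotProduct_self_eq]
  exact_mod_cast Iff.rfl

lemma nsq_pos {u : ι → ℂ} (h : u ≠ 0) : 0 < nsq u :=
  lt_of_le_of_ne (nsq_nonneg u) fun h' => h (nsq_eq_zero.1 h'.symm)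

lemma star_dotProduct_symm (u v : ι → ℂ) : star (star u ⬝ᵥ v) = star v ⬝ᵥ u := by
  rw [← star_dotProduct_star, star_star]

lemma star_dotProduct_eq_zero_symm {u v : ι → ℂ} (h : star u ⬝ᵥ v = 0) : star v ⬝ᵥ u = 0 := by
  rw [← star_dotProduct_symm, h, star_zero]

lemma star_dotProduct_mulVec (M : Matrix ι ι ℂ) (u v : ι → ℂ) :
    star u ⬝ᵥ (M *ᵥ v) = star (Mᴴ *ᵥ u) ⬝ᵥ v := by
  rw [star_mulVec, conjTranspose_conjTranspose, dotProduct_mulVec]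

lemma star_mulVec_dotProduct (M : Matrix ι ι ℂ) (u v : ι → ℂ) :
    star (M *ᵥ u) ⬝ᵥ v = star u ⬝ᵥ (Mᴴ *ᵥ v) := by
  rw [star_dotProduct_mulVec, conjTranspose_conjTranspose]

/-- Scaling a nonzero vector to norm one. -/
lemma exists_smul_nsq_eq_one {u : ι → ℂ} (h : u ≠ 0) :
    ∃ c : ℝ, 0 < c ∧ nsq ((c : ℂ) • u) = 1 := by
  have hp := nsq_pos h
  refine ⟨(Real.sqrt (nsq u))⁻¹, by positivity, ?_⟩
  rw [nsq, star_smul, smul_dotProduct, dotProduct_smul, star_dotProduct_self_eq]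
  simp only [RCLike.star_def, Complex.conj_ofReal, smul_eq_mul]
  norm_cast
  rw [← mul_assoc, ← mul_inv, Real.mul_self_sqrt hp.le, inv_mul_cancel₀ hp.ne']

/-- The standard Hermitian inner product on coordinate vectors. -/
@[reducible] def vecCore (ι : Type*) [Fintype ι] : InnerProductSpace.Core ℂ (ι → ℂ) where
  inner u v := star u ⬝ᵥ v
  conj_inner_symm u v := star_dotProduct_symm v u
  re_inner_nonneg u := nsq_nonneg u
  add_left u v w := by simp [add_dotProduct]
  smul_left u v c := by simp [smul_dotProduct]
  definite u h := nsq_eq_zero.1 (by simpa [star_dotProduct_self_eq] using h)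

lemma normSq_star_dotProduct_le (u v : ι → ℂ) :
    Complex.normSq (star u ⬝ᵥ v) ≤ nsq u * nsq v := by
  have h := InnerProductSpace.Core.inner_mul_inner_self_le (c := (vecCore ι).toCore) u v
  have h1 : ‖star u ⬝ᵥ v‖ * ‖star v ⬝ᵥ u‖ ≤ nsq u * nsq v := h
  rw [← star_dotProduct_symm u v, norm_star] at h1
  rwa [Complex.normSq_eq_norm_sq, sq]

lemma exists_add_orthogonal (W : Submodule ℂ (ι → ℂ)) (v : ι → ℂ) :
    ∃ w ∈ W, ∃ p, v = w + p ∧ ∀ w' ∈ W, star w' ⬝ᵥ p = 0 :=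
  exists_add_orthogonal_of_core (vecCore ι) W v

lemma trace_conjTranspose_mul_self_eq (X : Matrix ι ι ℂ) :
    trace (Xᴴ * X) = ∑ j, (nsq fun i => X i j : ℂ) := by
  rw [trace]
  refine Finset.sum_congr rfl fun j _ => ?_
  rw [← star_dotProduct_self_eq]
  rfl

/-- The squared Frobenius norm. -/
def frobSq (X : Matrix ι ι ℂ) : ℝ := (trace (Xᴴ * X)).re

lemma trace_conjTranspose_mul_self (X : Matrix ι ι ℂ) : trace (Xᴴ * X) = (frobSq X : ℂ) := by
  rw [frobSq, trace_conjTranspose_mul_self_eq, ← Complex.ofReal_sum, Complex.ofReal_re]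

lemma frobSq_eq_sum (X : Matrix ι ι ℂ) : frobSq X = ∑ j, nsq fun i => X i j := by
  rw [frobSq, trace_conjTranspose_mul_self_eq, ← Complex.ofReal_sum, Complex.ofReal_re]

lemma frobSq_nonneg (X : Matrix ι ι ℂ) : 0 ≤ frobSq X := by
  rw [frobSq_eq_sum]
  exact Finset.sum_nonneg fun _ _ => nsq_nonneg _

lemma frobSq_eq_zero {X : Matrix ι ι ℂ} : frobSq X = 0 ↔ X = 0 := by
  rw [← Matrix.trace_conjTranspose_mul_self_eq_zero_iff, trace_conjTranspose_mul_self]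
  norm_cast

/-- The Frobenius inner product on a space of matrices. -/
@[reducible] def matCore (W : Submodule ℂ (Matrix ι ι ℂ)) : InnerProductSpace.Core ℂ W where
  inner X Y := trace ((X : Matrix ι ι ℂ)ᴴ * (Y : Matrix ι ι ℂ))
  conj_inner_symm X Y := by
    rw [starRingEnd_apply, ← trace_conjTranspose, conjTranspose_mul, conjTranspose_conjTranspose]
  re_inner_nonneg X := frobSq_nonneg (X : Matrix ι ι ℂ)
  add_left X Y Z := by simp [add_mul]
  smul_left X Y c := by simp
  definite X h := by
    rw [trace_conjTranspose_mul_self_eq_zero_iff] at h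
    exact Subtype.ext h

end TransitiveSphere

namespace TransitiveSphere

open Filter Topology Matrix
open scoped Matrix.Norms.L2Operator

variable {ι : Type*} [Fintype ι] [DecidableEq ι]

/-- The complexified Lie algebra. -/
def cLie (Γ : Set (Matrix ι ι ℂ)) : Submodule ℂ (Matrix ι ι ℂ) := Submodule.span ℂ (lieAlg Γ)

/-- A maximal commuting orthonormal family in the Lie algebra. -/
structure IsCartan (Γ : Set (Matrix ι ι ℂ)) {r : ℕ} (A : Fin r → Matrix ι ι ℂ) : Prop where
  mem : ∀ j, A j ∈ lieAlg Γ
  comm : ∀ i j, A i * A j = A j * A i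
  orth : ∀ i j, trace (A i * A j) = if i = j then -1 else 0
  maximal : ∀ B ∈ lieAlg Γ, (∀ j, A j * B = B * A j) → ∃ c : Fin r → ℝ, B = ∑ j, c j • A j

lemma mem_cLie_of_mem {Γ : Set (Matrix ι ι ℂ)} {X : Matrix ι ι ℂ} (h : X ∈ lieAlg Γ) :
    X ∈ cLie Γ := Submodule.subset_span h

namespace IsTransitiveGroup

variable {Γ : Set (Matrix ι ι ℂ)}

lemma mem_cLie_iff (hΓ : IsTransitiveGroup Γ) {Z : Matrix ι ι ℂ} :
    Z ∈ cLie Γ ↔ ∃ X ∈ lieAlg Γ, ∃ Y ∈ lieAlg Γ, Z = X + Complex.I • Y := by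
  have hu := hΓ.toIsCompactUnitaryGroup
  constructor
  · intro h
    induction h using Submodule.span_induction with
    | mem x hx => exact ⟨x, hx, 0, zero_mem_lieAlg hu, by simp⟩
    | zero => exact ⟨0, zero_mem_lieAlg hu, 0, zero_mem_lieAlg hu, by simp⟩
    | add a b _ _ ha hb =>
      obtain ⟨X, hX, Y, hY, rfl⟩ := ha
      obtain ⟨X', hX', Y', hY', rfl⟩ := hb
      exact ⟨X + X', add_mem_lieAlg hu hX hX', Y + Y', add_mem_lieAlg hu hY hY', by module⟩
    | smul c a _ ha =>
      obtain ⟨X, hX, Y, hY, rfl⟩ := ha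
      refine ⟨c.re • X + (-c.im) • Y, add_mem_lieAlg hu (smul_mem_lieAlg hX _)
        (smul_mem_lieAlg hY _), c.im • X + c.re • Y, add_mem_lieAlg hu (smul_mem_lieAlg hX _)
        (smul_mem_lieAlg hY _), ?_⟩
      ext i j
      apply Complex.ext <;> simp <;> ring
  · rintro ⟨X, hX, Y, hY, rfl⟩
    exact (cLie Γ).add_mem (mem_cLie_of_mem hX) ((cLie Γ).smul_mem _ (mem_cLie_of_mem hY))

lemma conjTranspose_mem_cLie (hΓ : IsTransitiveGroup Γ) {Z : Matrix ι ι ℂ} (hZ : Z ∈ cLie Γ) :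
    Zᴴ ∈ cLie Γ := by
  obtain ⟨X, hX, Y, hY, rfl⟩ := hΓ.mem_cLie_iff.1 hZ
  rw [conjTranspose_add, conjTranspose_smul, hΓ.conjTranspose_eq_neg hX, hΓ.conjTranspose_eq_neg hY]
  exact (cLie Γ).add_mem ((cLie Γ).neg_mem (mem_cLie_of_mem hX))
    ((cLie Γ).smul_mem _ ((cLie Γ).neg_mem (mem_cLie_of_mem hY)))

lemma commutator_mem_cLie (hΓ : IsTransitiveGroup Γ) {Z W : Matrix ι ι ℂ} (hZ : Z ∈ cLie Γ)
    (hW : W ∈ cLie Γ) : Z * W - W * Z ∈ cLie Γ := by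
  have hu := hΓ.toIsCompactUnitaryGroup
  obtain ⟨X, hX, Y, hY, rfl⟩ := hΓ.mem_cLie_iff.1 hZ
  obtain ⟨X', hX', Y', hY', rfl⟩ := hΓ.mem_cLie_iff.1 hW
  have h := fun {a b} (ha : a ∈ lieAlg Γ) (hb : b ∈ lieAlg Γ) =>
    mem_cLie_of_mem (commutator_mem_lieAlg hu ha hb)
  have := (cLie Γ).add_mem (h hX hX') ((cLie Γ).add_mem ((cLie Γ).smul_mem Complex.I (h hX hY'))
    ((cLie Γ).add_mem ((cLie Γ).smul_mem Complex.I (h hY hX'))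
      ((cLie Γ).smul_mem (Complex.I * Complex.I) (h hY hY'))))
  convert this using 1
  simp only [add_mul, mul_add, smul_mul_assoc, mul_smul_comm]
  module

lemma conj_mem_cLie (hΓ : IsTransitiveGroup Γ) {g Z : Matrix ι ι ℂ} (hg : g ∈ Γ)
    (hZ : Z ∈ cLie Γ) : g * Z * gᴴ ∈ cLie Γ := by
  have hu := hΓ.toIsCompactUnitaryGroup
  obtain ⟨X, hX, Y, hY, rfl⟩ := hΓ.mem_cLie_iff.1 hZ
  have : g * (X + Complex.I • Y) * gᴴ = g * X * gᴴ + Complex.I • (g * Y * gᴴ) := by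
    simp [mul_add, add_mul]
  rw [this]
  exact (cLie Γ).add_mem (mem_cLie_of_mem (conj_mem_lieAlg hu hg hX))
    ((cLie Γ).smul_mem _ (mem_cLie_of_mem (conj_mem_lieAlg hu hg hY)))

lemma sub_conjTranspose_mem (hΓ : IsTransitiveGroup Γ) {Z : Matrix ι ι ℂ} (hZ : Z ∈ cLie Γ) :
    Z - Zᴴ ∈ lieAlg Γ := by
  obtain ⟨X, hX, Y, hY, rfl⟩ := hΓ.mem_cLie_iff.1 hZ
  rw [conjTranspose_add, conjTranspose_smul, hΓ.conjTranspose_eq_neg hX, hΓ.conjTranspose_eq_neg hY]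
  convert smul_mem_lieAlg hX 2 using 1
  rw [RCLike.star_def, Complex.conj_I, two_smul]
  module

lemma I_smul_add_conjTranspose_mem (hΓ : IsTransitiveGroup Γ) {Z : Matrix ι ι ℂ}
    (hZ : Z ∈ cLie Γ) : Complex.I • (Z + Zᴴ) ∈ lieAlg Γ := by
  have h := hΓ.sub_conjTranspose_mem ((cLie Γ).smul_mem Complex.I hZ)
  rw [conjTranspose_smul, RCLike.star_def, Complex.conj_I] at h
  convert h using 1
  module

lemma I_smul_mem_of_isHermitian (hΓ : IsTransitiveGroup Γ) {H : Matrix ι ι ℂ}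
    (hH : H ∈ cLie Γ) (h : Hᴴ = H) : Complex.I • H ∈ lieAlg Γ := by
  have h2 := smul_mem_lieAlg (hΓ.I_smul_add_conjTranspose_mem hH) (1 / 2 : ℝ)
  rw [h] at h2
  convert h2 using 1
  ext i j
  apply Complex.ext <;> simp <;> ring

lemma exists_mem_lieAlg_mulVec_eq_of_real (hΓ : IsTransitiveGroup Γ) {x u : ι → ℂ}
    (hx : star x = x) (hx0 : x ≠ 0) (hu : star u = u) (hux : u ⬝ᵥ x = 0) :
    ∃ X ∈ lieAlg Γ, X *ᵥ x = u := by
  by_cases hu0 : u = 0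
  · exact ⟨0, zero_mem_lieAlg hΓ.toIsCompactUnitaryGroup, by simp [hu0]⟩
  obtain ⟨a, ha, ha1⟩ := exists_smul_nsq_eq_one hx0
  obtain ⟨b, hb, hb1⟩ := exists_smul_nsq_eq_one hu0
  have hxs : star ((a : ℂ) • x) = (a : ℂ) • x := by
    rw [star_smul, hx, RCLike.star_def, Complex.conj_ofReal]
  have hus : star ((b : ℂ) • u) = (b : ℂ) • u := by
    rw [star_smul, hu, RCLike.star_def, Complex.conj_ofReal]
  obtain ⟨X, hX, hXx⟩ := hΓ.exists_mem_lieAlg_mulVec_eq hxs hus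
    (by conv_lhs => rw [← hxs, hxs]; arg 1; rw [← hxs]
        rw [star_dotProduct_self_eq, ha1]; simp)
    (by conv_lhs => rw [← hus, hus]; arg 1; rw [← hus]
        rw [star_dotProduct_self_eq, hb1]; simp)
    (by rw [smul_dotProduct, dotProduct_smul, hux]; simp)
  refine ⟨(b⁻¹ * a) • X, smul_mem_lieAlg hX _, ?_⟩
  rw [mulVec_smul] at hXx
  have : (b⁻¹ * a) • X *ᵥ x = ((b : ℂ)⁻¹) • ((a : ℂ) • X *ᵥ x) := by
    ext i; simp [mul_assoc]
  rw [smul_mulVec, this, hXx, smul_smul, inv_mul_cancel₀ (by exact_mod_cast hb.ne'), one_smul]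

lemma exists_mem_cLie_mulVec_eq (hΓ : IsTransitiveGroup Γ) {x y : ι → ℂ} (hx : star x = x)
    (hx0 : x ≠ 0) (hyx : y ⬝ᵥ x = 0) : ∃ Z ∈ cLie Γ, Z *ᵥ x = y := by
  have hyx' : star y ⬝ᵥ x = 0 := by
    have := congrArg star hyx
    rwa [← star_dotProduct_star, hx, star_zero, dotProduct_comm] at this
  obtain ⟨X, hX, hXx⟩ := hΓ.exists_mem_lieAlg_mulVec_eq_of_real (u := y + star y) hx hx0
    (by rw [star_add, star_star, add_comm]) (by rw [add_dotProduct, hyx, hyx', add_zero])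
  obtain ⟨Y, hY, hYx⟩ := hΓ.exists_mem_lieAlg_mulVec_eq_of_real
    (u := Complex.I • (star y - y)) hx hx0
    (by rw [star_smul, star_sub, star_star, RCLike.star_def, Complex.conj_I]; module)
    (by rw [smul_dotProduct, sub_dotProduct, hyx, hyx', sub_zero, smul_zero])
  refine ⟨(1 / 2 : ℂ) • (X + Complex.I • Y), (cLie Γ).smul_mem _
    (hΓ.mem_cLie_iff.2 ⟨X, hX, Y, hY, rfl⟩), ?_⟩
  rw [smul_mulVec, add_mulVec, smul_mulVec, hXx, hYx, smul_smul, Complex.I_mul_I]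
  module

lemma trace_mul_re (hΓ : IsTransitiveGroup Γ) {X Y : Matrix ι ι ℂ}
    (hX : X ∈ lieAlg Γ) (hY : Y ∈ lieAlg Γ) : ((trace (X * Y)).re : ℂ) = trace (X * Y) := by
  rw [← Complex.conj_eq_iff_re, starRingEnd_apply, ← trace_conjTranspose, conjTranspose_mul,
    hΓ.conjTranspose_eq_neg hX, hΓ.conjTranspose_eq_neg hY, neg_mul_neg, trace_mul_comm]

/-- Maximal orthonormal commuting families exist. -/
theorem exists_isCartan (hΓ : IsTransitiveGroup Γ) :
    ∃ (r : ℕ) (A : Fin r → Matrix ι ι ℂ), IsCartan Γ A := by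
  have hu := hΓ.toIsCompactUnitaryGroup
  let P : ℕ → Prop := fun r => ∃ A : Fin r → Matrix ι ι ℂ, (∀ j, A j ∈ lieAlg Γ) ∧
    (∀ i j, A i * A j = A j * A i) ∧ ∀ i j, trace (A i * A j) = if i = j then -1 else 0
  have hP0 : P 0 := ⟨fun i => i.elim0, fun i => i.elim0, fun i => i.elim0, fun i => i.elim0⟩
  have hbd : ∀ r, P r → r ≤ Module.finrank ℂ (Matrix ι ι ℂ) := by
    rintro r ⟨A, -, -, h⟩
    have hli : LinearIndependent ℂ A := by
      rw [Fintype.linearIndependent_iff]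
      intro c hc i
      have h1 := congrArg (fun M => trace (A i * M)) hc
      simpa [Finset.mul_sum, trace_sum, h] using h1
    simpa using hli.fintype_card_le_finrank
  classical
  set r := Nat.findGreatest P (Module.finrank ℂ (Matrix ι ι ℂ)) with hr
  have hPr : P r := Nat.findGreatest_spec (Nat.zero_le _) hP0
  obtain ⟨A, hA, hcomm, horth⟩ := hPr
  refine ⟨r, A, hA, hcomm, horth, fun B hB hBc => ?_⟩
  let c : Fin r → ℝ := fun j => -(trace (A j * B)).re
  set D := B - ∑ j, c j • A j with hD
  have hsum : ∑ j, c j • A j ∈ lieSubmodule hu :=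
    (lieSubmodule hu).sum_mem fun j _ => (lieSubmodule hu).smul_mem _ (hA j)
  have hDmem : D ∈ lieAlg Γ := (lieSubmodule hu).sub_mem hB hsum
  have hDc : ∀ j, A j * D = D * A j := fun j => by
    simp only [hD, mul_sub, sub_mul, Finset.mul_sum, Finset.sum_mul, mul_smul_comm,
      smul_mul_assoc, hBc, hcomm]
  have htr : ∀ j, trace (A j * D) = 0 := fun j => by
    have e : trace (A j * B) = ((trace (A j * B)).re : ℂ) := (hΓ.trace_mul_re (hA j) hB).symm
    simp only [hD, mul_sub, Finset.mul_sum, mul_smul_comm, trace_sub, trace_sum, trace_smul, horth]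
    simp only [c, smul_ite, smul_zero, Finset.sum_ite_eq, Finset.mem_univ, if_true]
    rw [e]
    simp
  refine ⟨c, sub_eq_zero.1 ?_⟩
  by_contra hD0
  have hN : 0 < frobSq D := lt_of_le_of_ne (frobSq_nonneg D) fun h => hD0 (frobSq_eq_zero.1 h.symm)
  have hDD : trace (D * D) = -(frobSq D : ℂ) := by
    rw [← trace_conjTranspose_mul_self, hΓ.conjTranspose_eq_neg hDmem, neg_mul, trace_neg, neg_neg]
  set s := (Real.sqrt (frobSq D))⁻¹ with hs
  have hss : s * s * frobSq D = 1 := by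
    rw [hs, ← mul_inv, Real.mul_self_sqrt hN.le, inv_mul_cancel₀ hN.ne']
  have hP : P (r + 1) := by
    refine ⟨Fin.snoc A (s • D), ?_, ?_, ?_⟩
    · intro j
      refine Fin.lastCases ?_ (fun j => ?_) j
      · simpa using smul_mem_lieAlg hDmem s
      · simpa using hA j
    · intro i j
      refine Fin.lastCases ?_ (fun i => ?_) i <;> refine Fin.lastCases ?_ (fun j => ?_) j
      · rfl
      · simp [hDc]
      · simp [hDc]
      · simp [hcomm]
    · intro i j
      refine Fin.lastCases ?_ (fun i => ?_) i <;> refine Fin.lastCases ?_ (fun j => ?_) j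
      · simp only [Fin.snoc_last, if_true, smul_mul_smul_comm, trace_smul, hDD]
        rw [Complex.real_smul, mul_neg, ← Complex.ofReal_mul, hss]
        simp
      · simp [trace_mul_comm D, htr, (Fin.castSucc_lt_last j).ne']
      · simp [htr, (Fin.castSucc_lt_last i).ne]
      · simp [horth]
  have := Nat.le_findGreatest (hbd _ hP) hP
  omega

end IsTransitiveGroup

end TransitiveSphere

namespace TransitiveSphere

open Filter Topology Matrix
open scoped Matrix.Norms.L2Operator

variable {ι : Type*} [Fintype ι] [DecidableEq ι] {r : ℕ}

/-- The weight space of a commuting family of skew-Hermitian matrices. -/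
def Wt (A : Fin r → Matrix ι ι ℂ) (τ : Fin r → ℝ) : Submodule ℂ (ι → ℂ) where
  carrier := {z | ∀ j, A j *ᵥ z = (Complex.I * τ j) • z}
  add_mem' ha hb j := by rw [mulVec_add, ha j, hb j, smul_add]
  zero_mem' j := by simp
  smul_mem' c z hz j := by rw [mulVec_smul, hz j, smul_comm]

/-- The root space of the complexified Lie algebra. -/
def Rt (Γ : Set (Matrix ι ι ℂ)) (A : Fin r → Matrix ι ι ℂ) (α : Fin r → ℝ) :
    Submodule ℂ (Matrix ι ι ℂ) where
  carrier := {Z | Z ∈ cLie Γ ∧ ∀ j, A j * Z - Z * A j = (Complex.I * α j) • Z}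
  add_mem' ha hb := ⟨(cLie Γ).add_mem ha.1 hb.1, fun j => by
    rw [smul_add, ← ha.2 j, ← hb.2 j]; noncomm_ring⟩
  zero_mem' := ⟨(cLie Γ).zero_mem, fun j => by simp⟩
  smul_mem' c Z hZ := ⟨(cLie Γ).smul_mem c hZ.1, fun j => by
    rw [smul_comm, ← hZ.2 j, mul_smul_comm, smul_mul_assoc, smul_sub]⟩

variable {Γ : Set (Matrix ι ι ℂ)} {A : Fin r → Matrix ι ι ℂ}

lemma mulVec_mem_Wt {α τ : Fin r → ℝ} {Z : Matrix ι ι ℂ} {z : ι → ℂ} (hZ : Z ∈ Rt Γ A α)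
    (hz : z ∈ Wt A τ) : Z *ᵥ z ∈ Wt A (τ + α) := fun j => by
  have h : A j * Z = Z * A j + (Complex.I * α j) • Z := by rw [← hZ.2 j]; abel
  rw [mulVec_mulVec, h, add_mulVec, ← mulVec_mulVec, hz j, mulVec_smul, smul_mulVec, ← add_smul,
    Pi.add_apply]
  push_cast
  ring_nf

lemma commutator_mem_Rt (hΓ : IsTransitiveGroup Γ) {α β : Fin r → ℝ} {Z W : Matrix ι ι ℂ}
    (hZ : Z ∈ Rt Γ A α) (hW : W ∈ Rt Γ A β) : Z * W - W * Z ∈ Rt Γ A (α + β) := by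
  refine ⟨hΓ.commutator_mem_cLie hZ.1 hW.1, fun j => ?_⟩
  have h1 : A j * Z = Z * A j + (Complex.I * α j) • Z := by rw [← hZ.2 j]; abel
  have h2 : A j * W = W * A j + (Complex.I * β j) • W := by rw [← hW.2 j]; abel
  have h3 : A j * (Z * W) = Z * W * A j + (Complex.I * α j + Complex.I * β j) • (Z * W) := by
    rw [← mul_assoc, h1, add_mul, mul_assoc, h2, mul_add, ← mul_assoc, mul_smul_comm,
      smul_mul_assoc]
    module
  have h4 : A j * (W * Z) = W * Z * A j + (Complex.I * α j + Complex.I * β j) • (W * Z) := by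
    rw [← mul_assoc, h2, add_mul, mul_assoc, h1, mul_add, ← mul_assoc, mul_smul_comm,
      smul_mul_assoc]
    module
  rw [mul_sub, h3, h4, sub_mul, Pi.add_apply]
  push_cast
  module

lemma exp_mulVec_re_eq_zero (w v : ι → ℂ) (X : Matrix ι ι ℂ)
    (hmax : ∀ t : ℝ, (star w ⬝ᵥ (NormedSpace.exp (t • X) *ᵥ v)).re ≤ (star w ⬝ᵥ v).re) :
    (star w ⬝ᵥ (X *ᵥ v)).re = 0 := by
  let L : Matrix ι ι ℂ →ₗ[ℝ] ℝ :=
    { toFun := fun N => (star w ⬝ᵥ (N *ᵥ v)).re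
      map_add' := fun a b => by rw [add_mulVec, dotProduct_add, Complex.add_re]
      map_smul' := fun a b => by
        rw [smul_mulVec, dotProduct_smul, Complex.real_smul, Complex.re_ofReal_mul]; rfl }
  have h := (LinearMap.toContinuousLinearMap L).hasFDerivAt.comp_hasDerivAt (0 : ℝ)
    (hasDerivAt_exp_smul_zero X)
  refine IsLocalMax.hasDerivAt_eq_zero (Eventually.of_forall fun t => ?_) h
  simpa [L] using hmax t

namespace IsCartan

lemma sum_smul_mem (hA : IsCartan Γ A) (hΓ : IsTransitiveGroup Γ) (c : Fin r → ℝ) :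
    ∑ j, c j • A j ∈ lieAlg Γ :=
  (lieSubmodule hΓ.toIsCompactUnitaryGroup).sum_mem fun j _ =>
    (lieSubmodule hΓ.toIsCompactUnitaryGroup).smul_mem _ (hA.mem j)

end IsCartan

lemma sum_smul_mulVec (c : Fin r → ℝ) {τ : Fin r → ℝ} {z : ι → ℂ} (hz : z ∈ Wt A τ) :
    (∑ j, c j • A j) *ᵥ z = (Complex.I * ((c ⬝ᵥ τ : ℝ) : ℂ)) • z := by
  rw [sum_mulVec, dotProduct, Complex.ofReal_sum, Finset.mul_sum, Finset.sum_smul]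
  refine Finset.sum_congr rfl fun j _ => ?_
  rw [smul_mulVec, hz j]
  ext i
  simp
  ring

lemma exp_sum_smul_mulVec (c : Fin r → ℝ) {τ : Fin r → ℝ} {z : ι → ℂ} (hz : z ∈ Wt A τ) :
    NormedSpace.exp (∑ j, c j • A j) *ᵥ z =
      Complex.exp (Complex.I * ((c ⬝ᵥ τ : ℝ) : ℂ)) • z :=
  exp_mulVec_of_mulVec_eq_smul (sum_smul_mulVec c hz)

namespace IsCartan

variable (hA : IsCartan Γ A) (hΓ : IsTransitiveGroup Γ)
include hA hΓ

lemma star_mem_Wt {τ : Fin r → ℝ} {z : ι → ℂ} (hz : z ∈ Wt A τ) : star z ∈ Wt A (-τ) :=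
  fun j => by
    rw [← star_mulVec_of_transpose_eq (hΓ.transpose_eq_of_mem_lieAlg (hA.mem j)), hz j, star_smul]
    simp

lemma conjTranspose_mem_Rt {α : Fin r → ℝ} {Z : Matrix ι ι ℂ} (hZ : Z ∈ Rt Γ A α) :
    Zᴴ ∈ Rt Γ A (-α) := by
  refine ⟨hΓ.conjTranspose_mem_cLie hZ.1, fun j => ?_⟩
  have h := congrArg conjTranspose (hZ.2 j)
  rw [conjTranspose_sub, conjTranspose_mul, conjTranspose_mul, conjTranspose_smul,
    hΓ.conjTranspose_eq_neg (hA.mem j)] at h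
  simp only [RCLike.star_def, map_mul, Complex.conj_I, Complex.conj_ofReal] at h
  rw [Pi.neg_apply, Complex.ofReal_neg, mul_neg, ← neg_mul, ← h]
  noncomm_ring

lemma iSup_Wt : ⨆ τ, Wt A τ = ⊤ := by
  have h := iSup_iInf_eigenspace_eq_top (vecCore ι) (fun j => mulVecLin ((-Complex.I) • A j))
    (fun j u v => by
      change star _ ⬝ᵥ _ = star _ ⬝ᵥ _
      rw [mulVecLin_apply, mulVecLin_apply, star_mulVec_dotProduct, conjTranspose_smul,
        hΓ.conjTranspose_eq_neg (hA.mem j)]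
      rw [star_neg, RCLike.star_def, Complex.conj_I, neg_neg, smul_neg, neg_smul])
    (fun i j => by
      refine LinearMap.ext fun v => ?_
      change _ *ᵥ (_ *ᵥ v) = _ *ᵥ (_ *ᵥ v)
      rw [mulVec_mulVec, mulVec_mulVec, smul_mul_smul_comm, smul_mul_smul_comm, hA.comm i j])
  rw [← h]
  congr 1
  ext τ z
  simp only [Submodule.mem_iInf, Module.End.mem_eigenspace_iff, mulVecLin_apply]
  refine forall_congr' fun j => ?_
  rw [smul_mulVec]
  constructor
  · intro hz
    rw [hz, smul_smul, ← mul_assoc]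
    simp
  · intro hz
    rw [mul_smul, ← hz, smul_smul]
    simp

lemma orthogonal {τ σ : Fin r → ℝ} (h : τ ≠ σ) {z w : ι → ℂ} (hz : z ∈ Wt A τ)
    (hw : w ∈ Wt A σ) : star z ⬝ᵥ w = 0 := by
  obtain ⟨j, hj⟩ := Function.ne_iff.1 h
  have h1 : star z ⬝ᵥ (A j *ᵥ w) = (Complex.I * σ j) * (star z ⬝ᵥ w) := by
    rw [hw j, dotProduct_smul, smul_eq_mul]
  rw [star_dotProduct_mulVec, hΓ.conjTranspose_eq_neg (hA.mem j), neg_mulVec, hz j, star_neg,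
    star_smul, neg_dotProduct, smul_dotProduct, RCLike.star_def, map_mul, Complex.conj_I,
    Complex.conj_ofReal, smul_eq_mul] at h1
  have h2 : Complex.I * ((τ j : ℂ) - σ j) * (star z ⬝ᵥ w) = 0 := by linear_combination h1
  refine (mul_eq_zero.1 h2).resolve_left (mul_ne_zero Complex.I_ne_zero ?_)
  rw [sub_ne_zero]
  exact_mod_cast hj

lemma mem_iSup_Rt {Z : Matrix ι ι ℂ} (hZ : Z ∈ cLie Γ) : Z ∈ ⨆ α, Rt Γ A α := by
  let T : Fin r → Module.End ℂ (cLie Γ) := fun j =>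
    { toFun := fun Y => ⟨(-Complex.I) • (A j * Y - Y * A j), (cLie Γ).smul_mem _
        (hΓ.commutator_mem_cLie (mem_cLie_of_mem (hA.mem j)) Y.2)⟩
      map_add' := fun Y Y' => Subtype.ext (by
        simp only [Submodule.coe_add]
        rw [← smul_add]; congr 1; noncomm_ring)
      map_smul' := fun c Y => Subtype.ext (by
        simp only [Submodule.coe_smul, RingHom.id_apply]
        rw [mul_smul_comm, smul_mul_assoc]; module) }
  have hT : ∀ j (Y : cLie Γ), ((T j Y : cLie Γ) : Matrix ι ι ℂ) =
      (-Complex.I) • (A j * Y - Y * A j) := fun j Y => rfl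
  have h := iSup_iInf_eigenspace_eq_top (matCore (cLie Γ)) T
    (fun j u v => by
      change trace ((_ : Matrix ι ι ℂ)ᴴ * _) = trace ((_ : Matrix ι ι ℂ)ᴴ * _)
      rw [hT, hT, conjTranspose_smul, conjTranspose_sub, conjTranspose_mul, conjTranspose_mul,
        hΓ.conjTranspose_eq_neg (hA.mem j), smul_mul_assoc, mul_smul_comm, trace_smul, trace_smul,
        mul_sub, sub_mul, trace_sub, trace_sub, mul_neg, neg_mul, neg_mul, neg_mul, trace_neg,
        trace_neg, mul_assoc, mul_assoc, trace_mul_comm (A j), mul_assoc]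
      simp
      ring)
    (fun i j => by
      change _ * _ = _ * _
      ext1 Y
      refine Subtype.ext ?_
      simp only [Module.End.mul_apply, hT, mul_smul_comm, smul_mul_assoc, ← smul_sub]
      congr 2
      have h1 : A i * (A j * Y) = A j * (A i * Y) := by rw [← mul_assoc, hA.comm, mul_assoc]
      have h2 : (Y : Matrix ι ι ℂ) * A i * A j = Y * A j * A i := by
        rw [mul_assoc, hA.comm, mul_assoc]
      simp only [mul_sub, sub_mul, h1, h2, mul_assoc]
      abel)
  have hmem : (⟨Z, hZ⟩ : cLie Γ) ∈ ⨆ χ : Fin r → ℝ, ⨅ j, Module.End.eigenspace (T j) (χ j : ℂ) := by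
    rw [h]; trivial
  have hle : (⨆ χ : Fin r → ℝ, ⨅ j, Module.End.eigenspace (T j) (χ j : ℂ)).map (cLie Γ).subtype ≤
      ⨆ α, Rt Γ A α := by
    rw [Submodule.map_iSup]
    refine iSup_mono fun χ => ?_
    rintro _ ⟨Y, hY, rfl⟩
    refine ⟨Y.2, fun j => ?_⟩
    have hY' := congrArg (fun y : cLie Γ => Complex.I • (y : Matrix ι ι ℂ))
      (Module.End.mem_eigenspace_iff.1 ((Submodule.mem_iInf _).1 hY j))
    simpa [hT, smul_smul, mul_smul] using hY'
  exact hle ⟨_, hmem, rfl⟩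

/-- Matrix coefficients of the complexified Lie algebra between weight vectors are determined by
one root space. -/
lemma star_dotProduct_mulVec_eq_zero {ω ω' : Fin r → ℝ} {x y : ι → ℂ} (hx : x ∈ Wt A ω)
    (hy : y ∈ Wt A ω') (h : ∀ Z ∈ Rt Γ A (ω' - ω), star y ⬝ᵥ (Z *ᵥ x) = 0) {Z : Matrix ι ι ℂ}
    (hZ : Z ∈ cLie Γ) : star y ⬝ᵥ (Z *ᵥ x) = 0 := by
  have hZ' := hA.mem_iSup_Rt hΓ hZ
  induction hZ' using Submodule.iSup_induction' with
  | mem α Z hZα =>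
    by_cases hα : α = ω' - ω
    · subst hα; exact h Z hZα
    · refine hA.orthogonal hΓ ?_ hy (mulVec_mem_Wt hZα hx)
      rintro rfl
      exact hα (by abel)
  | zero => simp
  | add Y W hY hW h1 h2 =>
    have hle : ⨆ α, Rt Γ A α ≤ cLie Γ := iSup_le fun α Y hY => hY.1
    rw [add_mulVec, dotProduct_add, h1 (hle hY), h2 (hle hW), add_zero]

lemma exists_eq_sum_of_mem_Rt_zero {Z : Matrix ι ι ℂ} (hZ : Z ∈ Rt Γ A 0) :
    ∃ c : Fin r → ℂ, Z = ∑ j, c j • A j := by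
  have hc : ∀ j, A j * Z = Z * A j := fun j => by
    have := hZ.2 j
    simpa [sub_eq_zero] using this
  have hZ' := hA.conjTranspose_mem_Rt hΓ hZ
  have hc' : ∀ j, A j * Zᴴ = Zᴴ * A j := fun j => by
    have := hZ'.2 j
    simpa [sub_eq_zero] using this
  obtain ⟨a, ha⟩ := hA.maximal _ (hΓ.sub_conjTranspose_mem hZ.1) (fun j => by
    rw [mul_sub, sub_mul, hc, hc'])
  obtain ⟨b, hb⟩ := hA.maximal _ (hΓ.I_smul_add_conjTranspose_mem hZ.1) (fun j => by
    rw [mul_smul_comm, smul_mul_assoc, mul_add, add_mul, hc, hc'])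
  refine ⟨fun j => (1 / 2 : ℂ) * (a j - Complex.I * b j), ?_⟩
  have e : Z = (1 / 2 : ℂ) • ((Z - Zᴴ) - Complex.I • (Complex.I • (Z + Zᴴ))) := by
    rw [smul_smul, Complex.I_mul_I]; module
  rw [e, ha, hb, Finset.smul_sum, ← Finset.sum_sub_distrib, Finset.smul_sum]
  refine Finset.sum_congr rfl fun j _ => ?_
  ext k l
  simp
  ring

lemma mulVec_of_mem_Rt_zero {Z : Matrix ι ι ℂ} (hZ : Z ∈ Rt Γ A 0) (τ : Fin r → ℝ) :
    ∃ c : ℂ, ∀ z ∈ Wt A τ, Z *ᵥ z = c • z := by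
  obtain ⟨c, rfl⟩ := hA.exists_eq_sum_of_mem_Rt_zero hΓ hZ
  refine ⟨∑ j, c j * (Complex.I * τ j), fun z hz => ?_⟩
  rw [sum_mulVec, Finset.sum_smul]
  refine Finset.sum_congr rfl fun j _ => ?_
  rw [smul_mulVec, hz j, smul_smul]

lemma I_smul_commutator {α : Fin r → ℝ} {X : Matrix ι ι ℂ} (hX : X ∈ Rt Γ A α) :
    Complex.I • (X * Xᴴ - Xᴴ * X) = ∑ j, (frobSq X * α j) • A j := by
  have hXH := hA.conjTranspose_mem_Rt hΓ hX
  have h0 : X * Xᴴ - Xᴴ * X ∈ Rt Γ A 0 := by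
    simpa using commutator_mem_Rt hΓ hX hXH
  have hmem : Complex.I • (X * Xᴴ - Xᴴ * X) ∈ lieAlg Γ :=
    hΓ.I_smul_mem_of_isHermitian h0.1 (by simp)
  obtain ⟨c, hc⟩ := hA.maximal _ hmem (fun j => by
    have := h0.2 j
    simp only [Pi.zero_apply, Complex.ofReal_zero, mul_zero, zero_smul, sub_eq_zero] at this
    rw [mul_smul_comm, smul_mul_assoc, this])
  rw [hc]
  refine Finset.sum_congr rfl fun j _ => ?_
  congr 1
  have h1 : trace (A j * (Complex.I • (X * Xᴴ - Xᴴ * X))) = -(c j : ℂ) := by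
    rw [hc, Finset.mul_sum, trace_sum]
    simp only [mul_smul_comm, trace_smul, hA.orth, smul_ite, smul_zero, Finset.sum_ite_eq,
      Finset.mem_univ, if_true]
    simp
  have h2 : trace (A j * (X * Xᴴ - Xᴴ * X)) = Complex.I * α j * frobSq X := by
    have h3 : trace (A j * (Xᴴ * X)) = trace (X * A j * Xᴴ) := by
      rw [← mul_assoc, trace_mul_comm, ← mul_assoc]
    rw [mul_sub, trace_sub, h3, ← mul_assoc, ← trace_sub, ← sub_mul, hX.2 j, smul_mul_assoc,
      trace_smul, trace_mul_comm, trace_conjTranspose_mul_self, smul_eq_mul]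
  rw [mul_smul_comm, trace_smul, h2, smul_eq_mul] at h1
  have h4 : (c j : ℂ) = frobSq X * α j := by
    linear_combination h1 - (α j * frobSq X : ℂ) * Complex.I_mul_I
  exact_mod_cast h4

lemma commutator_mulVec {α ω : Fin r → ℝ} {X : Matrix ι ι ℂ} (hX : X ∈ Rt Γ A α) {z : ι → ℂ}
    (hz : z ∈ Wt A ω) :
    (X * Xᴴ - Xᴴ * X) *ᵥ z = ((frobSq X * (α ⬝ᵥ ω) : ℝ) : ℂ) • z := by
  have h := congrArg (fun M => (-Complex.I) • (M *ᵥ z)) (hA.I_smul_commutator hΓ hX)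
  simp only [smul_mulVec, smul_smul] at h
  rw [sum_smul_mulVec (fun j => frobSq X * α j) hz, smul_smul] at h
  have e : (fun j => frobSq X * α j) ⬝ᵥ ω = frobSq X * (α ⬝ᵥ ω) := by
    rw [dotProduct, dotProduct, Finset.mul_sum]
    exact Finset.sum_congr rfl fun j _ => mul_assoc _ _ _
  rw [e] at h
  have e2 : -Complex.I * (Complex.I * ((frobSq X * (α ⬝ᵥ ω) : ℝ) : ℂ)) =
      ((frobSq X * (α ⬝ᵥ ω) : ℝ) : ℂ) := by
    rw [← mul_assoc, neg_mul, Complex.I_mul_I, neg_neg, one_mul]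
  rw [e2] at h
  simpa [Complex.I_mul_I] using h

lemma nsq_conjTranspose_sub_nsq {α ω : Fin r → ℝ} {X : Matrix ι ι ℂ} (hX : X ∈ Rt Γ A α)
    {z : ι → ℂ} (hz : z ∈ Wt A ω) :
    nsq (Xᴴ *ᵥ z) - nsq (X *ᵥ z) = frobSq X * (α ⬝ᵥ ω) * nsq z := by
  have h := congrArg (fun v => star z ⬝ᵥ v) (hA.commutator_mulVec hΓ hX hz)
  simp only [sub_mulVec, ← mulVec_mulVec, dotProduct_sub, dotProduct_smul, smul_eq_mul] at h
  rw [← star_mulVec_dotProduct, star_dotProduct_mulVec X, star_dotProduct_self_eq,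
    star_dotProduct_self_eq, star_dotProduct_self_eq] at h
  exact_mod_cast h

lemma mulVec_ne_zero {α ω : Fin r → ℝ} {X : Matrix ι ι ℂ} (hX : X ∈ Rt Γ A α) (hX0 : X ≠ 0)
    {z : ι → ℂ} (hz : z ∈ Wt A ω) (hz0 : z ≠ 0) (h : α ⬝ᵥ ω < 0) : X *ᵥ z ≠ 0 := by
  intro h0
  have h1 := hA.nsq_conjTranspose_sub_nsq hΓ hX hz
  rw [h0, nsq_eq_zero.2 rfl] at h1
  have hN : 0 < frobSq X := lt_of_le_of_ne (frobSq_nonneg X) fun h => hX0 (frobSq_eq_zero.1 h.symm)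
  have := mul_neg_of_neg_of_pos (mul_neg_of_pos_of_neg hN h) (nsq_pos hz0)
  have := nsq_nonneg (Xᴴ *ᵥ z)
  linarith

omit hΓ hA in
lemma finite_weights (A : Fin r → Matrix ι ι ℂ) : {τ | Wt A τ ≠ ⊥}.Finite := by
  have h : ∀ j, {c : ℝ | Module.End.HasEigenvalue (mulVecLin (A j)) (Complex.I * c)}.Finite := by
    intro j
    have hf := Module.End.finite_hasEigenvalue (mulVecLin (A j))
    refine Set.Finite.preimage (f := fun c : ℝ => Complex.I * c) ?_ hf
    intro a _ b _ hab
    have := mul_left_cancel₀ Complex.I_ne_zero hab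
    exact_mod_cast this
  refine (Set.Finite.pi h).subset fun τ hτ => ?_
  obtain ⟨v, hv, hv0⟩ := Submodule.exists_mem_ne_zero_of_ne_bot hτ
  intro j _
  exact Module.End.hasEigenvalue_of_hasEigenvector
    ⟨Module.End.mem_eigenspace_iff.2 (by simpa using hv j), hv0⟩

end IsCartan

end TransitiveSphere

namespace TransitiveSphere

open Filter Topology Matrix
open scoped Matrix.Norms.L2Operator

variable {ι : Type*} [Fintype ι] [DecidableEq ι] {r : ℕ}
variable {Γ : Set (Matrix ι ι ℂ)} {A : Fin r → Matrix ι ι ℂ}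

/-- A matrix coefficient attains its maximum over a compact set invariant under the identity
component, and there its infinitesimal variation vanishes. -/
lemma exists_mem_re_eq_zero {S : Set (Matrix ι ι ℂ)} (hS : IsCompact S) (hne : S.Nonempty)
    (hexp : ∀ X ∈ lieAlg Γ, ∀ g ∈ S, NormedSpace.exp X * g ∈ S) (w v : ι → ℂ) :
    ∃ g ∈ S, ∀ X ∈ lieAlg Γ, (star w ⬝ᵥ (X *ᵥ (g *ᵥ v))).re = 0 := by
  have hc : Continuous fun g : Matrix ι ι ℂ => (star w ⬝ᵥ (g *ᵥ v)).re :=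
    Complex.continuous_re.comp
      (continuous_const.dotProduct (continuous_id.matrix_mulVec continuous_const))
  obtain ⟨g, hg, hmax⟩ := hS.exists_isMaxOn hne hc.continuousOn
  refine ⟨g, hg, fun X hX => exp_mulVec_re_eq_zero w (g *ᵥ v) X fun t => ?_⟩
  rw [mulVec_mulVec]
  exact hmax (hexp _ (smul_mem_lieAlg hX t) g hg)

namespace IsTransitiveGroup

lemma exp_mul_mem (hΓ : IsTransitiveGroup Γ) :
    ∀ X ∈ lieAlg Γ, ∀ g ∈ Γ, NormedSpace.exp X * g ∈ Γ := fun _ hX _ hg =>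
  hΓ.mul_mem (exp_mem_of_mem_lieAlg hX) hg

lemma star_mulVec_dotProduct_mulVec (hΓ : IsTransitiveGroup Γ) {g : Matrix ι ι ℂ} (hg : g ∈ Γ)
    (u v : ι → ℂ) : star (g *ᵥ u) ⬝ᵥ (g *ᵥ v) = star u ⬝ᵥ v := by
  have := hΓ.star_mul_self hg
  rw [star_eq_conjTranspose] at this
  rw [star_mulVec_dotProduct, mulVec_mulVec, this, one_mulVec]

lemma nsq_mulVec (hΓ : IsTransitiveGroup Γ) {g : Matrix ι ι ℂ} (hg : g ∈ Γ) (u : ι → ℂ) :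
    nsq (g *ᵥ u) = nsq u := by
  have h := hΓ.star_mulVec_dotProduct_mulVec hg u u
  rw [star_dotProduct_self_eq, star_dotProduct_self_eq] at h
  exact_mod_cast h

/-- A compact set of orthogonal matrices invariant under the identity component is transitive on
lines. -/
theorem exists_mem_mulVec_eq_or_neg (hΓ : IsTransitiveGroup Γ) {S : Set (Matrix ι ι ℂ)}
    (hSΓ : S ⊆ Γ) (hS : IsCompact S) (hne : S.Nonempty)
    (hexp : ∀ X ∈ lieAlg Γ, ∀ g ∈ S, NormedSpace.exp X * g ∈ S) {x y : ι → ℂ}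
    (hx : star x = x) (hy : star y = y) (hxx : nsq x = 1) (hyy : nsq y = 1) :
    ∃ g ∈ S, g *ᵥ x = y ∨ g *ᵥ x = -y := by
  obtain ⟨g, hg, h⟩ := exists_mem_re_eq_zero hS hne hexp y x
  refine ⟨g, hg, ?_⟩
  set q := g *ᵥ x with hq
  have hqr : star q = q := by
    rw [hq, star_mulVec_of_transpose_eq (hΓ.transpose_eq (hSΓ hg)), hx]
  have hqq : q ⬝ᵥ q = 1 := by
    have := hΓ.star_mulVec_dotProduct_mulVec (hSΓ hg) x x
    rw [← hq, hqr] at this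
    rw [this, star_dotProduct_self_eq, hxx, Complex.ofReal_one]
  have hy1 : y ⬝ᵥ y = 1 := by
    conv_lhs => rw [← hy]
    rw [hy, ← hy, hy, ← Complex.ofReal_one, ← hyy, ← star_dotProduct_self_eq, hy]
  have hyqr : star (y ⬝ᵥ q) = y ⬝ᵥ q := by
    conv_lhs => rw [← hy, star_dotProduct_symm, hqr, dotProduct_comm]
  set c := y ⬝ᵥ q with hc
  have hq0 : q ≠ 0 := by rintro h0; rw [h0] at hqq; simp at hqq
  have hur : star (y - c • q) = y - c • q := by rw [star_sub, star_smul, hyqr, hqr, hy]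
  have huq : (y - c • q) ⬝ᵥ q = 0 := by
    rw [sub_dotProduct, smul_dotProduct, hqq, ← hc]; simp
  obtain ⟨X, hX, hXq⟩ := hΓ.exists_mem_lieAlg_mulVec_eq_of_real hqr hq0 hur huq
  have h1 := h X hX
  rw [hXq, hy] at h1
  have h2 : star (y - c • q) ⬝ᵥ (y - c • q) = y ⬝ᵥ (y - c • q) := by
    rw [hur, sub_dotProduct, smul_dotProduct, dotProduct_comm q, huq, smul_zero, sub_zero]
  rw [← h2, star_dotProduct_self_eq, Complex.ofReal_re, nsq_eq_zero, sub_eq_zero] at h1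
  have hc2 : c * c = 1 := by
    have := hy1
    rw [h1, smul_dotProduct, dotProduct_smul, hqq] at this
    simpa using this
  rcases mul_self_eq_one_iff.1 hc2 with h3 | h3
  · left; rw [h1, h3, one_smul]
  · right; rw [h1, h3]; simp

/-- At a critical point, matrix coefficients of the complexified Lie algebra are Hermitian. -/
lemma star_dotProduct_mulVec_comm (hΓ : IsTransitiveGroup Γ) {w v : ι → ℂ}
    (h : ∀ X ∈ lieAlg Γ, (star w ⬝ᵥ (X *ᵥ v)).re = 0) {Z : Matrix ι ι ℂ} (hZ : Z ∈ cLie Γ) :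
    star w ⬝ᵥ (Z *ᵥ v) = star v ⬝ᵥ (Z *ᵥ w) := by
  have h1 := h _ (hΓ.sub_conjTranspose_mem hZ)
  have h2 := h _ (hΓ.I_smul_add_conjTranspose_mem hZ)
  have h3 : star v ⬝ᵥ (Z *ᵥ w) = star (star w ⬝ᵥ (Zᴴ *ᵥ v)) := by
    rw [star_dotProduct_symm, star_mulVec_dotProduct, conjTranspose_conjTranspose]
  rw [h3]
  rw [sub_mulVec, dotProduct_sub, Complex.sub_re] at h1
  rw [smul_mulVec, add_mulVec, dotProduct_smul, dotProduct_add, smul_eq_mul] at h2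
  simp at h2
  apply Complex.ext
  · simp; linarith
  · simp; linarith

end IsTransitiveGroup

lemma nsq_smul (c : ℂ) (u : ι → ℂ) : nsq (c • u) = Complex.normSq c * nsq u := by
  have h : ((nsq (c • u) : ℝ) : ℂ) = (Complex.normSq c * nsq u : ℝ) := by
    rw [← star_dotProduct_self_eq, star_smul, smul_dotProduct, dotProduct_smul,
      star_dotProduct_self_eq, Complex.ofReal_mul, ← Complex.mul_conj, smul_eq_mul, smul_eq_mul,
      RCLike.star_def]
    ring
  exact_mod_cast h

/-- A real form of the projection onto a unit line. -/
lemma eq_smul_of_forall_orthogonal {W : Submodule ℂ (ι → ℂ)} {z : ι → ℂ} (hz : nsq z = 1)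
    (hzW : z ∈ W) (h : ∀ y ∈ W, star z ⬝ᵥ y = 0 → y = 0) {y : ι → ℂ} (hy : y ∈ W) :
    y = (star z ⬝ᵥ y) • z := by
  rw [← sub_eq_zero]
  refine h _ (W.sub_mem hy (W.smul_mem _ hzW)) ?_
  rw [dotProduct_sub, dotProduct_smul, star_dotProduct_self_eq, hz]
  simp

namespace IsCartan

variable (hA : IsCartan Γ A) (hΓ : IsTransitiveGroup Γ)

include hA hΓ

/-- A vector orthogonal to all weight spaces outside `S` lies in the span of those in `S`. -/
lemma mem_iSup_of_orthogonal {S : Set (Fin r → ℝ)} {v : ι → ℂ}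
    (h : ∀ τ ∉ S, ∀ y ∈ Wt A τ, star y ⬝ᵥ v = 0) : v ∈ ⨆ τ ∈ S, Wt A τ := by
  obtain ⟨w, hw, p, rfl, hp⟩ := exists_add_orthogonal (⨆ τ ∈ S, Wt A τ) v
  have hwo : ∀ τ ∉ S, ∀ y ∈ Wt A τ, star y ⬝ᵥ w = 0 := by
    intro τ hτ y hy
    clear h
    induction hw using Submodule.iSup_induction' with
    | mem σ w hw =>
      by_cases hσ : σ ∈ S
      · simp only [hσ, iSup_pos] at hw
        exact hA.orthogonal hΓ (by rintro rfl; exact hτ hσ) hy hw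
      · simp only [hσ] at hw
        simp at hw
        simp [hw]
    | zero => simp
    | add a b _ _ ha hb => rw [dotProduct_add, ha, hb, add_zero]
  have hp0 : ∀ y : ι → ℂ, star y ⬝ᵥ p = 0 := by
    intro y
    have hy : y ∈ ⨆ τ, Wt A τ := by rw [hA.iSup_Wt hΓ]; trivial
    induction hy using Submodule.iSup_induction' with
    | mem τ y hy =>
      by_cases hτ : τ ∈ S
      · exact hp y (Submodule.mem_iSup_of_mem τ (Submodule.mem_iSup_of_mem hτ hy))
      · have := h τ hτ y hy
        rwa [dotProduct_add, hwo τ hτ y hy, zero_add] at this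
    | zero => simp
    | add a b _ _ ha hb => rw [star_add, add_dotProduct, ha, hb, add_zero]
  have : p = 0 := by
    have := hp0 p
    rw [star_dotProduct_self_eq] at this
    exact nsq_eq_zero.1 (by exact_mod_cast this)
  rw [this, add_zero]
  exact hw

lemma neg_ne_bot {τ : Fin r → ℝ} (h : Wt A τ ≠ ⊥) : Wt A (-τ) ≠ ⊥ := by
  obtain ⟨z, hz, hz0⟩ := Submodule.exists_mem_ne_zero_of_ne_bot h
  exact fun hb => hz0 (by
    have := (Submodule.eq_bot_iff _).1 hb _ (hA.star_mem_Wt hΓ hz)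
    simpa using this)

lemma dotProduct_eq_zero {τ σ : Fin r → ℝ} (h : τ + σ ≠ 0) {y z : ι → ℂ} (hy : y ∈ Wt A τ)
    (hz : z ∈ Wt A σ) : y ⬝ᵥ z = 0 := by
  have := hA.orthogonal hΓ (τ := -τ) (σ := σ) (fun e => h (by rw [← e]; simp))
    (hA.star_mem_Wt hΓ hy) hz
  rwa [star_star] at this

/-- Vectors orthogonal to a real vector and to its images under root vectors vanish. -/
lemma eq_zero_of_star_dotProduct_mulVec {ω₁ ω₂ ω' : Fin r → ℝ} {x₁ x₂ y : ι → ℂ}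
    (h₁ : x₁ ∈ Wt A ω₁) (h₂ : x₂ ∈ Wt A ω₂) (hr : star (x₁ + x₂) = x₁ + x₂) (h0 : x₁ + x₂ ≠ 0)
    (hy : y ∈ Wt A ω') (hyx : y ⬝ᵥ (x₁ + x₂) = 0)
    (hZ₁ : ∀ Z ∈ Rt Γ A (ω' - ω₁), star y ⬝ᵥ (Z *ᵥ x₁) = 0)
    (hZ₂ : ∀ Z ∈ Rt Γ A (ω' - ω₂), star y ⬝ᵥ (Z *ᵥ x₂) = 0) : y = 0 := by
  obtain ⟨Z, hZ, hZx⟩ := hΓ.exists_mem_cLie_mulVec_eq hr h0 hyx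
  have h : star y ⬝ᵥ (Z *ᵥ (x₁ + x₂)) = nsq y := by rw [hZx, star_dotProduct_self_eq]
  rw [mulVec_add, dotProduct_add, hA.star_dotProduct_mulVec_eq_zero hΓ h₁ hy hZ₁ hZ,
    hA.star_dotProduct_mulVec_eq_zero hΓ h₂ hy hZ₂ hZ, add_zero] at h
  exact nsq_eq_zero.1 (by exact_mod_cast h.symm)

lemma exists_weight_ne_zero (hcard : Nontrivial ι) : ∃ τ, τ ≠ 0 ∧ Wt A τ ≠ ⊥ := by
  by_contra! hc
  have htop : Wt A 0 = ⊤ := by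
    rw [← top_le_iff, ← hA.iSup_Wt hΓ]
    refine iSup_le fun τ => ?_
    by_cases hτ : τ = 0
    · rw [hτ]
    · rw [hc τ hτ]; exact bot_le
  obtain ⟨i, j, hij⟩ := hcard
  have h1 : ∀ k, A k = 0 := fun k => (ext_iff_mulVec (B := 0)).2 fun v => by
    have hv : v ∈ Wt A 0 := by rw [htop]; trivial
    have := hv k
    simpa using this
  have hs : star (Pi.single i 1 : ι → ℂ) = Pi.single i 1 := by
    rw [← Pi.single_star]; simp
  have hsj : star (Pi.single j 1 : ι → ℂ) = Pi.single j 1 := by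
    rw [← Pi.single_star]; simp
  obtain ⟨X, hX, hXe⟩ := hΓ.exists_mem_lieAlg_mulVec_eq_of_real (x := Pi.single i 1)
    (u := Pi.single j 1) hs (by simp) hsj (by simp [hij])
  obtain ⟨c, hc⟩ := hA.maximal X hX (fun k => by rw [h1]; simp)
  have hX0 : X = 0 := by rw [hc]; simp [h1]
  rw [hX0, zero_mulVec] at hXe
  have := congrFun hXe j
  simp at this

end IsCartan

end TransitiveSphere

namespace TransitiveSphere

open Filter Topology Matrix
open scoped Matrix.Norms.L2Operator

variable {ι : Type*} [Fintype ι] [DecidableEq ι] {r : ℕ}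
variable {Γ : Set (Matrix ι ι ℂ)} {A : Fin r → Matrix ι ι ℂ}

lemma exists_real_of_ne_zero {W : Submodule ℂ (ι → ℂ)} (hW : ∀ z ∈ W, star z ∈ W) {z : ι → ℂ}
    (hz : z ∈ W) (hz0 : z ≠ 0) : ∃ v ∈ W, star v = v ∧ nsq v = 1 := by
  have key : ∀ u ∈ W, star u = u → u ≠ 0 → ∃ v ∈ W, star v = v ∧ nsq v = 1 := by
    intro u hu hur hu0
    obtain ⟨c, -, hc⟩ := exists_smul_nsq_eq_one hu0
    exact ⟨_, W.smul_mem _ hu, by rw [star_smul, hur]; simp, hc⟩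
  by_cases h : z + star z = 0
  · refine key (Complex.I • z) (W.smul_mem _ hz) ?_ (smul_ne_zero Complex.I_ne_zero hz0)
    have : star z = -z := by rw [← add_eq_zero_iff_eq_neg, add_comm, h]
    rw [star_smul, this]; simp
  · exact key _ (W.add_mem hz (hW z hz)) (by rw [star_add, star_star, add_comm]) h

lemma exists_maximal_weight (h : ∃ τ, Wt A τ ≠ ⊥) :
    ∃ l, Wt A l ≠ ⊥ ∧ ∀ τ, Wt A τ ≠ ⊥ → τ ⬝ᵥ τ ≤ l ⬝ᵥ l :=
  (IsCartan.finite_weights A).exists_maximalFor (fun τ : Fin r → ℝ => τ ⬝ᵥ τ) _ h |>.imp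
    fun l hl => ⟨hl.1, fun τ hτ => by
      by_contra! hc
      exact absurd (hl.2 hτ hc.le) (not_le.2 hc)⟩

lemma eq_zero_of_lt {l τ : Fin r → ℝ} (hmax : ∀ τ, Wt A τ ≠ ⊥ → τ ⬝ᵥ τ ≤ l ⬝ᵥ l)
    (h : l ⬝ᵥ l < τ ⬝ᵥ τ) {z : ι → ℂ} (hz : z ∈ Wt A τ) : z = 0 := by
  by_contra h0
  exact absurd (hmax τ ((Submodule.ne_bot_iff _).2 ⟨z, hz, h0⟩)) (not_le.2 h)

lemma dotProduct_self_pos {τ : Fin r → ℝ} (h : τ ≠ 0) : 0 < τ ⬝ᵥ τ :=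
  lt_of_le_of_ne (Finset.sum_nonneg fun _ _ => mul_self_nonneg _)
    fun e => h (dotProduct_self_eq_zero.1 e.symm)

/-- The map `Z ↦ Z z`. -/
def evalAt (z : ι → ℂ) : Matrix ι ι ℂ →ₗ[ℂ] (ι → ℂ) where
  toFun Z := Z *ᵥ z
  map_add' a b := add_mulVec a b z
  map_smul' c a := smul_mulVec c a z

/-- If no nonzero weight vector is orthogonal to the image of `z` under a root space, then every
vector of that weight lies in the image. -/
lemma exists_mem_Rt_mulVec_eq {α ω : Fin r → ℝ} {z y : ι → ℂ} (hz : z ∈ Wt A ω)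
    (hy : y ∈ Wt A (ω + α))
    (h : ∀ p ∈ Wt A (ω + α), (∀ Z ∈ Rt Γ A α, star p ⬝ᵥ (Z *ᵥ z) = 0) → p = 0) :
    ∃ Z ∈ Rt Γ A α, Z *ᵥ z = y := by
  obtain ⟨w, ⟨Z, hZ, rfl⟩, p, rfl, hp⟩ := exists_add_orthogonal ((Rt Γ A α).map (evalAt z)) y
  have hZz : Z *ᵥ z ∈ Wt A (ω + α) := mulVec_mem_Wt hZ hz
  have hp0 : p = 0 := by
    refine h p ?_ fun Y hY => star_dotProduct_eq_zero_symm (hp _ ⟨Y, hY, rfl⟩)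
    have := (Wt A (ω + α)).sub_mem hy hZz
    rwa [show evalAt z Z = Z *ᵥ z from rfl, add_sub_cancel_left] at this
  exact ⟨Z, hZ, by rw [hp0, add_zero]; rfl⟩

namespace IsCartan

variable (hA : IsCartan Γ A) (hΓ : IsTransitiveGroup Γ)

include hA hΓ

section ZeroWeight

variable {v : ι → ℂ} (hv : v ∈ Wt A 0) (hvr : star v = v) (hv1 : nsq v = 1)

include hv hvr hv1

lemma eq_smul_of_mem_Wt_zero {y : ι → ℂ} (hy : y ∈ Wt A 0) : y = (star v ⬝ᵥ y) • v := by
  refine eq_smul_of_forall_orthogonal hv1 hv (fun y hy hvy => ?_) hy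
  have hv0 : v ≠ 0 := by rintro rfl; simp [nsq_eq_zero.2] at hv1
  refine hA.eq_zero_of_star_dotProduct_mulVec hΓ hv (Submodule.zero_mem (Wt A 0))
    (by simpa using hvr) (by simpa using hv0) hy ?_ ?_ (by simp)
  · rw [add_zero, dotProduct_comm, ← hvr, hvy]
  · intro Z hZ
    rw [sub_zero] at hZ
    obtain ⟨c, hc⟩ := hA.mulVec_of_mem_Rt_zero hΓ hZ 0
    rw [hc v hv, dotProduct_smul, star_dotProduct_eq_zero_symm hvy, smul_zero]

lemma exists_mem_Rt_mulVec_zero_weight {ω : Fin r → ℝ} (hω : ω ≠ 0) {y : ι → ℂ}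
    (hy : y ∈ Wt A ω) : ∃ W ∈ Rt Γ A ω, W *ᵥ v = y := by
  refine exists_mem_Rt_mulVec_eq hv (by rwa [zero_add]) fun p hp h => ?_
  rw [zero_add] at hp
  have hv0 : v ≠ 0 := by rintro rfl; simp [nsq_eq_zero.2] at hv1
  refine hA.eq_zero_of_star_dotProduct_mulVec hΓ hv (Submodule.zero_mem (Wt A 0))
    (by simpa using hvr) (by simpa using hv0) hp ?_ ?_ (by simp)
  · rw [add_zero]
    exact hA.dotProduct_eq_zero hΓ (by simpa using hω) hp hv
  · simpa using h

lemma conjTranspose_mulVec_of_mulVec_eq {ω : Fin r → ℝ} {y : ι → ℂ} (hy : y ∈ Wt A ω)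
    (hy1 : nsq y = 1) {W : Matrix ι ι ℂ} (hW : W ∈ Rt Γ A ω) (hWv : W *ᵥ v = y) :
    Wᴴ *ᵥ y = v := by
  have h : Wᴴ *ᵥ y ∈ Wt A 0 := by
    simpa using mulVec_mem_Wt (hA.conjTranspose_mem_Rt hΓ hW) hy
  rw [hA.eq_smul_of_mem_Wt_zero hΓ hv hvr hv1 h, star_dotProduct_mulVec,
    conjTranspose_conjTranspose, hWv, star_dotProduct_self_eq, hy1, Complex.ofReal_one, one_smul]

variable {l : Fin r → ℝ} (hl : l ≠ 0) (hmax : ∀ τ, Wt A τ ≠ ⊥ → τ ⬝ᵥ τ ≤ l ⬝ᵥ l)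
  {z : ι → ℂ} (hz : z ∈ Wt A l) (hz1 : nsq z = 1)

include hl hmax hz hz1

set_option maxHeartbeats 4000000 in
/-- No unit weight vector is orthogonal to the image of a vector of maximal weight. -/
lemma eq_zero_of_orthogonal_maximal {ω : Fin r → ℝ} (hω : ω ≠ -l) {y : ι → ℂ} (hy : y ∈ Wt A ω)
    (h : ∀ Z ∈ Rt Γ A (ω - l), star y ⬝ᵥ (Z *ᵥ z) = 0) : y = 0 := by
  obtain ⟨X, hX, hXv⟩ := hA.exists_mem_Rt_mulVec_zero_weight hΓ hv hvr hv1 hl hz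
  have hXz := hA.conjTranspose_mulVec_of_mulVec_eq hΓ hv hvr hv1 hz hz1 hX hXv
  have hXH := hA.conjTranspose_mem_Rt hΓ hX
  have hll : 0 < l ⬝ᵥ l := dotProduct_self_pos hl
  by_cases hω0 : ω = 0
  · subst hω0
    have h1 := h _ (by simpa using hXH)
    rw [hXz] at h1
    rw [hA.eq_smul_of_mem_Wt_zero hΓ hv hvr hv1 hy, star_dotProduct_eq_zero_symm h1, zero_smul]
  by_contra hy0
  wlog hy1 : nsq y = 1 generalizing y
  · obtain ⟨c, hc, hc1⟩ := exists_smul_nsq_eq_one hy0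
    refine this ((Wt A ω).smul_mem (c : ℂ) hy) (fun Z hZ => ?_) ?_ hc1
    · rw [star_smul, smul_dotProduct, h Z hZ, smul_zero]
    · exact smul_ne_zero (by exact_mod_cast hc.ne') hy0
  have hee : 0 < ω ⬝ᵥ ω := dotProduct_self_pos hω0
  obtain ⟨W, hW, hWv⟩ := hA.exists_mem_Rt_mulVec_zero_weight hΓ hv hvr hv1 hω0 hy
  have hWy := hA.conjTranspose_mulVec_of_mulVec_eq hΓ hv hvr hv1 hy hy1 hW hWv
  have hWH := hA.conjTranspose_mem_Rt hΓ hW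
  have hf : star (X *ᵥ y) ⬝ᵥ (W *ᵥ z) = 1 := by
    have hc : W * Xᴴ - Xᴴ * W ∈ Rt Γ A (ω - l) := by
      rw [sub_eq_add_neg ω]
      exact commutator_mem_Rt hΓ hW hXH
    have h1 := h _ hc
    rw [sub_mulVec, ← mulVec_mulVec, ← mulVec_mulVec, hXz, hWv, dotProduct_sub,
      star_dotProduct_self_eq, hy1, star_dotProduct_mulVec Xᴴ, conjTranspose_conjTranspose,
      Complex.ofReal_one, sub_eq_zero] at h1
    exact h1.symm
  set q := X *ᵥ y with hq
  set p := W *ᵥ z with hp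
  have hqw : q ∈ Wt A (ω + l) := mulVec_mem_Wt hX hy
  have hpw : p ∈ Wt A (l + ω) := mulVec_mem_Wt hW hz
  have hp0 : p ≠ 0 := by intro h0; rw [h0] at hf; simp at hf
  have hcomm : ω ⬝ᵥ l = l ⬝ᵥ ω := dotProduct_comm _ _
  have hneg : l ⬝ᵥ ω < 0 := by
    have := hmax _ ((Submodule.ne_bot_iff _).2 ⟨p, hpw, hp0⟩)
    rw [add_dotProduct, dotProduct_add, dotProduct_add, hcomm] at this
    linarith
  have hXy : Xᴴ *ᵥ y = 0 := by
    refine eq_zero_of_lt hmax ?_ (mulVec_mem_Wt hXH hy)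
    rw [add_dotProduct, dotProduct_add, dotProduct_add, dotProduct_neg, neg_dotProduct,
      neg_dotProduct, dotProduct_neg, hcomm]
    linarith
  have hWz : Wᴴ *ᵥ z = 0 := by
    refine eq_zero_of_lt hmax ?_ (mulVec_mem_Wt hWH hz)
    rw [add_dotProduct, dotProduct_add, dotProduct_add, dotProduct_neg, neg_dotProduct,
      neg_dotProduct, dotProduct_neg, hcomm]
    linarith
  have hXz0 : X *ᵥ z = 0 := by
    refine eq_zero_of_lt hmax ?_ (mulVec_mem_Wt hX hz)
    rw [add_dotProduct, dotProduct_add]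
    linarith
  have hz0 : nsq (0 : ι → ℂ) = 0 := nsq_eq_zero.2 rfl
  have e1 := hA.nsq_conjTranspose_sub_nsq hΓ hX hz
  have e2 := hA.nsq_conjTranspose_sub_nsq hΓ hX hy
  have e3 := hA.nsq_conjTranspose_sub_nsq hΓ hW hz
  have e4 := hA.nsq_conjTranspose_sub_nsq hΓ hW hy
  have e5 := hA.nsq_conjTranspose_sub_nsq hΓ hW hv
  rw [hXz, hXz0, hv1, hz0, hz1] at e1
  rw [hXy, ← hq, hy1, hz0] at e2
  rw [hWz, ← hp, hz1, hz0, hcomm] at e3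
  rw [hWy, hv1, hy1] at e4
  rw [hWv, hy1, hv1, dotProduct_zero] at e5
  have hCS := normSq_star_dotProduct_le q p
  rw [hf, map_one] at hCS
  set NX := frobSq X
  set NW := frobSq W
  obtain ⟨c, hc⟩ : ∃ c, l ⬝ᵥ ω = -(c * (l ⬝ᵥ l)) := ⟨-(l ⬝ᵥ ω) / (l ⬝ᵥ l), by field_simp⟩
  have hc0 : 0 < c := by
    by_contra! hcn
    nlinarith
  have hqn : nsq q = c := by
    rw [hc] at e2
    linear_combination (-1) * e2 - c * e1
  have hpn : nsq p = NW * (c * (l ⬝ᵥ l)) := by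
    rw [hc] at e3
    linear_combination (-1) * e3
  have hgap : (ω + c • l) ⬝ᵥ (ω + c • l) = ω ⬝ᵥ ω - c ^ 2 * (l ⬝ᵥ l) := by
    rw [add_dotProduct, dotProduct_add, dotProduct_add, smul_dotProduct, dotProduct_smul,
      dotProduct_smul, smul_dotProduct, hcomm, hc]
    simp only [smul_eq_mul]
    ring
  have hgap0 : 0 ≤ (ω + c • l) ⬝ᵥ (ω + c • l) := Finset.sum_nonneg fun i _ => mul_self_nonneg _
  have hNW : 0 ≤ NW := frobSq_nonneg W
  have hWyn := nsq_nonneg (W *ᵥ y)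
  rw [hqn, hpn] at hCS
  have hNW0 : 0 < NW := by
    refine lt_of_le_of_ne hNW fun h0 => ?_
    rw [← h0] at hCS
    linarith
  have hge : NW * ((ω + c • l) ⬝ᵥ (ω + c • l)) ≤ 0 := by
    rw [hgap]
    nlinarith
  have hω' : ω = -(c • l) := by
    rw [← add_eq_zero_iff_eq_neg]
    refine dotProduct_self_eq_zero.1 (le_antisymm ?_ hgap0)
    by_contra! hpos
    nlinarith
  have hee' : ω ⬝ᵥ ω = c ^ 2 * (l ⬝ᵥ l) := by
    have : (ω + c • l) = 0 := by rw [hω']; simp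
    rw [this, zero_dotProduct] at hgap
    linarith
  have hNWe : NW * (c ^ 2 * (l ⬝ᵥ l)) = 1 := by
    rw [hee'] at e4
    nlinarith
  have hc1 : c < 1 := by
    have h1 : c ≠ 1 := by rintro rfl; exact hω (by simpa using hω')
    have h2 := hmax ω ((Submodule.ne_bot_iff _).2 ⟨y, hy, hy0⟩)
    rw [hee'] at h2
    have h3 : c ^ 2 ≤ 1 := by
      by_contra! h4
      nlinarith
    exact lt_of_le_of_ne (by nlinarith) h1
  have hXq : X *ᵥ q = 0 := by
    refine eq_zero_of_lt hmax ?_ (mulVec_mem_Wt hX hqw)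
    have : ω + l + l = (2 - c) • l := by rw [hω']; module
    rw [this, smul_dotProduct, dotProduct_smul, smul_eq_mul, smul_eq_mul]
    nlinarith [mul_pos (mul_pos (sub_pos.2 hc1) (by linarith : 0 < 3 - c)) hll]
  have hXHq : Xᴴ *ᵥ q = (c : ℂ) • y := by
    have h1 := hA.commutator_mulVec hΓ hX hy
    rw [sub_mulVec, ← mulVec_mulVec, ← mulVec_mulVec, hXy, mulVec_zero, zero_sub, hc] at h1
    rw [← neg_inj, h1, ← neg_smul]
    congr 1
    rw [← Complex.ofReal_neg]
    congr 1
    linear_combination c * e1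
  have e6 := hA.nsq_conjTranspose_sub_nsq hΓ hX hqw
  rw [hXq, hXHq, hz0, nsq_smul, hy1, hqn, dotProduct_add, hc, Complex.normSq_ofReal] at e6
  have hhalf : c = 1 / 2 := by
    have : c * (2 * c - 1) = 0 := by linear_combination e6 - (1 - c) * c * e1
    rcases mul_eq_zero.1 this with h0 | h0 <;> linarith
  have hWHp : Wᴴ *ᵥ p = ((2 : ℝ) : ℂ) • z := by
    have h1 := hA.commutator_mulVec hΓ hW hz
    rw [sub_mulVec, ← mulVec_mulVec, ← mulVec_mulVec, hWz, mulVec_zero, zero_sub, hcomm, hc] at h1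
    rw [← neg_inj, h1, ← neg_smul]
    congr 1
    rw [← Complex.ofReal_neg]
    congr 1
    rw [hhalf] at hNWe ⊢
    linarith
  have e7 := hA.nsq_conjTranspose_sub_nsq hΓ hW hpw
  rw [hWHp, nsq_smul, hz1, hpn, dotProduct_add, hee', hcomm, hc, Complex.normSq_ofReal] at e7
  have hpw0 : W *ᵥ p ∈ Wt A 0 := by
    have h1 := mulVec_mem_Wt hW hpw
    have : l + ω + ω = 0 := by rw [hω', hhalf]; module
    rwa [this] at h1
  have h2 := hA.eq_smul_of_mem_Wt_zero hΓ hv hvr hv1 hpw0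
  have h3 := congrArg nsq h2
  rw [nsq_smul, hv1, star_dotProduct_mulVec] at h3
  have h4 := normSq_star_dotProduct_le (Wᴴ *ᵥ v) p
  rw [hpn] at h4
  rw [hhalf] at hNWe h4 e7
  have h5 : NW * (l ⬝ᵥ l) = 4 := by linarith
  have h6 : nsq (Wᴴ *ᵥ v) = 1 := by linarith
  rw [h6] at h4
  nlinarith

end ZeroWeight

/-- If zero is a weight then every vector is negated by some group element. -/
theorem exists_mulVec_eq_neg_of_zero_weight [Nontrivial ι] (h0 : Wt A 0 ≠ ⊥) (ζ₀ : ι → ℂ) :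
    ∃ g ∈ Γ, g *ᵥ ζ₀ = -ζ₀ := by
  obtain ⟨u, hu, hu0⟩ := Submodule.exists_mem_ne_zero_of_ne_bot h0
  obtain ⟨v, hv, hvr, hv1⟩ := exists_real_of_ne_zero
    (fun z hz => by simpa using hA.star_mem_Wt hΓ hz) hu hu0
  obtain ⟨τ, hτ0, hτ⟩ := hA.exists_weight_ne_zero hΓ ‹_›
  obtain ⟨l, hl, hmax⟩ := exists_maximal_weight ⟨τ, hτ⟩
  have hll : 0 < l ⬝ᵥ l := (dotProduct_self_pos hτ0).trans_le (hmax τ hτ)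
  have hl0 : l ≠ 0 := by rintro rfl; simp at hll
  obtain ⟨z', hz', hz'0⟩ := Submodule.exists_mem_ne_zero_of_ne_bot hl
  obtain ⟨c, -, hz1⟩ := exists_smul_nsq_eq_one hz'0
  set z := (c : ℂ) • z'
  have hz : z ∈ Wt A l := (Wt A l).smul_mem _ hz'
  obtain ⟨g, hg, hcrit⟩ := exists_mem_re_eq_zero hΓ.isCompact ⟨1, hΓ.one_mem⟩ hΓ.exp_mul_mem z ζ₀
  set ζ := g *ᵥ ζ₀
  have hζ : ζ ∈ ⨆ τ ∈ ({l, -l} : Set (Fin r → ℝ)), Wt A τ := by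
    refine hA.mem_iSup_of_orthogonal hΓ fun τ hτ y hy => ?_
    simp only [Set.mem_insert_iff, Set.mem_singleton_iff, not_or] at hτ
    by_cases hy0 : y = 0
    · simp [hy0]
    obtain ⟨Z, hZ, rfl⟩ : ∃ Z ∈ Rt Γ A (τ - l), Z *ᵥ z = y := by
      refine exists_mem_Rt_mulVec_eq hz (by simpa using hy) fun p hp h => ?_
      rw [add_sub_cancel] at hp
      exact hA.eq_zero_of_orthogonal_maximal hΓ hv hvr hv1 hl0 hmax hz hz1 hτ.2 hp h
    have hZH := hA.conjTranspose_mem_Rt hΓ hZ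
    have hZz : Zᴴ *ᵥ z = 0 := by
      refine eq_zero_of_lt hmax ?_ (mulVec_mem_Wt hZH hz)
      have h1 := hmax τ ((Submodule.ne_bot_iff _).2 ⟨_, hy, hy0⟩)
      have h2 := dotProduct_self_pos (sub_ne_zero.2 hτ.1)
      have h3 : (l + -(τ - l)) ⬝ᵥ (l + -(τ - l)) =
          2 * ((τ - l) ⬝ᵥ (τ - l)) + 2 * (l ⬝ᵥ l) - τ ⬝ᵥ τ := by
        simp only [dotProduct, Finset.mul_sum, ← Finset.sum_add_distrib, ← Finset.sum_sub_distrib]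
        refine Finset.sum_congr rfl fun i _ => ?_
        simp only [Pi.add_apply, Pi.neg_apply, Pi.sub_apply]
        ring
      rw [h3]
      linarith
    rw [star_mulVec_dotProduct, hΓ.star_dotProduct_mulVec_comm hcrit hZH.1, hZz, dotProduct_zero]
  let E := NormedSpace.exp (∑ j, ((Real.pi / (l ⬝ᵥ l)) • l) j • A j)
  have hE : E ∈ Γ := exp_mem_of_mem_lieAlg (hA.sum_smul_mem hΓ _)
  have hEζ : E *ᵥ ζ = -ζ := by
    clear_value ζ
    clear hcrit
    induction hζ using Submodule.iSup_induction' with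
    | mem τ y hy =>
      by_cases hτ : τ ∈ ({l, -l} : Set (Fin r → ℝ))
      · simp only [hτ, iSup_pos] at hy
        rw [exp_sum_smul_mulVec _ hy, smul_dotProduct]
        rcases hτ with rfl | rfl
        · have : (Real.pi / (τ ⬝ᵥ τ)) • (τ ⬝ᵥ τ) = Real.pi := by
            rw [smul_eq_mul]; field_simp
          rw [this, mul_comm, Complex.exp_pi_mul_I]; simp
        · have : (Real.pi / (l ⬝ᵥ l)) • (l ⬝ᵥ -l) = -Real.pi := by
            rw [smul_eq_mul, dotProduct_neg]; field_simp
          rw [this, mul_comm, Complex.ofReal_neg, neg_mul, Complex.exp_neg,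
            Complex.exp_pi_mul_I]; norm_num
      · simp only [hτ] at hy
        simp at hy
        simp [hy]
    | zero => simp
    | add a b _ _ ha hb =>
      rw [mulVec_add]
      rw [ha, hb, neg_add]
  refine ⟨gᴴ * (E * g), hΓ.mul_mem (hΓ.star_mem hg) (hΓ.mul_mem hE hg), ?_⟩
  have h1 := hΓ.star_mul_self hg
  rw [star_eq_conjTranspose] at h1
  rw [← mulVec_mulVec, ← mulVec_mulVec, hEζ, mulVec_neg, mulVec_mulVec, h1, one_mulVec]

end IsCartan

end TransitiveSphere

namespace TransitiveSphere

open Filter Topology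

/-- The averages of the powers of a complex number of modulus one other than `1` tend to zero. -/
lemma tendsto_average_pow {z : ℂ} (hz : ‖z‖ = 1) (h1 : z ≠ 1) :
    Tendsto (fun K : ℕ => (∑ k ∈ Finset.range K, z ^ k) / K) atTop (𝓝 0) := by
  rw [tendsto_zero_iff_norm_tendsto_zero]
  refine squeeze_zero (g := fun K : ℕ => (2 / ‖z - 1‖) / K) (fun K => norm_nonneg _) (fun K => ?_)
    (tendsto_const_div_atTop_nhds_zero_nat _)
  rw [geom_sum_eq h1, norm_div, norm_div, Complex.norm_natCast]
  gcongr
  refine (norm_sub_le _ _).trans ?_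
  rw [norm_pow, hz]
  norm_num

variable {W : Type*} [Fintype W]

lemma tendsto_average_pow_sum {u : W → ℂ} (hu : ∀ w, ‖u w‖ = 1) {m : ℕ}
    (hm : ∀ p : Fin m → W, ∏ i, u (p i) ≠ 1) :
    Tendsto (fun K : ℕ => (∑ k ∈ Finset.range K, (∑ w, u w ^ k) ^ m) / K) atTop (𝓝 0) := by
  have h : Tendsto (fun K : ℕ => ∑ p : Fin m → W,
      (∑ k ∈ Finset.range K, (∏ i, u (p i)) ^ k) / K) atTop (𝓝 (∑ p : Fin m → W, 0)) :=
    tendsto_finsetSum _ fun p _ => tendsto_average_pow (by simp [hu]) (hm p)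
  rw [Finset.sum_const_zero] at h
  refine h.congr fun K => ?_
  rw [← Finset.sum_div, Finset.sum_comm]
  congr 1
  refine Finset.sum_congr rfl fun k _ => ?_
  rw [Fintype.sum_pow]
  exact Finset.sum_congr rfl fun p _ => (Finset.prod_pow _ _ _).symm

lemma add_pow_sub_sub_pow (n f : ℝ) (N : ℕ) :
    (n + f) ^ N - (n - f) ^ N =
      ∑ j ∈ Finset.range (N + 1), (1 - (-1) ^ j) * n ^ (N - j) * N.choose j * f ^ j := by
  rw [sub_eq_add_neg n f, add_comm n, add_comm n, add_pow, add_pow, ← Finset.sum_sub_distrib]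
  refine Finset.sum_congr rfl fun j _ => ?_
  rw [neg_pow f]
  ring

/-- A positive proportion of the powers of finitely many numbers of modulus one is close to one. -/
lemma exists_card_return {u : W → ℂ} (hu : ∀ w, ‖u w‖ = 1) {ε : ℝ} (hε : 0 < ε) :
    ∃ M : ℕ, 0 < M ∧ ∀ K : ℕ, ∃ s ⊆ Finset.range K, K ≤ M * s.card ∧
      ∀ k ∈ s, ∀ w, ‖u w ^ k - 1‖ < ε := by
  classical
  have hcomp : IsCompact (Metric.closedBall (0 : W → ℂ) 1) := isCompact_closedBall _ _
  obtain ⟨t, -, htf, ht⟩ := hcomp.totallyBounded.exists_subset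
    (Metric.dist_mem_uniformity (half_pos hε))
  lift t to Finset (W → ℂ) using htf
  have hmem : ∀ k : ℕ, ∃ c ∈ t, dist (fun w => u w ^ k) c < ε / 2 := by
    intro k
    have hk : (fun w => u w ^ k) ∈ Metric.closedBall (0 : W → ℂ) 1 := by
      rw [mem_closedBall_zero_iff, pi_norm_le_iff_of_nonneg zero_le_one]
      intro w
      simp [hu]
    simpa using ht hk
  choose c hct hc using hmem
  have hcard : 0 < t.card := Finset.card_pos.2 ⟨_, hct 0⟩
  refine ⟨t.card, hcard, fun K => ?_⟩
  rcases Nat.eq_zero_or_pos K with rfl | hK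
  · exact ⟨∅, by simp, by simp, by simp⟩
  obtain ⟨d, hd, hfib⟩ : ∃ d ∈ t, K ≤ t.card * ((Finset.range K).filter fun k => c k = d).card := by
    by_contra! hcon
    have h1 : K = ∑ d ∈ t, ((Finset.range K).filter fun k => c k = d).card := by
      rw [← Finset.card_eq_sum_card_fiberwise fun k _ => hct k, Finset.card_range]
    have h2 : ∑ d ∈ t, t.card * ((Finset.range K).filter fun k => c k = d).card < ∑ _d ∈ t, K :=
      Finset.sum_lt_sum_of_nonempty ⟨_, hct 0⟩ hcon
    rw [← Finset.mul_sum, ← h1, Finset.sum_const, smul_eq_mul] at h2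
    exact lt_irrefl _ h2
  set F := (Finset.range K).filter fun k => c k = d with hF
  have hFne : F.Nonempty := by
    rw [← Finset.card_pos]
    by_contra! h0
    rw [Nat.le_zero.1 h0] at hfib
    omega
  set k₀ := F.min' hFne
  have hk₀ : k₀ ∈ F := F.min'_mem hFne
  refine ⟨F.image (· - k₀), ?_, ?_, ?_⟩
  · intro k hk
    obtain ⟨k', hk', rfl⟩ := Finset.mem_image.1 hk
    have := Finset.mem_range.1 (Finset.mem_filter.1 hk').1
    rw [Finset.mem_range]
    omega
  · rw [Finset.card_image_of_injOn]
    · exact hfib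
    · intro a ha b hb hab
      have h1 := F.min'_le a ha
      have h2 := F.min'_le b hb
      dsimp only at hab
      omega
  · intro k hk w
    obtain ⟨k', hk', rfl⟩ := Finset.mem_image.1 hk
    have hle := F.min'_le k' hk'
    have h1 : dist (fun w => u w ^ k') (fun w => u w ^ k₀) < ε := by
      have e1 := hc k'
      have e2 := hc k₀
      rw [(Finset.mem_filter.1 hk').2] at e1
      rw [(Finset.mem_filter.1 hk₀).2] at e2
      have := dist_triangle_right (fun w => u w ^ k') (fun w => u w ^ k₀) d
      linarith
    have h2 := (dist_le_pi_dist (fun w => u w ^ k') (fun w => u w ^ k₀) w).trans_lt h1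
    rw [dist_eq_norm] at h2
    have h3 : u w ^ k' - u w ^ k₀ = u w ^ k₀ * (u w ^ (k' - k₀) - 1) := by
      rw [mul_sub, ← pow_add, mul_one, Nat.add_sub_cancel' hle]
    rwa [h3, norm_mul, norm_pow, hu, one_pow, one_mul] at h2

/-- Either simultaneous powers of the given numbers come close to `-1`, or some product of an odd
number of them equals one. -/
theorem exists_pow_near_neg_one_or_odd_prod {u : W → ℂ} (hu : ∀ w, ‖u w‖ = 1)
    (hreal : ∀ k : ℕ, ((∑ w, (u w ^ k).re : ℝ) : ℂ) = ∑ w, u w ^ k) :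
    (∀ ε > 0, ∃ k : ℕ, ∀ w, ‖u w ^ k + 1‖ < ε) ∨
      ∃ m, Odd m ∧ ∃ p : Fin m → W, ∏ i, u (p i) = 1 := by
  classical
  by_contra! hcon
  obtain ⟨⟨ε, hε, hfar⟩, hodd⟩ := hcon
  set n : ℝ := (Fintype.card W : ℝ) with hn
  have hWne : Nonempty W := (hfar 0).nonempty
  have hn1 : 1 ≤ n := by
    rw [hn, Nat.one_le_cast]
    exact Fintype.card_pos
  set f : ℕ → ℝ := fun k => ∑ w, (u w ^ k).re with hf
  have hre : ∀ k w, |(u w ^ k).re| ≤ 1 := fun k w =>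
    (Complex.abs_re_le_norm _).trans (by simp [hu])
  have hnorm : ∀ k w, (u w ^ k).re ^ 2 + (u w ^ k).im ^ 2 = 1 := fun k w => by
    have := Complex.sq_norm (u w ^ k)
    rw [norm_pow, hu, one_pow, one_pow, Complex.normSq_apply] at this
    linarith
  have hfle : ∀ k, f k ≤ n := fun k => by
    refine (Finset.sum_le_sum fun w _ => (abs_le.1 (hre k w)).2).trans ?_
    simp [hn]
  obtain ⟨δ, hδ, hδ2, hlow⟩ : ∃ δ, 0 < δ ∧ δ < 1 ∧ ∀ k, -n + δ ≤ f k := by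
    refine ⟨min (ε ^ 2 / 2) (1 / 2), by positivity, by
      exact (min_le_right _ _).trans_lt (by norm_num), fun k => ?_⟩
    obtain ⟨w, hw⟩ := hfar k
    have h1 : -1 + ε ^ 2 / 2 ≤ (u w ^ k).re := by
      have h2 := Complex.sq_norm (u w ^ k + 1)
      rw [Complex.normSq_apply] at h2
      simp only [Complex.add_re, Complex.add_im, Complex.one_re, Complex.one_im] at h2
      have h3 : ε ^ 2 ≤ ‖u w ^ k + 1‖ ^ 2 := by gcongr
      nlinarith [hnorm k w]
    have h4 : ∑ w', (-1 + if w' = w then ε ^ 2 / 2 else 0) ≤ f k := by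
      refine Finset.sum_le_sum fun w' _ => ?_
      split_ifs with h
      · rw [h]; exact h1
      · have := (abs_le.1 (hre k w')).1
        linarith
    rw [Finset.sum_add_distrib, Finset.sum_ite_eq' Finset.univ w] at h4
    simp only [Finset.sum_const, Finset.card_univ, Finset.mem_univ, if_true, nsmul_eq_mul] at h4
    have := min_le_left (ε ^ 2 / 2) (1 / 2 : ℝ)
    linarith
  obtain ⟨M, hM, hret⟩ := exists_card_return hu (ε := δ / (2 * n)) (by positivity)
  have hclose : ∀ k, (∀ w, ‖u w ^ k - 1‖ < δ / (2 * n)) → n - δ / 2 ≤ f k := fun k hk => by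
    have h1 : ∑ _w : W, (1 - δ / (2 * n)) ≤ f k := by
      refine Finset.sum_le_sum fun w _ => ?_
      have h2 := (Complex.abs_re_le_norm (u w ^ k - 1)).trans (hk w).le
      rw [Complex.sub_re, Complex.one_re] at h2
      have := (abs_le.1 h2).1
      linarith
    rw [Finset.sum_const, Finset.card_univ, nsmul_eq_mul, ← hn] at h1
    have : n * (1 - δ / (2 * n)) = n - δ / 2 := by field_simp
    linarith
  have havg : ∀ j, Odd j →
      Tendsto (fun K : ℕ => (∑ k ∈ Finset.range K, f k ^ j) / K) atTop (𝓝 0) := fun j hj => by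
    have h1 := tendsto_average_pow_sum hu (hodd j hj)
    have h2 := (Complex.continuous_re.tendsto 0).comp h1
    rw [Complex.zero_re] at h2
    refine h2.congr fun K => ?_
    simp only [Function.comp_apply, ← hreal]
    exact_mod_cast rfl
  have hdiff : ∀ N : ℕ, Tendsto (fun K : ℕ =>
      (∑ k ∈ Finset.range K, ((n + f k) ^ N - (n - f k) ^ N)) / K) atTop (𝓝 0) := fun N => by
    have h1 : Tendsto (fun K : ℕ => ∑ j ∈ Finset.range (N + 1),
        (1 - (-1) ^ j) * n ^ (N - j) * N.choose j * ((∑ k ∈ Finset.range K, f k ^ j) / K)) atTop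
        (𝓝 (∑ j ∈ Finset.range (N + 1), 0)) := by
      refine tendsto_finsetSum _ fun j _ => ?_
      rcases Nat.even_or_odd j with hj | hj
      · simp [hj.neg_one_pow]
      · simpa using (havg j hj).const_mul ((1 - (-1) ^ j) * n ^ (N - j) * N.choose j)
    rw [Finset.sum_const_zero] at h1
    refine h1.congr fun K => ?_
    simp only [add_pow_sub_sub_pow]
    rw [Finset.sum_comm, Finset.sum_div]
    refine Finset.sum_congr rfl fun j _ => ?_
    rw [← Finset.mul_sum, mul_div_assoc]
  have hbound : ∀ N : ℕ, (2 * n - δ / 2) ^ N / M ≤ (2 * n - δ) ^ N := fun N => by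
    rw [← sub_nonpos]
    refine le_of_tendsto_of_tendsto tendsto_const_nhds (hdiff N) ?_
    filter_upwards [eventually_gt_atTop 0] with K hK
    have hK' : (0 : ℝ) < K := by exact_mod_cast hK
    have hM' : (0 : ℝ) < M := by exact_mod_cast hM
    obtain ⟨s, hs, hsc, hsk⟩ := hret K
    have h1 : s.card * (2 * n - δ / 2) ^ N ≤ ∑ k ∈ Finset.range K, (n + f k) ^ N := by
      rw [← nsmul_eq_mul, ← Finset.sum_const]
      refine (Finset.sum_le_sum fun k hk => ?_).trans
        (Finset.sum_le_sum_of_subset_of_nonneg hs fun k _ _ => ?_)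
      · have := hclose k (hsk k hk)
        exact pow_le_pow_left₀ (by linarith) (by linarith) _
      · have := hlow k
        exact pow_nonneg (by linarith) _
    have h2 : ∑ k ∈ Finset.range K, (n - f k) ^ N ≤ K * (2 * n - δ) ^ N := by
      refine (Finset.sum_le_sum (g := fun _ => (2 * n - δ) ^ N) fun k _ => ?_).trans (by simp)
      have h3 := hfle k
      have h4 := hlow k
      exact pow_le_pow_left₀ (by linarith) (by linarith) _
    have h3 : (K : ℝ) / M * (2 * n - δ / 2) ^ N ≤ s.card * (2 * n - δ / 2) ^ N := by
      have : (K : ℝ) ≤ M * s.card := by exact_mod_cast hsc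
      refine mul_le_mul_of_nonneg_right ?_ (pow_nonneg (by linarith) _)
      rw [div_le_iff₀ hM']
      linarith
    rw [Finset.sum_sub_distrib, le_div_iff₀ hK']
    have h4 : ((2 * n - δ / 2) ^ N / M - (2 * n - δ) ^ N) * K =
      K / M * (2 * n - δ / 2) ^ N - K * (2 * n - δ) ^ N := by ring
    rw [h4]
    linarith
  have hq : Tendsto (fun N : ℕ => ((2 * n - δ) / (2 * n - δ / 2)) ^ N) atTop (𝓝 0) :=
    tendsto_pow_atTop_nhds_zero_of_lt_one (div_nonneg (by linarith) (by linarith))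
      ((div_lt_one (by linarith)).2 (by linarith))
  have hM' : (0 : ℝ) < M := by exact_mod_cast hM
  obtain ⟨N, hN⟩ := (hq.eventually (gt_mem_nhds (inv_pos.2 hM'))).exists
  have hpos : 0 < (2 * n - δ / 2) ^ N := pow_pos (by linarith) _
  have h5 := hbound N
  rw [div_pow, div_lt_iff₀ hpos] at hN
  rw [div_eq_inv_mul] at h5
  linarith

end TransitiveSphere

namespace TransitiveSphere

open Filter Topology Matrix
open scoped Matrix.Norms.L2Operator

variable {ι : Type*} [Fintype ι] [DecidableEq ι] {r : ℕ}
variable {Γ : Set (Matrix ι ι ℂ)} {A : Fin r → Matrix ι ι ℂ}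

open MeasureTheory in
/-- A vector pairing with countably many nonzero vectors outside the multiples of `2π`. -/
lemma exists_forall_dotProduct_ne {S : Set (Fin r → ℝ)} (hS : S.Countable) (h0 : 0 ∉ S) :
    ∃ c : Fin r → ℝ, ∀ σ ∈ S, ∀ k : ℤ, c ⬝ᵥ σ ≠ k * (2 * Real.pi) := by
  have hnull : ∀ σ : Fin r → ℝ, σ ≠ 0 → ∀ a : ℝ, volume {c : Fin r → ℝ | c ⬝ᵥ σ = a} = 0 := by
    intro σ hσ a
    rcases Set.eq_empty_or_nonempty {c : Fin r → ℝ | c ⬝ᵥ σ = a} with he | ⟨c₀, hc₀⟩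
    · rw [he, measure_empty]
    let L : (Fin r → ℝ) →ₗ[ℝ] ℝ :=
      { toFun := fun c => c ⬝ᵥ σ
        map_add' := fun a b => add_dotProduct a b σ
        map_smul' := fun t a => smul_dotProduct t a σ }
    have hs : ((AffineSubspace.mk' c₀ L.ker : AffineSubspace ℝ (Fin r → ℝ)) : Set (Fin r → ℝ)) =
        {c | c ⬝ᵥ σ = a} := by
      ext c
      rw [SetLike.mem_coe, AffineSubspace.mem_mk', LinearMap.mem_ker]
      change (c - c₀) ⬝ᵥ σ = 0 ↔ c ⬝ᵥ σ = a
      rw [sub_dotProduct, show c₀ ⬝ᵥ σ = a from hc₀, sub_eq_zero]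
    rw [← hs]
    refine Measure.addHaar_affineSubspace _ _ fun htop => ?_
    have h1 : ∀ c : Fin r → ℝ, c ⬝ᵥ σ = a := fun c => by
      have : c ∈ ({c | c ⬝ᵥ σ = a} : Set (Fin r → ℝ)) := by rw [← hs, htop]; trivial
      exact this
    have h2 := h1 σ
    rw [← h1 0, zero_dotProduct] at h2
    exact hσ (dotProduct_self_eq_zero.1 h2)
  have hU : volume (⋃ σ ∈ S, ⋃ k : ℤ, {c : Fin r → ℝ | c ⬝ᵥ σ = k * (2 * Real.pi)}) = 0 := by
    rw [measure_biUnion_null_iff hS]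
    intro σ hσ
    rw [measure_iUnion_null_iff]
    exact fun k => hnull σ (fun h => h0 (h ▸ hσ)) _
  by_contra! hc
  have huniv : (⋃ σ ∈ S, ⋃ k : ℤ, {c : Fin r → ℝ | c ⬝ᵥ σ = k * (2 * Real.pi)}) = Set.univ := by
    refine Set.eq_univ_of_forall fun c => ?_
    obtain ⟨σ, hσ, k, hk⟩ := hc c
    simp only [Set.mem_iUnion]
    exact ⟨σ, hσ, k, hk⟩
  rw [huniv] at hU
  exact isOpen_univ.measure_ne_zero volume Set.univ_nonempty hU

namespace IsCartan

variable (hA : IsCartan Γ A) (hΓ : IsTransitiveGroup Γ)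

include hA hΓ

lemma eq_neg_one_of_forall {h : Matrix ι ι ℂ} (hz : ∀ τ, ∀ z ∈ Wt A τ, h *ᵥ z = -z) : h = -1 := by
  refine ext_iff_mulVec.2 fun v => ?_
  rw [neg_mulVec, one_mulVec]
  have hv : v ∈ ⨆ τ, Wt A τ := by rw [hA.iSup_Wt hΓ]; trivial
  induction hv using Submodule.iSup_induction' with
  | mem τ y hy => exact hz τ y hy
  | zero => simp
  | add a b _ _ ha hb => rw [mulVec_add, ha, hb, neg_add]

/-- Unless the group contains `-1`, some odd number of weights sum to zero. -/
theorem exists_odd_sum_eq_zero (hneg : -1 ∉ Γ) :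
    ∃ m, Odd m ∧ ∃ p : Fin m → Fin r → ℝ, (∀ i, Wt A (p i) ≠ ⊥) ∧ ∑ i, p i = 0 := by
  let W := {τ : Fin r → ℝ // Wt A τ ≠ ⊥}
  have : Finite W := (finite_weights A).to_subtype
  let _ : Fintype W := Fintype.ofFinite W
  let S : Set (Fin r → ℝ) := Set.range (fun p : Σ m : ℕ, (Fin m → W) => ∑ i, (p.2 i).1) \ {0}
  obtain ⟨c, hc⟩ := exists_forall_dotProduct_ne (S := S) ((Set.countable_range _).mono
    Set.sdiff_subset) (fun h => h.2 rfl)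
  let u : W → ℂ := fun τ => Complex.exp (Complex.I * ((c ⬝ᵥ τ.1 : ℝ) : ℂ))
  have hu : ∀ τ, ‖u τ‖ = 1 := fun τ => by
    simp only [u]; rw [mul_comm]; exact Complex.norm_exp_ofReal_mul_I _
  let e : W ≃ W := ⟨fun τ => ⟨-τ.1, hA.neg_ne_bot hΓ τ.2⟩, fun τ => ⟨-τ.1, hA.neg_ne_bot hΓ τ.2⟩,
    fun τ => by simp, fun τ => by simp⟩
  have hconj : ∀ τ, (starRingEnd ℂ) (u τ) = u (e τ) := fun τ => by
    simp only [u, e, Equiv.coe_fn_mk, dotProduct_neg]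
    rw [← Complex.exp_conj]
    simp
  have hreal : ∀ k : ℕ, ((∑ w, (u w ^ k).re : ℝ) : ℂ) = ∑ w, u w ^ k := fun k => by
    rw [← Complex.re_sum]
    refine Complex.conj_eq_iff_re.1 ?_
    rw [map_sum, ← e.sum_comp]
    refine Finset.sum_congr rfl fun w _ => ?_
    rw [map_pow, hconj]
    congr 2
    simp [e]
  rcases exists_pow_near_neg_one_or_odd_prod hu hreal with h | ⟨m, hm, p, hp⟩
  · exfalso
    let E := NormedSpace.exp (∑ j, c j • A j)
    have hE : E ∈ Γ := exp_mem_of_mem_lieAlg (hA.sum_smul_mem hΓ _)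
    choose k hk using fun N : ℕ => h (1 / ((N : ℝ) + 1)) (pos_inv_succ N)
    obtain ⟨g, hg, φ, hφ, hlim⟩ := hΓ.isCompact.tendsto_subseq
      fun N => IsCompactUnitaryGroup.pow_mem hΓ.toIsCompactUnitaryGroup hE (k N)
    refine hneg ((hA.eq_neg_one_of_forall hΓ fun τ z hz => ?_) ▸ hg)
    by_cases hτ : Wt A τ = ⊥
    · rw [hτ, Submodule.mem_bot] at hz
      simp [hz]
    have h1 : Tendsto (fun N => u ⟨τ, hτ⟩ ^ k N) atTop (𝓝 (-1)) := by
      rw [tendsto_iff_norm_sub_tendsto_zero]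
      refine squeeze_zero (fun N => norm_nonneg _) (fun N => ?_)
        tendsto_one_div_add_atTop_nhds_zero_nat
      rw [sub_neg_eq_add]
      exact (hk N _).le
    have h2 := (h1.comp hφ.tendsto_atTop).smul_const z
    have h3 : Tendsto (fun N => (E ^ k (φ N)) *ᵥ z) atTop (𝓝 (g *ᵥ z)) :=
      ((continuous_id.matrix_mulVec continuous_const).tendsto g).comp hlim
    rw [neg_one_smul] at h2
    refine tendsto_nhds_unique h3 (h2.congr fun N => ?_)
    exact (pow_mulVec_of_mulVec_eq_smul (exp_sum_smul_mulVec c hz) _).symm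
  · refine ⟨m, hm, fun i => (p i).1, fun i => (p i).2, ?_⟩
    by_contra hne
    have h1 : Complex.exp (Complex.I * ((c ⬝ᵥ ∑ i, (p i).1 : ℝ) : ℂ)) = 1 := by
      rw [← hp, dotProduct_sum, Complex.ofReal_sum, Finset.mul_sum, Complex.exp_sum]
    obtain ⟨n, hn⟩ := Complex.exp_eq_one_iff.1 h1
    refine hc _ ⟨⟨⟨m, p⟩, rfl⟩, hne⟩ n ?_
    have h2 : Complex.I * ((c ⬝ᵥ ∑ i, (p i).1 : ℝ) : ℂ) =
        Complex.I * ((n * (2 * Real.pi) : ℝ) : ℂ) := by rw [hn]; push_cast; ring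
    exact_mod_cast mul_left_cancel₀ Complex.I_ne_zero h2

lemma neg_root {α : Fin r → ℝ} (h : Rt Γ A α ≠ ⊥) : Rt Γ A (-α) ≠ ⊥ := by
  obtain ⟨X, hX, hX0⟩ := Submodule.exists_mem_ne_zero_of_ne_bot h
  exact (Submodule.ne_bot_iff _).2 ⟨_, hA.conjTranspose_mem_Rt hΓ hX, by simpa using hX0⟩

/-- If zero is not a weight then no sum of roots is a weight. -/
lemma Wt_sum_eq_bot (h0 : Wt A 0 = ⊥) (n : ℕ) : ∀ s : Multiset (Fin r → ℝ), s.card = n →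
    (∀ α ∈ s, Rt Γ A α ≠ ⊥) → Wt A s.sum = ⊥ := by
  induction n with
  | zero =>
    intro s hs _
    rw [Multiset.card_eq_zero] at hs
    rw [hs, Multiset.sum_zero, h0]
  | succ n ih =>
    intro s hs hroot
    by_contra hw
    have hne : s.sum ≠ 0 := by rintro h; rw [h] at hw; exact hw h0
    obtain ⟨α, hα, hpos⟩ : ∃ α ∈ s, 0 < α ⬝ᵥ s.sum := by
      by_contra! hc
      have h1 : s.sum ⬝ᵥ s.sum = (s.map fun α => α ⬝ᵥ s.sum).sum := by
        have : ∀ (t : Multiset (Fin r → ℝ)) (σ : Fin r → ℝ),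
            t.sum ⬝ᵥ σ = (t.map fun α => α ⬝ᵥ σ).sum := by
          intro t σ
          induction t using Multiset.induction_on with
          | empty => simp
          | cons a t ih => simp [add_dotProduct, ih]
        exact this _ _
      have h2 : (s.map fun α => α ⬝ᵥ s.sum).sum ≤ 0 := by
        have h3 := Multiset.sum_le_card_nsmul (s.map fun α => α ⬝ᵥ s.sum) 0 fun x hx => by
          obtain ⟨α, hα, rfl⟩ := Multiset.mem_map.1 hx
          exact hc α hα
        rwa [smul_zero] at h3
      exact absurd (dotProduct_self_pos hne) (not_lt.2 (h1 ▸ h2))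
    obtain ⟨X, hX, hX0⟩ := Submodule.exists_mem_ne_zero_of_ne_bot (hA.neg_root hΓ (hroot α hα))
    obtain ⟨z, hz, hz0⟩ := Submodule.exists_mem_ne_zero_of_ne_bot hw
    have h3 := hA.mulVec_ne_zero hΓ hX hX0 hz hz0 (by rw [neg_dotProduct]; linarith)
    have h4 := mulVec_mem_Wt hX hz
    have h5 : s.sum + -α = (s.erase α).sum := by
      rw [← Multiset.cons_erase hα, Multiset.sum_cons, Multiset.erase_cons_head]
      abel
    rw [h5, ih (s.erase α) (by rw [Multiset.card_erase_of_mem hα, hs]; rfl)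
      fun β hβ => hroot β (Multiset.mem_of_mem_erase hβ)] at h4
    exact h3 h4

end IsCartan

/-- The additive group generated by the roots. -/
def rootLattice (Γ : Set (Matrix ι ι ℂ)) (A : Fin r → Matrix ι ι ℂ) : AddSubgroup (Fin r → ℝ) :=
  AddSubgroup.closure {α | Rt Γ A α ≠ ⊥}

namespace IsCartan

variable (hA : IsCartan Γ A) (hΓ : IsTransitiveGroup Γ)

include hA hΓ

lemma Wt_eq_bot_of_mem_rootLattice (h0 : Wt A 0 = ⊥) {ω : Fin r → ℝ}
    (hω : ω ∈ rootLattice Γ A) : Wt A ω = ⊥ := by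
  have h1 : ω ∈ (AddSubgroup.closure {α | Rt Γ A α ≠ ⊥}).toAddSubmonoid := hω
  rw [AddSubgroup.closure_toAddSubmonoid] at h1
  have h2 : {α | Rt Γ A α ≠ ⊥} ∪ -{α | Rt Γ A α ≠ ⊥} = {α | Rt Γ A α ≠ ⊥} := by
    refine Set.union_eq_left.2 fun α hα => ?_
    have := hA.neg_root hΓ hα
    rwa [neg_neg] at this
  rw [h2] at h1
  obtain ⟨s, hs, rfl⟩ := AddSubmonoid.exists_multiset_of_mem_closure h1
  exact hA.Wt_sum_eq_bot hΓ h0 _ s rfl hs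

section NoZeroWeight

variable (h0 : Wt A 0 = ⊥)

include h0

lemma ne_zero_of_ne_bot {ω : Fin r → ℝ} (hω : Wt A ω ≠ ⊥) : ω ≠ 0 := by
  rintro rfl; exact hω h0

lemma eq_zero_of_root_orthogonal {ω ω' : Fin r → ℝ} {y z : ι → ℂ} (hz : z ∈ Wt A ω) (hz0 : z ≠ 0)
    (hy : y ∈ Wt A ω') (hyz : star y ⬝ᵥ z = 0) (hyz' : y ⬝ᵥ z = 0)
    (h₁ : ∀ Z ∈ Rt Γ A (ω' - ω), star y ⬝ᵥ (Z *ᵥ z) = 0) (h₂ : Rt Γ A (ω' + ω) = ⊥) : y = 0 := by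
  have hω := hA.ne_zero_of_ne_bot hΓ h0 ((Submodule.ne_bot_iff _).2 ⟨z, hz, hz0⟩)
  have hzs := hA.star_mem_Wt hΓ hz
  have hne : z + star z ≠ 0 := by
    intro h
    have h1 : star z ⬝ᵥ star z = 0 := hA.orthogonal hΓ
      (fun e => hω (by simpa using self_eq_neg.1 e)) hz hzs
    have h2 : star z ⬝ᵥ z = 0 := by
      rw [show star z ⬝ᵥ z = star z ⬝ᵥ -star z from congrArg _ (eq_neg_of_add_eq_zero_left h),
        dotProduct_neg, h1, neg_zero]
    rw [star_dotProduct_self_eq] at h2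
    exact hz0 (nsq_eq_zero.1 (by exact_mod_cast h2))
  refine hA.eq_zero_of_star_dotProduct_mulVec hΓ hz hzs (by rw [star_add, star_star, add_comm])
    hne hy ?_ h₁ ?_
  · rw [dotProduct_add, hyz', zero_add, dotProduct_comm]
    exact star_dotProduct_eq_zero_symm hyz
  · rw [sub_neg_eq_add, h₂]
    rintro Z hZ
    rw [(Submodule.mem_bot ℂ).1 hZ]
    simp

lemma sub_mem_or_add_mem {ω ω' : Fin r → ℝ} (hω : Wt A ω ≠ ⊥) (hω' : Wt A ω' ≠ ⊥) :
    ω' - ω ∈ rootLattice Γ A ∨ ω' + ω ∈ rootLattice Γ A := by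
  by_contra! hc
  obtain ⟨z, hz, hz0⟩ := Submodule.exists_mem_ne_zero_of_ne_bot hω
  obtain ⟨y, hy, hy0⟩ := Submodule.exists_mem_ne_zero_of_ne_bot hω'
  have h1 : Rt Γ A (ω' - ω) = ⊥ := by
    by_contra h; exact hc.1 (AddSubgroup.subset_closure h)
  have h2 : Rt Γ A (ω' + ω) = ⊥ := by
    by_contra h; exact hc.2 (AddSubgroup.subset_closure h)
  refine hy0 (hA.eq_zero_of_root_orthogonal hΓ h0 hz hz0 hy ?_ ?_ ?_ h2)
  · refine hA.orthogonal hΓ ?_ hy hz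
    rintro rfl
    exact hc.1 (by simp [(rootLattice Γ A).zero_mem])
  · refine hA.dotProduct_eq_zero hΓ (fun h => hc.2 ?_) hy hz
    rw [h]; exact (rootLattice Γ A).zero_mem
  · rw [h1]
    rintro Z hZ
    rw [(Submodule.mem_bot ℂ).1 hZ]
    simp

/-- Unless the group contains `-1`, twice a weight is not in the root lattice. -/
lemma add_self_notMem_rootLattice (hneg : -1 ∉ Γ) {ω : Fin r → ℝ} (hω : Wt A ω ≠ ⊥) :
    ω + ω ∉ rootLattice Γ A := by
  intro h2
  have hall : ∀ τ, Wt A τ ≠ ⊥ → τ - ω ∈ rootLattice Γ A := fun τ hτ => by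
    rcases hA.sub_mem_or_add_mem hΓ h0 hω hτ with h | h
    · exact h
    · have := (rootLattice Γ A).sub_mem h h2
      rwa [show τ + ω - (ω + ω) = τ - ω by abel] at this
  obtain ⟨m, ⟨k, hk⟩, p, hp, hsum⟩ := hA.exists_odd_sum_eq_zero hΓ hneg
  have h3 : ∑ i, (p i - ω) ∈ rootLattice Γ A :=
    AddSubgroup.sum_mem _ fun i _ => hall _ (hp i)
  rw [Finset.sum_sub_distrib, hsum, zero_sub, Finset.sum_const, Finset.card_univ,
    Fintype.card_fin, neg_mem_iff, hk] at h3
  have h4 := (rootLattice Γ A).sub_mem h3 ((rootLattice Γ A).nsmul_mem h2 k)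
  have h5 : (2 * k + 1) • ω - k • (ω + ω) = ω := by module
  rw [h5] at h4
  exact hω (hA.Wt_eq_bot_of_mem_rootLattice hΓ h0 h4)

lemma Rt_eq_bot_of_notMem {α : Fin r → ℝ} (h : α ∉ rootLattice Γ A) : Rt Γ A α = ⊥ := by
  by_contra hr; exact h (AddSubgroup.subset_closure hr)

/-- Weights have multiplicity one. -/
lemma eq_smul_of_mem_Wt (hneg : -1 ∉ Γ) {ω : Fin r → ℝ} {z : ι → ℂ} (hz : z ∈ Wt A ω)
    (hz1 : nsq z = 1) {y : ι → ℂ} (hy : y ∈ Wt A ω) : y = (star z ⬝ᵥ y) • z := by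
  have hz0 : z ≠ 0 := by rintro rfl; simp [nsq_eq_zero.2] at hz1
  have hω : Wt A ω ≠ ⊥ := (Submodule.ne_bot_iff _).2 ⟨z, hz, hz0⟩
  have h2 := hA.add_self_notMem_rootLattice hΓ h0 hneg hω
  refine eq_smul_of_forall_orthogonal hz1 hz (fun y hy hzy => ?_) hy
  have hyz := star_dotProduct_eq_zero_symm hzy
  refine hA.eq_zero_of_root_orthogonal hΓ h0 hz hz0 hy hyz ?_ ?_
    (hA.Rt_eq_bot_of_notMem hΓ h0 h2)
  · refine hA.dotProduct_eq_zero hΓ (fun h => h2 ?_) hy hz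
    rw [h]; exact (rootLattice Γ A).zero_mem
  · intro Z hZ
    rw [sub_self] at hZ
    obtain ⟨c, hc⟩ := hA.mulVec_of_mem_Rt_zero hΓ hZ ω
    rw [hc z hz, dotProduct_smul, hyz, smul_zero]

end NoZeroWeight

end IsCartan

end TransitiveSphere

namespace TransitiveSphere

open Filter Topology Matrix
open scoped Matrix.Norms.L2Operator

variable {ι : Type*} [Fintype ι] [DecidableEq ι]
variable {Γ : Set (Matrix ι ι ℂ)} {U : Submodule ℂ (ι → ℂ)}

lemma exp_mulVec_mem {M : Matrix ι ι ℂ} (h : ∀ u ∈ U, M *ᵥ u ∈ U) {u : ι → ℂ} (hu : u ∈ U) :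
    NormedSpace.exp M *ᵥ u ∈ U := by
  have hp : ∀ n : ℕ, M ^ n *ᵥ u ∈ U := fun n => by
    induction n with
    | zero => simpa
    | succ n ih => rw [pow_succ', ← mulVec_mulVec]; exact h _ ih
  have hs := NormedSpace.exp_series_hasSum_exp' (𝕂 := ℂ) M
  let L : Matrix ι ι ℂ →ₗ[ℂ] (ι → ℂ) :=
    { toFun := fun N => N *ᵥ u
      map_add' := fun a b => add_mulVec a b u
      map_smul' := fun a b => smul_mulVec a b u }
  have h1 := hs.map L (LinearMap.continuous_of_finiteDimensional L)
  refine (Submodule.closed_of_finiteDimensional U).mem_of_tendsto h1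
    (Eventually.of_forall fun F => U.sum_mem fun n _ => ?_)
  change ((n.factorial : ℂ)⁻¹ • M ^ n) *ᵥ u ∈ U
  rw [smul_mulVec]
  exact U.smul_mem _ (hp n)

/-- An isotropic subspace, invariant under the Lie algebra, which together with its complex
conjugate spans everything. -/
structure IsPolarization (Γ : Set (Matrix ι ι ℂ)) (U : Submodule ℂ (ι → ℂ)) : Prop where
  dotProduct_eq_zero : ∀ u ∈ U, ∀ v ∈ U, u ⬝ᵥ v = 0
  exists_eq_add_star : ∀ ζ, ∃ a ∈ U, ∃ c ∈ U, ζ = a + star c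
  mulVec_mem : ∀ Z ∈ cLie Γ, ∀ u ∈ U, Z *ᵥ u ∈ U

/-- The complexified Lie algebra contains a square-zero rank one operator of `U`, with image
spanned by `a` and kernel orthogonal to `b`. -/
structure RankOne (Γ : Set (Matrix ι ι ℂ)) (U : Submodule ℂ (ι → ℂ)) (a b : ι → ℂ) : Prop where
  left_mem : a ∈ U
  right_mem : b ∈ U
  orthogonal : star b ⬝ᵥ a = 0
  exists_mem : ∃ e ∈ cLie Γ, ∀ u ∈ U, e *ᵥ u = (star b ⬝ᵥ u) • a

lemma eq_zero_of_orthogonal {u : ι → ℂ} (hu : u ∈ U) (h : ∀ v ∈ U, star v ⬝ᵥ u = 0) : u = 0 := by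
  have h1 := h u hu
  rw [star_dotProduct_self_eq] at h1
  exact nsq_eq_zero.1 (by exact_mod_cast h1)

lemma star_dotProduct_self_ne_zero {u : ι → ℂ} (hu : u ≠ 0) : star u ⬝ᵥ u ≠ 0 := by
  rw [star_dotProduct_self_eq]
  exact_mod_cast (nsq_pos hu).ne'

lemma star_smul_dotProduct (c : ℂ) (u v : ι → ℂ) : star (c • u) ⬝ᵥ v = star c * (star u ⬝ᵥ v) := by
  rw [star_smul, smul_dotProduct, smul_eq_mul]

namespace RankOne

lemma smul_right {a b : ι → ℂ} (h : RankOne Γ U a b) (c : ℂ) : RankOne Γ U a (c • b) := by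
  obtain ⟨e, he, hu⟩ := h.exists_mem
  refine ⟨h.left_mem, U.smul_mem _ h.right_mem, ?_, star c • e, (cLie Γ).smul_mem _ he, ?_⟩
  · rw [star_smul_dotProduct, h.orthogonal, mul_zero]
  · intro u hu'
    rw [smul_mulVec, hu u hu', star_smul_dotProduct, smul_smul]

lemma sub_right {a b c : ι → ℂ} (h : RankOne Γ U a b) (h' : RankOne Γ U a c) :
    RankOne Γ U a (b - c) := by
  obtain ⟨e, he, hu⟩ := h.exists_mem
  obtain ⟨f, hf, hu'⟩ := h'.exists_mem
  refine ⟨h.left_mem, U.sub_mem h.right_mem h'.right_mem, ?_, e - f, (cLie Γ).sub_mem he hf, ?_⟩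
  · rw [star_sub, sub_dotProduct, h.orthogonal, h'.orthogonal, sub_zero]
  · intro u hU
    rw [sub_mulVec, hu u hU, hu' u hU, star_sub, sub_dotProduct, sub_smul]

lemma smul_left {a b : ι → ℂ} (h : RankOne Γ U a b) (c : ℂ) : RankOne Γ U (c • a) b := by
  obtain ⟨e, he, hu⟩ := h.exists_mem
  refine ⟨U.smul_mem _ h.left_mem, h.right_mem, ?_, c • e, (cLie Γ).smul_mem _ he, ?_⟩
  · rw [dotProduct_smul, h.orthogonal, smul_zero]
  · intro u hu'
    rw [smul_mulVec, hu u hu', smul_comm]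

variable (hΓ : IsTransitiveGroup Γ)

include hΓ

lemma mulVec {a b : ι → ℂ} (h : RankOne Γ U a b) {g : Matrix ι ι ℂ} (hg : g ∈ Γ)
    (h1 : ∀ u ∈ U, g *ᵥ u ∈ U) (h2 : ∀ u ∈ U, gᴴ *ᵥ u ∈ U) :
    RankOne Γ U (g *ᵥ a) (g *ᵥ b) := by
  obtain ⟨e, he, hu⟩ := h.exists_mem
  refine ⟨h1 _ h.left_mem, h1 _ h.right_mem, ?_, g * e * gᴴ, hΓ.conj_mem_cLie hg he, ?_⟩
  · rw [hΓ.star_mulVec_dotProduct_mulVec hg, h.orthogonal]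
  · intro u hU
    rw [← mulVec_mulVec, ← mulVec_mulVec, hu _ (h2 u hU), mulVec_smul, star_mulVec_dotProduct]

/-- Composition of rank one operators. -/
lemma trans {a b a' b' : ι → ℂ} (h : RankOne Γ U a b) (h' : RankOne Γ U a' b')
    (hne : star b ⬝ᵥ a' ≠ 0) (h0 : star b' ⬝ᵥ a = 0) : RankOne Γ U a b' := by
  obtain ⟨e, he, hu⟩ := h.exists_mem
  obtain ⟨f, hf, hu'⟩ := h'.exists_mem
  refine ⟨h.left_mem, h'.right_mem, h0, (star b ⬝ᵥ a')⁻¹ • (e * f - f * e),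
    (cLie Γ).smul_mem _ (hΓ.commutator_mem_cLie he hf), fun u hU => ?_⟩
  rw [smul_mulVec, sub_mulVec, ← mulVec_mulVec, ← mulVec_mulVec, hu u hU, hu' u hU, mulVec_smul,
    mulVec_smul, hu _ h'.left_mem, hu' _ h.left_mem, h0, zero_smul, smul_zero, sub_zero,
    smul_comm, inv_smul_smul₀ hne]

variable (hU : IsPolarization Γ U)

include hU

lemma conjTranspose_mulVec {a b : ι → ℂ} (hb : b ∈ U) {e : Matrix ι ι ℂ}
    (he : e ∈ cLie Γ) (hu : ∀ u ∈ U, e *ᵥ u = (star b ⬝ᵥ u) • a) {u : ι → ℂ} (hu' : u ∈ U) :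
    eᴴ *ᵥ u = (star a ⬝ᵥ u) • b := by
  rw [← sub_eq_zero]
  refine eq_zero_of_orthogonal (U.sub_mem (hU.mulVec_mem _ (hΓ.conjTranspose_mem_cLie he) _ hu')
    (U.smul_mem _ hb)) fun v hv => ?_
  rw [dotProduct_sub, ← star_mulVec_dotProduct, hu v hv, star_smul_dotProduct, dotProduct_smul,
    star_dotProduct_symm, smul_eq_mul, mul_comm, sub_self]

lemma symm {a b : ι → ℂ} (h : RankOne Γ U a b) : RankOne Γ U b a := by
  obtain ⟨e, he, hu⟩ := h.exists_mem
  exact ⟨h.right_mem, h.left_mem, star_dotProduct_eq_zero_symm h.orthogonal, eᴴ,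
    hΓ.conjTranspose_mem_cLie he, fun u hu' =>
      conjTranspose_mulVec hΓ hU h.right_mem he hu hu'⟩

lemma of_common {a c b : ι → ℂ} (hb : b ≠ 0) (h : RankOne Γ U a b) (h' : RankOne Γ U c b)
    (hac : star c ⬝ᵥ a = 0) : RankOne Γ U a c :=
  h.trans hΓ (h'.symm hΓ hU) (star_dotProduct_self_ne_zero hb) hac

/-- The group element negating `a` and `b` and fixing their complement in `U`. -/
lemma exists_flip {a b : ι → ℂ} (h : RankOne Γ U a b) (ha : nsq a = 1) (hb : nsq b = 1) :
    ∃ g ∈ Γ, g *ᵥ a = -a ∧ g *ᵥ b = -b ∧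
      ∀ u ∈ U, star a ⬝ᵥ u = 0 → star b ⬝ᵥ u = 0 → g *ᵥ u = u := by
  obtain ⟨e, he, hu⟩ := h.exists_mem
  have hu' : ∀ u ∈ U, eᴴ *ᵥ u = (star a ⬝ᵥ u) • b := fun u hU' =>
    conjTranspose_mulVec hΓ hU h.right_mem he hu hU'
  set H := e * eᴴ - eᴴ * e with hH
  have hHu : ∀ u ∈ U, H *ᵥ u = (star a ⬝ᵥ u) • a - (star b ⬝ᵥ u) • b := fun u hU' => by
    rw [hH, sub_mulVec, ← mulVec_mulVec, ← mulVec_mulVec, hu u hU', hu' u hU', mulVec_smul,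
      mulVec_smul, hu _ h.right_mem, hu' _ h.left_mem, star_dotProduct_self_eq,
      star_dotProduct_self_eq, ha, hb, Complex.ofReal_one, one_smul, one_smul]
  have hmem : Complex.I • H ∈ lieAlg Γ := by
    refine hΓ.I_smul_mem_of_isHermitian (hΓ.commutator_mem_cLie he
      (hΓ.conjTranspose_mem_cLie he)) ?_
    rw [hH, conjTranspose_sub, conjTranspose_mul, conjTranspose_mul, conjTranspose_conjTranspose]
  have hab := star_dotProduct_eq_zero_symm h.orthogonal
  have key : ∀ u : ι → ℂ, ∀ c : ℝ, H *ᵥ u = (c : ℂ) • u →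
      NormedSpace.exp (Real.pi • Complex.I • H) *ᵥ u = Complex.exp (c * Real.pi * Complex.I) • u :=
    fun u c hc => exp_mulVec_of_mulVec_eq_smul (by
      rw [smul_mulVec, smul_mulVec, hc, smul_smul, ← Complex.coe_smul, smul_smul]
      ring_nf)
  refine ⟨NormedSpace.exp (Real.pi • Complex.I • H),
    exp_mem_of_mem_lieAlg (smul_mem_lieAlg hmem _), ?_, ?_, fun u hU' h1 h2 => ?_⟩
  · rw [key a 1 (by rw [hHu a h.left_mem, h.orthogonal, star_dotProduct_self_eq, ha]; simp)]
    simp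
  · rw [key b (-1) (by rw [hHu b h.right_mem, hab, star_dotProduct_self_eq, hb]; simp)]
    simp [Complex.exp_neg]
  · rw [key u 0 (by rw [hHu u hU', h1, h2]; simp)]
    simp

end RankOne

namespace IsPolarization

variable (hΓ : IsTransitiveGroup Γ) (hU : IsPolarization Γ U)

include hU in
lemma eq_of_add_star_eq {a b : ι → ℂ} (ha : a ∈ U) (hb : b ∈ U) (h : a + star a = b + star b) :
    a = b := by
  rw [← sub_eq_zero]
  refine eq_zero_of_orthogonal (U.sub_mem ha hb) fun v hv => ?_
  have h1 : a - b = star (b - a) := by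
    rw [star_sub, sub_eq_sub_iff_add_eq_add, h, add_comm]
  rw [h1, star_dotProduct_star, hU.dotProduct_eq_zero _ (U.sub_mem hb ha) _ hv, star_zero]

include hΓ hU

/-- The elements preserving `U` act transitively on its unit vectors up to sign. -/
lemma exists_mulVec_eq {a b : ι → ℂ} (ha : a ∈ U) (hb : b ∈ U) (ha1 : nsq a = 1)
    (hb1 : nsq b = 1) : ∃ g ∈ Γ, (∀ u ∈ U, g *ᵥ u ∈ U) ∧ (∀ u ∈ U, gᴴ *ᵥ u ∈ U) ∧
      (g *ᵥ a = b ∨ g *ᵥ a = -b) := by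
  let S : Set (Matrix ι ι ℂ) := {g | g ∈ Γ ∧ (∀ u ∈ U, g *ᵥ u ∈ U) ∧ ∀ u ∈ U, gᴴ *ᵥ u ∈ U}
  have hUc : IsClosed (U : Set (ι → ℂ)) := Submodule.closed_of_finiteDimensional U
  have hS : IsCompact S := by
    have h1 : IsClosed {g : Matrix ι ι ℂ | ∀ u ∈ U, g *ᵥ u ∈ U} := by
      simp only [Set.ofPred_forall]
      exact isClosed_biInter fun u _ =>
        hUc.preimage (continuous_id.matrix_mulVec continuous_const)
    have h2 : IsClosed {g : Matrix ι ι ℂ | ∀ u ∈ U, gᴴ *ᵥ u ∈ U} := by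
      simp only [Set.ofPred_forall]
      exact isClosed_biInter fun u _ =>
        hUc.preimage (continuous_id.matrix_conjTranspose.matrix_mulVec continuous_const)
    exact hΓ.isCompact.inter_right (h1.inter h2)
  have hexp : ∀ X ∈ lieAlg Γ, ∀ g ∈ S, NormedSpace.exp X * g ∈ S := by
    rintro X hX g ⟨hg, h1, h2⟩
    have hXc := mem_cLie_of_mem hX
    refine ⟨hΓ.exp_mul_mem X hX g hg, fun u hu => ?_, fun u hu => ?_⟩
    · rw [← mulVec_mulVec]
      exact exp_mulVec_mem (hU.mulVec_mem X hXc) (h1 u hu)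
    · rw [conjTranspose_mul, ← mulVec_mulVec, ← star_eq_conjTranspose (NormedSpace.exp X),
        star_exp_of_skew (star_eq_neg_of_mem_lieAlg hΓ.toIsCompactUnitaryGroup hX)]
      exact h2 _ (exp_mulVec_mem (hU.mulVec_mem _ ((cLie Γ).neg_mem hXc)) hu)
  have hs0 : ((Real.sqrt 2 : ℝ) : ℂ) ≠ 0 := by
    exact_mod_cast (Real.sqrt_pos.2 (by norm_num : (0 : ℝ) < 2)).ne'
  let s : ℂ := ((Real.sqrt 2 : ℝ) : ℂ)⁻¹
  have hs : star s = s := by simp [s]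
  have hreal : ∀ c : ι → ℂ, star (s • (c + star c)) = s • (c + star c) := fun c => by
    rw [star_smul, hs, star_add, star_star, add_comm]
  have hunit : ∀ c ∈ U, nsq c = 1 → nsq (s • (c + star c)) = 1 := fun c hc hc1 => by
    have h0 := hU.dotProduct_eq_zero c hc c hc
    have h1 : (nsq (c + star c) : ℂ) = 2 := by
      rw [← star_dotProduct_self_eq, star_add, star_star, add_dotProduct, dotProduct_add,
        dotProduct_add, h0, star_dotProduct_star, h0, dotProduct_comm c,
        star_dotProduct_self_eq, hc1]
      norm_num
    have h2 : nsq (c + star c) = 2 := by exact_mod_cast h1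
    rw [nsq_smul, h2]
    simp [s]
  obtain ⟨g, ⟨hg, h1, h2⟩, h⟩ := hΓ.exists_mem_mulVec_eq_or_neg (S := S) (fun g hg => hg.1) hS
    ⟨1, hΓ.one_mem, fun u hu => by simpa, fun u hu => by simpa⟩ hexp (hreal a) (hreal b)
    (hunit a ha ha1) (hunit b hb hb1)
  refine ⟨g, hg, h1, h2, ?_⟩
  have hga : g *ᵥ (s • (a + star a)) = s • (g *ᵥ a + star (g *ᵥ a)) := by
    rw [mulVec_smul, mulVec_add, star_mulVec_of_transpose_eq (hΓ.transpose_eq hg)]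
  have hs' : s ≠ 0 := inv_ne_zero hs0
  rw [hga] at h
  refine h.imp (fun h => ?_) fun h => ?_
  · exact hU.eq_of_add_star_eq (h1 _ ha) hb (smul_right_injective _ hs' h)
  · refine hU.eq_of_add_star_eq (h1 _ ha) (U.neg_mem hb) (smul_right_injective _ hs' ?_)
    rw [star_neg, ← neg_add]
    simpa using h

lemma rankOne_mulVec_or {a a' b : ι → ℂ} (h : RankOne Γ U a b) (ha' : a' ∈ U) (ha1 : nsq a = 1)
    (ha1' : nsq a' = 1) : ∃ g ∈ Γ, ∀ b, RankOne Γ U a b → RankOne Γ U a' (g *ᵥ b) := by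
  obtain ⟨g, hg, h1, h2, h3⟩ := hU.exists_mulVec_eq hΓ h.left_mem ha' ha1 ha1'
  refine ⟨g, hg, fun b hb => ?_⟩
  have h4 := hb.mulVec hΓ hg h1 h2
  rcases h3 with h3 | h3
  · rwa [h3] at h4
  · rw [h3] at h4
    simpa using h4.smul_left (-1)

lemma exists_rankOne {a₀ b₀ : ι → ℂ} (h₀ : RankOne Γ U a₀ b₀) (ha₀ : a₀ ≠ 0) (hb₀ : b₀ ≠ 0)
    {a : ι → ℂ} (ha : a ∈ U) (ha0 : a ≠ 0) : ∃ b, nsq b = 1 ∧ RankOne Γ U a b := by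
  obtain ⟨s, hs, hs1⟩ := exists_smul_nsq_eq_one ha₀
  obtain ⟨t, ht, ht1⟩ := exists_smul_nsq_eq_one ha0
  obtain ⟨q, hq, hq1⟩ := exists_smul_nsq_eq_one hb₀
  obtain ⟨g, hg, h⟩ := hU.rankOne_mulVec_or hΓ ((h₀.smul_left s).smul_right q)
    (U.smul_mem (t : ℂ) ha) hs1 ht1
  refine ⟨g *ᵥ ((q : ℂ) • b₀), by rw [hΓ.nsq_mulVec hg, hq1], ?_⟩
  have h1 := (h _ ((h₀.smul_left s).smul_right q)).smul_left (t : ℂ)⁻¹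
  rwa [inv_smul_smul₀ (by exact_mod_cast ht.ne')] at h1

end IsPolarization

end TransitiveSphere

namespace TransitiveSphere

open Filter Topology Matrix
open scoped Matrix.Norms.L2Operator

variable {ι : Type*} [Fintype ι] [DecidableEq ι]
variable {Γ : Set (Matrix ι ι ℂ)} {U : Submodule ℂ (ι → ℂ)}

namespace IsPolarization

variable (hΓ : IsTransitiveGroup Γ) (hU : IsPolarization Γ U)

include hΓ hU

section Abundant

variable (hex : ∀ a ∈ U, a ≠ 0 → ∃ b, nsq b = 1 ∧ RankOne Γ U a b)
variable (hab : ∀ c ∈ U, c ≠ 0 → ∀ a ∈ U, ∃ b, b ≠ 0 ∧ RankOne Γ U c b ∧ star a ⬝ᵥ b = 0)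

include hex hab

lemma rankOne_of_orthogonal {a c : ι → ℂ} (ha : a ∈ U) (hc : c ∈ U) (ha0 : a ≠ 0) (hc0 : c ≠ 0)
    (hca : star c ⬝ᵥ a = 0) : RankOne Γ U a c := by
  obtain ⟨b, hb1, hb⟩ := hex a ha ha0
  have hb0 : b ≠ 0 := by rintro rfl; simp [nsq] at hb1
  have key : ∀ d ∈ U, d ≠ 0 → star d ⬝ᵥ a = 0 → star b ⬝ᵥ d ≠ 0 → RankOne Γ U a d := by
    intro d hd hd0 hda hbd
    obtain ⟨b', hb'0, hb', hab'⟩ := hab d hd hd0 a ha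
    have h1 := hb.trans hΓ hb' hbd (star_dotProduct_eq_zero_symm hab')
    exact h1.of_common hΓ hU hb'0 hb' hda
  by_cases hbc : star b ⬝ᵥ c = 0
  · have hne : star b ⬝ᵥ (c + b) ≠ 0 := by
      rw [dotProduct_add, hbc, zero_add]
      exact star_dotProduct_self_ne_zero hb0
    have h1 := key (c + b) (U.add_mem hc hb.right_mem) (by rintro h; rw [h] at hne; simp at hne)
      (by rw [star_add, add_dotProduct, hca, hb.orthogonal, add_zero]) hne
    simpa using h1.sub_right hb
  · exact key c hc hc0 hca hbc

lemma exists_mulVec_eq_neg_of_ne_zero {a c : ι → ℂ} (ha : a ∈ U) (hc : c ∈ U) (ha0 : a ≠ 0) :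
    ∃ g ∈ Γ, g *ᵥ (a + star c) = -(a + star c) := by
  obtain ⟨t, ht, ht1⟩ := exists_smul_nsq_eq_one ha0
  have ht0 : (t : ℂ) ≠ 0 := by exact_mod_cast ht.ne'
  set x := (t : ℂ) • a with hx
  have hxU : x ∈ U := U.smul_mem _ ha
  have hax : a = (t : ℂ)⁻¹ • x := by rw [hx, inv_smul_smul₀ ht0]
  set d := c - (star x ⬝ᵥ c) • x with hd
  have hdU : d ∈ U := U.sub_mem hc (U.smul_mem _ hxU)
  have hxd : star x ⬝ᵥ d = 0 := by
    rw [hd, dotProduct_sub, dotProduct_smul, star_dotProduct_self_eq, ht1]; simp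
  have hx0 : x ≠ 0 := smul_ne_zero ht0 ha0
  obtain ⟨b, hb1, hb, s, hs⟩ : ∃ b, nsq b = 1 ∧ RankOne Γ U x b ∧ ∃ s : ℂ, d = s • b := by
    by_cases hd0 : d = 0
    · obtain ⟨b, hb1, hb⟩ := hex x hxU hx0
      exact ⟨b, hb1, hb, 0, by rw [hd0, zero_smul]⟩
    · obtain ⟨s, hs, hs1⟩ := exists_smul_nsq_eq_one hd0
      have hs0 : (s : ℂ) ≠ 0 := by exact_mod_cast hs.ne'
      exact ⟨_, hs1, (hU.rankOne_of_orthogonal hΓ hex hab hxU hdU hx0 hd0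
        (star_dotProduct_eq_zero_symm hxd)).smul_right s, (s : ℂ)⁻¹, (inv_smul_smul₀ hs0 _).symm⟩
  obtain ⟨g, hg, hgx, hgb, -⟩ := hb.exists_flip hΓ hU ht1 hb1
  have hgc : g *ᵥ c = -c := by
    have hc' : c = s • b + (star x ⬝ᵥ c) • x := by rw [← hs, hd]; abel
    rw [hc', mulVec_add, mulVec_smul, mulVec_smul, hgx, hgb, ← hc', smul_neg, smul_neg, ← neg_add,
      ← hc']
  refine ⟨g, hg, ?_⟩
  rw [mulVec_add, ← star_mulVec_of_transpose_eq (hΓ.transpose_eq hg), hgc, hax, mulVec_smul, hgx,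
    smul_neg, star_neg, neg_add]

lemma exists_mulVec_eq_neg_of_abundant (ζ : ι → ℂ) : ∃ g ∈ Γ, g *ᵥ ζ = -ζ := by
  obtain ⟨a, ha, c, hc, rfl⟩ := hU.exists_eq_add_star ζ
  by_cases ha0 : a = 0
  · by_cases hc0 : c = 0
    · exact ⟨1, hΓ.one_mem, by simp [ha0, hc0]⟩
    · obtain ⟨g, hg, h⟩ := hU.exists_mulVec_eq_neg_of_ne_zero hΓ hex hab hc ha hc0
      refine ⟨g, hg, star_injective ?_⟩
      rw [star_mulVec_of_transpose_eq (hΓ.transpose_eq hg), star_neg, star_add, star_star,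
        add_comm, h]
  · exact hU.exists_mulVec_eq_neg_of_ne_zero hΓ hex hab ha hc ha0

end Abundant

section Scarce

variable (hex : ∀ a ∈ U, a ≠ 0 → ∃ b, nsq b = 1 ∧ RankOne Γ U a b)
variable (huniq : ∀ c ∈ U, c ≠ 0 → ∀ b b', b ≠ 0 → RankOne Γ U c b → RankOne Γ U c b' →
  ∃ s : ℂ, b' = s • b)

include huniq

lemma orthogonal_of_unique {a b c b' : ι → ℂ} (hc0 : c ≠ 0) (hb0 : b ≠ 0)
    (h : RankOne Γ U a b) (h' : RankOne Γ U c b') (hbc : star b ⬝ᵥ c = 0) :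
    star b' ⬝ᵥ a = 0 := by
  by_contra hne
  obtain ⟨s, rfl⟩ := huniq c h'.left_mem hc0 b b' hb0 (h'.trans hΓ h hne hbc) h'
  rw [star_smul_dotProduct, h.orthogonal, mul_zero] at hne
  exact hne rfl

/-- A subspace on which `-1` extends by the identity to an element of the group. -/
def Negatable (Γ : Set (Matrix ι ι ℂ)) (U S : Submodule ℂ (ι → ℂ)) : Prop :=
  S ≤ U ∧ (∃ g ∈ Γ, (∀ s ∈ S, g *ᵥ s = -s) ∧
    ∀ c ∈ U, (∀ s ∈ S, star s ⬝ᵥ c = 0) → g *ᵥ c = c) ∧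
    ∀ c ∈ U, c ≠ 0 → (∀ s ∈ S, star s ⬝ᵥ c = 0) → ∀ b, RankOne Γ U c b →
      ∀ s ∈ S, star s ⬝ᵥ b = 0

include hex

lemma exists_negatable_gt {S : Submodule ℂ (ι → ℂ)} (hS : Negatable Γ U S) (hne : S ≠ U) :
    ∃ S', Negatable Γ U S' ∧ S < S' := by
  obtain ⟨hSU, ⟨g, hg, hg1, hg2⟩, hS3⟩ := hS
  obtain ⟨u, hu, huS⟩ := SetLike.exists_of_lt (lt_of_le_of_ne hSU hne)
  obtain ⟨w, hw, p, rfl, hp⟩ := exists_add_orthogonal S u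
  have hpU : p ∈ U := by simpa using U.sub_mem hu (hSU hw)
  have hpS : p ∉ S := fun h => huS (S.add_mem hw h)
  have hp0 : p ≠ 0 := by rintro rfl; exact hpS S.zero_mem
  obtain ⟨t, ht, ht1⟩ := exists_smul_nsq_eq_one hp0
  have ht0 : (t : ℂ) ≠ 0 := by exact_mod_cast ht.ne'
  set a := (t : ℂ) • p with ha
  have haU : a ∈ U := U.smul_mem _ hpU
  have ha0 : a ≠ 0 := smul_ne_zero ht0 hp0
  have haS : ∀ s ∈ S, star s ⬝ᵥ a = 0 := fun s hs => by
    rw [ha, dotProduct_smul, hp s hs, smul_zero]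
  obtain ⟨b, hb1, hb⟩ := hex a haU ha0
  have hb0 : b ≠ 0 := by rintro rfl; simp [nsq] at hb1
  have hbS := hS3 a haU ha0 haS b hb
  obtain ⟨f, hf, hfa, hfb, hfu⟩ := hb.exists_flip hΓ hU ht1 hb1
  have hsup : ∀ x ∈ S ⊔ Submodule.span ℂ {a, b}, ∃ s ∈ S, ∃ i j : ℂ, x = s + (i • a + j • b) := by
    intro x hx
    obtain ⟨s, hs, y, hy, rfl⟩ := Submodule.mem_sup.1 hx
    obtain ⟨i, j, rfl⟩ := Submodule.mem_span_pair.1 hy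
    exact ⟨s, hs, i, j, rfl⟩
  have haS' : a ∈ S ⊔ Submodule.span ℂ {a, b} :=
    Submodule.mem_sup_right (Submodule.subset_span (by simp))
  have hbS' : b ∈ S ⊔ Submodule.span ℂ {a, b} :=
    Submodule.mem_sup_right (Submodule.subset_span (by simp))
  refine ⟨S ⊔ Submodule.span ℂ {a, b}, ⟨?_, ⟨g * f, hΓ.mul_mem hg hf, ?_, ?_⟩, ?_⟩, ?_⟩
  · intro x hx
    obtain ⟨s, hs, i, j, rfl⟩ := hsup x hx
    exact U.add_mem (hSU hs) (U.add_mem (U.smul_mem _ haU) (U.smul_mem _ hb.right_mem))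
  · intro x hx
    obtain ⟨s, hs, i, j, rfl⟩ := hsup x hx
    have hfs : f *ᵥ s = s := hfu s (hSU hs) (star_dotProduct_eq_zero_symm (haS s hs))
      (star_dotProduct_eq_zero_symm (hbS s hs))
    rw [← mulVec_mulVec]
    simp only [mulVec_add, mulVec_smul, mulVec_neg, hfs, hfa, hfb, hg1 s hs, hg2 a haU haS,
      hg2 b hb.right_mem hbS]
    module
  · intro c hc hcS
    rw [← mulVec_mulVec, hfu c hc (hcS a haS') (hcS b hbS')]
    exact hg2 c hc fun s hs => hcS s (Submodule.mem_sup_left hs)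
  · intro c hc hc0 hcS b' hb' x hx
    obtain ⟨s, hs, i, j, rfl⟩ := hsup x hx
    have h1 := hS3 c hc hc0 (fun s hs => hcS s (Submodule.mem_sup_left hs)) b' hb' s hs
    have h2 := star_dotProduct_eq_zero_symm
      (hU.orthogonal_of_unique hΓ huniq hc0 hb0 hb hb' (hcS b hbS'))
    have h3 := star_dotProduct_eq_zero_symm
      (hU.orthogonal_of_unique hΓ huniq hc0 ha0 (hb.symm hΓ hU) hb' (hcS a haS'))
    rw [star_add, star_add, add_dotProduct, add_dotProduct, star_smul_dotProduct i,
      star_smul_dotProduct j, h1, h2, h3, mul_zero, mul_zero, add_zero, add_zero]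
  · refine lt_of_le_of_ne le_sup_left fun h => hpS ?_
    rw [← h] at haS'
    have := S.smul_mem (t : ℂ)⁻¹ haS'
    rwa [ha, inv_smul_smul₀ ht0] at this

lemma exists_mulVec_eq_neg_of_unique (ζ : ι → ℂ) : ∃ g ∈ Γ, g *ᵥ ζ = -ζ := by
  have hbot : Negatable Γ U ⊥ := by
    refine ⟨bot_le, ⟨1, hΓ.one_mem, ?_, fun c _ _ => one_mulVec c⟩, ?_⟩
    · intro s hs
      rw [(Submodule.mem_bot ℂ).1 hs]; simp
    · intro c _ _ _ b _ s hs
      rw [(Submodule.mem_bot ℂ).1 hs]; simp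
  obtain ⟨S, hS, hmax⟩ := (wellFounded_gt (α := Submodule ℂ (ι → ℂ))).has_min
    {S | Negatable Γ U S} ⟨⊥, hbot⟩
  have hSU : S = U := by
    by_contra hne
    obtain ⟨S', hS', hlt⟩ := hU.exists_negatable_gt hΓ hex huniq hS hne
    exact hmax S' hS' hlt
  subst hSU
  obtain ⟨-, ⟨g, hg, hg1, -⟩, -⟩ := hS
  obtain ⟨a, ha, c, hc, rfl⟩ := hU.exists_eq_add_star ζ
  refine ⟨g, hg, ?_⟩
  rw [mulVec_add, ← star_mulVec_of_transpose_eq (hΓ.transpose_eq hg), hg1 a ha, hg1 c hc,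
    star_neg, neg_add]

end Scarce

theorem exists_mulVec_eq_neg {a₀ b₀ : ι → ℂ} (h₀ : RankOne Γ U a₀ b₀) (ha₀ : a₀ ≠ 0)
    (hb₀ : b₀ ≠ 0) (ζ : ι → ℂ) : ∃ g ∈ Γ, g *ᵥ ζ = -ζ := by
  have hex : ∀ a ∈ U, a ≠ 0 → ∃ b, nsq b = 1 ∧ RankOne Γ U a b := fun a ha ha0 =>
    hU.exists_rankOne hΓ h₀ ha₀ hb₀ ha ha0
  by_cases hab : ∀ c ∈ U, c ≠ 0 → ∀ a ∈ U, ∃ b, b ≠ 0 ∧ RankOne Γ U c b ∧ star a ⬝ᵥ b = 0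
  · exact hU.exists_mulVec_eq_neg_of_abundant hΓ hex hab ζ
  push Not at hab
  obtain ⟨c₀, hc₀, hc₀0, a₁, ha₁, h1⟩ := hab
  refine hU.exists_mulVec_eq_neg_of_unique hΓ hex (fun c hc hc0 b b' hb0 hb hb' => ?_) ζ
  obtain ⟨s, hs, hs1⟩ := exists_smul_nsq_eq_one hc₀0
  obtain ⟨t, ht, ht1⟩ := exists_smul_nsq_eq_one hc0
  obtain ⟨g, hg, h⟩ := hU.rankOne_mulVec_or hΓ (hb.smul_left t) (U.smul_mem (s : ℂ) hc₀) ht1 hs1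
  have h2 : ∀ b, RankOne Γ U c b → RankOne Γ U c₀ (g *ᵥ b) := fun b hb => by
    have := (h b (hb.smul_left t)).smul_left (s : ℂ)⁻¹
    rwa [inv_smul_smul₀ (by exact_mod_cast hs.ne')] at this
  have hinj : ∀ v, g *ᵥ v = 0 → v = 0 := fun v hv => by
    have := hΓ.nsq_mulVec hg v
    rw [hv] at this
    exact nsq_eq_zero.1 (this.symm.trans (nsq_eq_zero.2 rfl))
  have h3 : star a₁ ⬝ᵥ (g *ᵥ b) ≠ 0 := h1 _ (fun h => hb0 (hinj b h)) (h2 b hb)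
  refine ⟨(star a₁ ⬝ᵥ (g *ᵥ b')) / (star a₁ ⬝ᵥ (g *ᵥ b)), ?_⟩
  rw [← sub_eq_zero]
  refine hinj _ ?_
  by_contra hne
  refine h1 _ hne (h2 _ (hb'.sub_right (hb.smul_right _))) ?_
  rw [mulVec_sub, mulVec_smul, dotProduct_sub, dotProduct_smul, smul_eq_mul, div_mul_cancel₀ _ h3,
    sub_self]

end IsPolarization

end TransitiveSphere

namespace TransitiveSphere

open Filter Topology Matrix
open scoped Matrix.Norms.L2Operator

variable {ι : Type*} [Fintype ι] [DecidableEq ι] {r : ℕ}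
variable {Γ : Set (Matrix ι ι ℂ)} {A : Fin r → Matrix ι ι ℂ}

/-- The sum of the weight spaces of weights congruent to `ω` modulo the root lattice. -/
def cosetSpace (Γ : Set (Matrix ι ι ℂ)) (A : Fin r → Matrix ι ι ℂ) (ω : Fin r → ℝ) :
    Submodule ℂ (ι → ℂ) :=
  ⨆ τ ∈ {τ | τ - ω ∈ rootLattice Γ A}, Wt A τ

lemma mem_cosetSpace {ω τ : Fin r → ℝ} (h : τ - ω ∈ rootLattice Γ A) {z : ι → ℂ}
    (hz : z ∈ Wt A τ) : z ∈ cosetSpace Γ A ω :=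
  Submodule.mem_iSup_of_mem τ (Submodule.mem_iSup_of_mem h hz)

lemma cosetSpace_le {ω : Fin r → ℝ} {W : Submodule ℂ (ι → ℂ)}
    (h : ∀ τ, τ - ω ∈ rootLattice Γ A → ∀ z ∈ Wt A τ, z ∈ W) : cosetSpace Γ A ω ≤ W :=
  iSup₂_le fun τ hτ z hz => h τ hτ z hz

lemma mulVec_eq_of_mem_cosetSpace {ω : Fin r → ℝ} {M N : Matrix ι ι ℂ}
    (h : ∀ τ, τ - ω ∈ rootLattice Γ A → ∀ z ∈ Wt A τ, M *ᵥ z = N *ᵥ z) {u : ι → ℂ}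
    (hu : u ∈ cosetSpace Γ A ω) : M *ᵥ u = N *ᵥ u :=
  cosetSpace_le (W := LinearMap.eqLocus (mulVecLin M) (mulVecLin N)) h hu

namespace IsCartan

variable (hA : IsCartan Γ A) (hΓ : IsTransitiveGroup Γ) (h0 : Wt A 0 = ⊥) (hneg : -1 ∉ Γ)
variable {ω : Fin r → ℝ} (hω : Wt A ω ≠ ⊥)

include hA hΓ

lemma mulVec_mem_cosetSpace {Z : Matrix ι ι ℂ} (hZ : Z ∈ cLie Γ) {u : ι → ℂ}
    (hu : u ∈ cosetSpace Γ A ω) : Z *ᵥ u ∈ cosetSpace Γ A ω := by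
  replace hZ := hA.mem_iSup_Rt hΓ hZ
  induction hZ using Submodule.iSup_induction' with
  | mem α Z hZ =>
    refine cosetSpace_le (W := (cosetSpace Γ A ω).comap (mulVecLin Z)) (fun τ hτ z hz => ?_) hu
    change Z *ᵥ z ∈ cosetSpace Γ A ω
    by_cases hα : Rt Γ A α = ⊥
    · rw [hα, Submodule.mem_bot] at hZ
      rw [hZ, zero_mulVec]
      exact Submodule.zero_mem _
    · refine mem_cosetSpace ?_ (mulVec_mem_Wt hZ hz)
      rw [add_sub_right_comm]
      exact (rootLattice Γ A).add_mem hτ (AddSubgroup.subset_closure hα)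
  | zero => rw [zero_mulVec]; exact Submodule.zero_mem _
  | add X Y _ _ hX hY => rw [add_mulVec]; exact Submodule.add_mem _ hX hY

include h0 hneg hω

lemma isPolarization_cosetSpace : IsPolarization Γ (cosetSpace Γ A ω) := by
  refine ⟨fun u hu v hv => ?_, fun ζ => ?_, fun Z hZ u hu => hA.mulVec_mem_cosetSpace hΓ hZ hu⟩
  · have h1 : ∀ τ, τ - ω ∈ rootLattice Γ A → ∀ z ∈ Wt A τ, ∀ σ, σ - ω ∈ rootLattice Γ A →
        ∀ y ∈ Wt A σ, z ⬝ᵥ y = 0 := by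
      intro τ hτ z hz σ hσ y hy
      by_cases hz0 : z = 0
      · rw [hz0, zero_dotProduct]
      refine hA.dotProduct_eq_zero hΓ (fun h => ?_) hz hy
      refine hA.add_self_notMem_rootLattice hΓ h0 hneg
        ((Submodule.ne_bot_iff _).2 ⟨z, hz, hz0⟩) ?_
      have := (rootLattice Γ A).sub_mem hτ hσ
      rwa [sub_sub_sub_cancel_right, eq_neg_of_add_eq_zero_right h, sub_neg_eq_add] at this
    let L : (ι → ℂ) → (ι → ℂ) →ₗ[ℂ] ℂ := fun z =>
      { toFun := fun y => z ⬝ᵥ y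
        map_add' := fun a b => dotProduct_add z a b
        map_smul' := fun a b => dotProduct_smul a z b }
    have h2 : ∀ τ, τ - ω ∈ rootLattice Γ A → ∀ z ∈ Wt A τ, z ⬝ᵥ v = 0 := fun τ hτ z hz =>
      cosetSpace_le (W := (L z).ker) (fun σ hσ y hy => h1 τ hτ z hz σ hσ y hy) hv
    rw [dotProduct_comm]
    refine cosetSpace_le (W := (L v).ker) (fun τ hτ z hz => ?_) hu
    change v ⬝ᵥ z = 0
    rw [dotProduct_comm, h2 τ hτ z hz]
  · have hζ : ζ ∈ ⨆ τ, Wt A τ := by rw [hA.iSup_Wt hΓ]; trivial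
    induction hζ using Submodule.iSup_induction' with
    | mem τ z hz =>
      by_cases hz0 : z = 0
      · exact ⟨0, Submodule.zero_mem _, 0, Submodule.zero_mem _, by simp [hz0]⟩
      rcases hA.sub_mem_or_add_mem hΓ h0 hω ((Submodule.ne_bot_iff _).2 ⟨z, hz, hz0⟩) with h | h
      · exact ⟨z, mem_cosetSpace h hz, 0, Submodule.zero_mem _, by simp⟩
      · refine ⟨0, Submodule.zero_mem _, star z, mem_cosetSpace ?_ (hA.star_mem_Wt hΓ hz), by simp⟩
        rw [← neg_add', neg_mem_iff]
        exact h
    | zero => exact ⟨0, Submodule.zero_mem _, 0, Submodule.zero_mem _, by simp⟩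
    | add x y _ _ hx hy =>
      obtain ⟨a, ha, c, hc, rfl⟩ := hx
      obtain ⟨a', ha', c', hc', rfl⟩ := hy
      exact ⟨a + a', Submodule.add_mem _ ha ha', c + c', Submodule.add_mem _ hc hc', by
        rw [star_add]; abel⟩

lemma exists_weight_ne : ∃ τ, Wt A τ ≠ ⊥ ∧ τ - ω ∈ rootLattice Γ A ∧ τ ≠ ω := by
  by_contra! hc
  have hpos := dotProduct_self_pos (hA.ne_zero_of_ne_bot hΓ h0 hω)
  let c : Fin r → ℝ := (Real.pi / (ω ⬝ᵥ ω)) • ω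
  have hcω : c ⬝ᵥ ω = Real.pi := by
    simp only [c, smul_dotProduct, smul_eq_mul]
    exact div_mul_cancel₀ _ hpos.ne'
  refine hneg ((hA.eq_neg_one_of_forall hΓ fun τ z hz => ?_) ▸
    exp_mem_of_mem_lieAlg (hA.sum_smul_mem hΓ c))
  by_cases hz0 : z = 0
  · simp [hz0]
  have hτ : Wt A τ ≠ ⊥ := (Submodule.ne_bot_iff _).2 ⟨z, hz, hz0⟩
  rw [exp_sum_smul_mulVec c hz]
  rcases hA.sub_mem_or_add_mem hΓ h0 hω hτ with h | h
  · rw [hc τ hτ h, hcω, mul_comm, Complex.exp_pi_mul_I, neg_one_smul]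
  · have h1 : -τ = ω := hc _ (hA.neg_ne_bot hΓ hτ) (by rwa [← neg_add', neg_mem_iff])
    rw [← neg_neg τ, h1, dotProduct_neg, hcω, Complex.ofReal_neg, mul_neg, mul_comm,
      Complex.exp_neg, Complex.exp_pi_mul_I]
    simp

lemma exists_rankOne : ∃ a b, a ≠ 0 ∧ b ≠ 0 ∧ RankOne Γ (cosetSpace Γ A ω) a b := by
  let Ω : Set (Fin r → ℝ) := {τ | Wt A τ ≠ ⊥ ∧ τ - ω ∈ rootLattice Γ A}
  have hfin : Ω.Finite := (finite_weights A).subset fun τ hτ => hτ.1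
  have hωΩ : ω ∈ Ω := ⟨hω, by rw [sub_self]; exact (rootLattice Γ A).zero_mem⟩
  obtain ⟨τ, hτ, hτQ, hτω⟩ := hA.exists_weight_ne hΓ h0 hneg hω
  obtain ⟨⟨ω₁, ω₂⟩, ⟨hω₁, hω₂⟩, hmax⟩ := Set.exists_max_image (Ω ×ˢ Ω)
    (fun p => (p.1 - p.2) ⬝ᵥ (p.1 - p.2)) (hfin.prod hfin) ⟨(ω, ω), hωΩ, hωΩ⟩
  have hne : ω₁ - ω₂ ≠ 0 := by
    intro h
    have h1 := hmax (τ, ω) ⟨⟨hτ, hτQ⟩, hωΩ⟩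
    simp only [h, zero_dotProduct] at h1
    exact absurd (dotProduct_self_pos (sub_ne_zero.2 hτω)) (not_lt.2 h1)
  have hadd : ω₁ + ω₂ ∉ rootLattice Γ A := fun h => by
    refine hA.add_self_notMem_rootLattice hΓ h0 hneg hω ?_
    have := (rootLattice Γ A).sub_mem h ((rootLattice Γ A).add_mem hω₁.2 hω₂.2)
    rwa [show ω₁ + ω₂ - (ω₁ - ω + (ω₂ - ω)) = ω + ω by abel] at this
  have hd : ω₁ - ω₂ ∈ rootLattice Γ A := by
    have := (rootLattice Γ A).sub_mem hω₁.2 hω₂.2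
    rwa [sub_sub_sub_cancel_right] at this
  obtain ⟨a, ha, ha0⟩ := Submodule.exists_mem_ne_zero_of_ne_bot hω₁.1
  obtain ⟨b', hb', hb'0⟩ := Submodule.exists_mem_ne_zero_of_ne_bot hω₂.1
  obtain ⟨t, ht, ht1⟩ := exists_smul_nsq_eq_one hb'0
  set b := (t : ℂ) • b'
  have hb : b ∈ Wt A ω₂ := (Wt A ω₂).smul_mem _ hb'
  have hb0 : b ≠ 0 := smul_ne_zero (by exact_mod_cast ht.ne') hb'0
  have heq : ω₂ + (ω₁ - ω₂) = ω₁ := by abel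
  obtain ⟨e, he, heb⟩ := exists_mem_Rt_mulVec_eq (Γ := Γ) (α := ω₁ - ω₂) hb (y := a)
    (by rwa [heq]) (by
      rw [heq]
      intro p hp h
      refine hA.eq_zero_of_root_orthogonal hΓ h0 hb hb0 hp
        (hA.orthogonal hΓ (sub_ne_zero.1 hne) hp hb) (hA.dotProduct_eq_zero hΓ ?_ hp hb) h
        (hA.Rt_eq_bot_of_notMem hΓ h0 hadd)
      intro h; rw [h] at hadd; exact hadd (rootLattice Γ A).zero_mem)
  refine ⟨a, b, ha0, hb0, mem_cosetSpace hω₁.2 ha, mem_cosetSpace hω₂.2 hb,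
    hA.orthogonal hΓ (sub_ne_zero.1 hne).symm hb ha, e, he.1, fun u hu => ?_⟩
  have hv : ∀ u, vecMulVec a (star b) *ᵥ u = (star b ⬝ᵥ u) • a := fun u => by
    rw [vecMulVec_mulVec, op_smul_eq_smul]
  rw [← hv]
  refine mulVec_eq_of_mem_cosetSpace (fun σ hσ z hz => ?_) hu
  rw [hv]
  by_cases hσ2 : σ = ω₂
  · subst hσ2
    conv_lhs => rw [hA.eq_smul_of_mem_Wt hΓ h0 hneg hb ht1 hz, mulVec_smul, heb]
  · rw [hA.orthogonal hΓ (Ne.symm hσ2) hb hz, zero_smul]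
    by_contra hez
    have hz0 : z ≠ 0 := by rintro rfl; simp at hez
    have hσΩ : σ ∈ Ω := ⟨(Submodule.ne_bot_iff _).2 ⟨z, hz, hz0⟩, hσ⟩
    have hσd : σ + (ω₁ - ω₂) ∈ Ω := by
      refine ⟨(Submodule.ne_bot_iff _).2 ⟨_, mulVec_mem_Wt he hz, hez⟩, ?_⟩
      rw [add_sub_right_comm]
      exact (rootLattice Γ A).add_mem hσ hd
    have h1 := hmax (_, _) ⟨hσd, hω₂⟩
    have h2 := hmax (ω₁, σ) ⟨hω₁, hσΩ⟩
    have h3 := dotProduct_self_pos (sub_ne_zero.2 hσ2)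
    simp only [add_dotProduct, sub_dotProduct, dotProduct_add, dotProduct_sub,
      dotProduct_comm ω₂ ω₁, dotProduct_comm σ ω₁, dotProduct_comm σ ω₂] at h1 h2 h3
    linarith

end IsCartan

/-- Every complex vector is negated by some element of a transitive group. -/
theorem IsTransitiveGroup.exists_mulVec_eq_neg [Nontrivial ι] (hΓ : IsTransitiveGroup Γ)
    (ζ : ι → ℂ) : ∃ g ∈ Γ, g *ᵥ ζ = -ζ := by
  by_cases hneg : -1 ∈ Γ
  · exact ⟨-1, hneg, by rw [neg_mulVec, one_mulVec]⟩
  obtain ⟨r, A, hA⟩ := hΓ.exists_isCartan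
  by_cases h0 : Wt A 0 = ⊥
  · obtain ⟨ω, -, hω⟩ := hA.exists_weight_ne_zero hΓ inferInstance
    obtain ⟨a, b, ha, hb, h⟩ := hA.exists_rankOne hΓ h0 hneg hω
    exact (hA.isPolarization_cosetSpace hΓ h0 hneg hω).exists_mulVec_eq_neg hΓ h ha hb ζ
  · exact hA.exists_mulVec_eq_neg_of_zero_weight hΓ h0 ζ

end TransitiveSphere

namespace TransitiveSphere

open Filter Topology Matrix
open scoped Matrix.Norms.L2Operator

/-- The complexification of a group of real orthogonal matrices. -/
def complexify {n : ℕ} (G : Subgroup (orthogonalGroup (Fin n) ℝ)) :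
    Set (Matrix (Fin n) (Fin n) ℂ) :=
  (fun g : orthogonalGroup (Fin n) ℝ => (g : Matrix (Fin n) (Fin n) ℝ).map Complex.ofRealHom) '' G

lemma map_ofReal_mulVec {n : ℕ} (M : Matrix (Fin n) (Fin n) ℝ) (x : Fin n → ℝ) :
    M.map Complex.ofRealHom *ᵥ (fun i => (x i : ℂ)) = fun i => ((M *ᵥ x) i : ℂ) := by
  ext i
  simp [mulVec, dotProduct]

lemma isCompact_orthogonalGroup (n : ℕ) :
    IsCompact (orthogonalGroup (Fin n) ℝ : Set (Matrix (Fin n) (Fin n) ℝ)) := by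
  have hK : IsCompact (Set.univ.pi fun _ => Set.univ.pi fun _ => Set.Icc (-1 : ℝ) 1 :
      Set (Fin n → Fin n → ℝ)) :=
    isCompact_univ_pi fun _ => isCompact_univ_pi fun _ => isCompact_Icc
  refine hK.of_isClosed_subset ?_ fun M hM i _ j _ => ?_
  · have h : (orthogonalGroup (Fin n) ℝ : Set (Matrix (Fin n) (Fin n) ℝ)) = {M | M * Mᵀ = 1} :=
      Set.ext fun M => mem_orthogonalGroup_iff (Fin n) ℝ
    rw [h]
    exact isClosed_eq (continuous_id.mul continuous_id.matrix_transpose) continuous_const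
  · exact abs_le.1 (entry_norm_bound_of_unitary hM i j)

lemma isTransitiveGroup_complexify {n : ℕ} (G : Subgroup (orthogonalGroup (Fin n) ℝ))
    (hG : IsClosed (G : Set (orthogonalGroup (Fin n) ℝ)))
    (htrans : ∀ u v : Fin n → ℝ, u ⬝ᵥ u = 1 → v ⬝ᵥ v = 1 →
      ∃ g ∈ G, (g : Matrix (Fin n) (Fin n) ℝ) *ᵥ u = v) :
    IsTransitiveGroup (complexify G) where
  one_mem := ⟨1, G.one_mem, by simp⟩
  mul_mem := by
    rintro _ _ ⟨g, hg, rfl⟩ ⟨h, hh, rfl⟩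
    exact ⟨g * h, G.mul_mem hg hh, by simp [Matrix.map_mul]⟩
  star_mem := by
    rintro _ ⟨g, hg, rfl⟩
    refine ⟨g⁻¹, G.inv_mem hg, ?_⟩
    ext i j
    simp [star_apply]
  star_mul_self := by
    rintro _ ⟨g, hg, rfl⟩
    have h : star (g : Matrix (Fin n) (Fin n) ℝ) * g = 1 :=
      (mem_orthogonalGroup_iff' (Fin n) ℝ).1 g.2
    have h2 : star ((g : Matrix (Fin n) (Fin n) ℝ).map Complex.ofRealHom) =
        (star (g : Matrix (Fin n) (Fin n) ℝ)).map Complex.ofRealHom := by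
      ext i j; simp [star_apply]
    rw [h2, ← Matrix.map_mul, h]
    simp
  isCompact := by
    have : CompactSpace (orthogonalGroup (Fin n) ℝ) :=
      isCompact_iff_compactSpace.1 (isCompact_orthogonalGroup n)
    refine hG.isCompact.image ?_
    exact continuous_subtype_val.matrix_map Complex.continuous_ofReal
  transpose_eq := by
    rintro _ ⟨g, hg, rfl⟩
    ext i j
    simp
  transitive := by
    intro x y hx hy hxx hyy
    have hre : ∀ x : Fin n → ℂ, star x = x → x = fun i => ((x i).re : ℂ) := fun x hx =>
      funext fun i => (Complex.conj_eq_iff_re.1 (congrFun hx i)).symm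
    have hdot : ∀ x : Fin n → ℂ, star x = x → x ⬝ᵥ x = 1 →
        (fun i => (x i).re) ⬝ᵥ (fun i => (x i).re) = 1 := fun x hx hxx => by
      rw [hre x hx] at hxx
      simp only [dotProduct] at hxx ⊢
      exact_mod_cast hxx
    obtain ⟨g, hg, h⟩ := htrans _ _ (hdot x hx hxx) (hdot y hy hyy)
    refine ⟨_, ⟨g, hg, rfl⟩, ?_⟩
    rw [hre x hx, hre y hy]
    simp only [map_ofReal_mulVec, h]

end TransitiveSphere

/-- Lemma 8.4 of the paper.  Let `n ≥ 2` and let `G` be a closed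
subgroup of the orthogonal group `O(n)` acting transitively on the unit sphere
`S^{n−1} ⊆ ℝⁿ`.  Then for every 2-dimensional linear subspace `L ⊆ ℝⁿ` there is
`g ∈ G` with `g v = −v` for every `v ∈ L`. -/
theorem stmt_15 (n : ℕ) (hn : 2 ≤ n)
    (G : Subgroup (Matrix.orthogonalGroup (Fin n) ℝ))
    (hGclosed : IsClosed (G : Set (Matrix.orthogonalGroup (Fin n) ℝ)))
    (htrans : ∀ u v : EuclideanSpace ℝ (Fin n), ‖u‖ = 1 → ‖v‖ = 1 →
      ∃ g ∈ G, (g : Matrix (Fin n) (Fin n) ℝ).mulVec ((WithLp.equiv 2 (Fin n → ℝ)) u) =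
        (WithLp.equiv 2 (Fin n → ℝ)) v)
    (L : Submodule ℝ (EuclideanSpace ℝ (Fin n))) (hL : Module.finrank ℝ L = 2) :
    ∃ g ∈ G, ∀ v ∈ L, (g : Matrix (Fin n) (Fin n) ℝ).mulVec
      ((WithLp.equiv 2 (Fin n → ℝ)) v) = (WithLp.equiv 2 (Fin n → ℝ)) (-v) := by
  have hnt : Nontrivial (Fin n) := Fin.nontrivial_iff_two_le.2 hn
  have hnorm : ∀ u : Fin n → ℝ, u ⬝ᵥ u = 1 → ‖WithLp.toLp 2 u‖ = 1 := fun u hu => by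
    rw [EuclideanSpace.norm_eq, Real.sqrt_eq_one]
    simpa [dotProduct, sq] using hu
  have hΓ := TransitiveSphere.isTransitiveGroup_complexify G hGclosed fun u v hu hv =>
    htrans (WithLp.toLp 2 u) (WithLp.toLp 2 v) (hnorm u hu) (hnorm v hv)
  let b := Module.finBasisOfFinrankEq ℝ L hL
  obtain ⟨_, ⟨g, hg, rfl⟩, h⟩ := hΓ.exists_mulVec_eq_neg
    ((fun i => ((b 0 : EuclideanSpace ℝ (Fin n)) i : ℂ)) +
      Complex.I • fun i => ((b 1 : EuclideanSpace ℝ (Fin n)) i : ℂ))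
  rw [Matrix.mulVec_add, Matrix.mulVec_smul, TransitiveSphere.map_ofReal_mulVec,
    TransitiveSphere.map_ofReal_mulVec] at h
  have h0 : (g : Matrix (Fin n) (Fin n) ℝ).mulVec (b 0 : EuclideanSpace ℝ (Fin n)).ofLp =
      -(b 0 : EuclideanSpace ℝ (Fin n)).ofLp := funext fun i => by
    simpa using congrArg Complex.re (congrFun h i)
  have h1 : (g : Matrix (Fin n) (Fin n) ℝ).mulVec (b 1 : EuclideanSpace ℝ (Fin n)).ofLp =
      -(b 1 : EuclideanSpace ℝ (Fin n)).ofLp := funext fun i => by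
    simpa using congrArg Complex.im (congrFun h i)
  refine ⟨g, hg, fun v hv => ?_⟩
  have hsum := congrArg (fun w : L => (w : EuclideanSpace ℝ (Fin n)).ofLp) (b.sum_repr ⟨v, hv⟩)
  simp only [Fin.sum_univ_two, Submodule.coe_add, Submodule.coe_smul, WithLp.ofLp_add,
    WithLp.ofLp_smul] at hsum
  rw [WithLp.equiv_apply, WithLp.equiv_apply, WithLp.ofLp_neg, ← hsum, Matrix.mulVec_add,
    Matrix.mulVec_smul, Matrix.mulVec_smul, h0, h1, smul_neg, smul_neg, ← neg_add]
end

section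
/- Let Y be a metric space and σ ⊆ Y a subset homeomorphic to the circle S¹ such that for every quadruple (x,y,z,u) of distinct points of σ in which the pair (x,z) separates the pair (y,u) on σ, the Ptolemy equality d(x,z)d(y,u) = d(x,y)d(z,u) + d(x,u)d(y,z) holds. Let x, y ∈ σ with a = d(x,y) > 0 and let σ₊ be one of the two connected components of σ∖{x,y}. Then for every t with 0 < t < a there exists exactly one point p ∈ σ₊ with d(x,p) = t. -/
open Set

/-- A loop `γ` based at `x` which traverses the set `σ` once. -/
structure IsSimpleLoop {Y : Type*} [TopologicalSpace Y] (γ : ℝ → Y) (σ : Set Y) (x : Y) :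
    Prop where
  continuous : ContinuousOn γ (Icc 0 1)
  zero : γ 0 = x
  one : γ 1 = x
  image : γ '' Icc 0 1 = σ
  injOn : InjOn γ (Ioo 0 1)
  ne : ∀ u ∈ Ioo (0 : ℝ) 1, γ u ≠ x

namespace IsSimpleLoop

theorem exists_of_homeomorph {Y : Type*} [TopologicalSpace Y] {σ : Set Y}
    (e : σ ≃ₜ Metric.sphere (0 : ℂ) 1) {x : Y} (hx : x ∈ σ) :
    ∃ γ : ℝ → Y, IsSimpleLoop γ σ x := by
  let c : Metric.sphere (0 : ℂ) 1 ≃ₜ Circle := Homeomorph.refl _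
  let f : σ ≃ₜ AddCircle (1 : ℝ) :=
    (e.trans c).trans (AddCircle.homeomorphCircle one_ne_zero).symm
  have hγ : ∀ u v : ℝ, (f.symm ((u : AddCircle (1 : ℝ)) + f ⟨x, hx⟩) : Y) =
      f.symm ((v : AddCircle (1 : ℝ)) + f ⟨x, hx⟩) ↔
        (u : AddCircle (1 : ℝ)) = (v : AddCircle (1 : ℝ)) := by
    intro u v
    rw [Subtype.coe_inj, f.symm.injective.eq_iff, add_left_inj]
  have h0 : (f.symm (((0 : ℝ) : AddCircle (1 : ℝ)) + f ⟨x, hx⟩) : Y) = x := by simp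
  have hinj : InjOn ((↑) : ℝ → AddCircle (1 : ℝ)) (Ico 0 1) := by
    intro u hu v hv h
    have : Fact ((0 : ℝ) < 1) := ⟨one_pos⟩
    exact (AddCircle.coe_eq_coe_iff_of_mem_Ico (p := (1 : ℝ)) (a := 0)
      (by simpa using hu) (by simpa using hv)).1 h
  refine ⟨fun u ↦ f.symm ((u : AddCircle (1 : ℝ)) + f ⟨x, hx⟩), ?_, h0, ?_, ?_, ?_, ?_⟩
  · have : Continuous fun u : ℝ ↦ (u : AddCircle (1 : ℝ)) := AddCircle.continuous_mk' 1
    fun_prop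
  · exact ((hγ 1 0).2 (by rw [AddCircle.coe_period, AddCircle.coe_zero])).trans h0
  · ext z
    constructor
    · rintro ⟨u, -, rfl⟩
      exact Subtype.coe_prop _
    · intro hz
      have : Fact ((0 : ℝ) < 1) := ⟨one_pos⟩
      have hmem : f ⟨z, hz⟩ - f ⟨x, hx⟩ ∈ ((↑) : ℝ → AddCircle (1 : ℝ)) '' Icc 0 (0 + 1) := by
        rw [AddCircle.coe_image_Icc_eq]
        trivial
      obtain ⟨u, hu, h⟩ := hmem
      refine ⟨u, by simpa using hu, ?_⟩
      simp [h]
  · intro u hu v hv h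
    exact hinj (Ioo_subset_Ico_self hu) (Ioo_subset_Ico_self hv) ((hγ u v).1 h)
  · intro u hu h
    have := hinj (Ioo_subset_Ico_self hu) ⟨le_rfl, one_pos⟩ ((hγ u 0).1 (h.trans h0.symm))
    exact hu.1.ne' this

section

variable {Y : Type*} [TopologicalSpace Y] {γ : ℝ → Y} {σ : Set Y} {x : Y}

theorem reverse (h : IsSimpleLoop γ σ x) : IsSimpleLoop (fun u ↦ γ (1 - u)) σ x where
  continuous := h.continuous.comp (by fun_prop) fun u hu ↦ by
    constructor <;> linarith [hu.1, hu.2]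
  zero := by simpa using h.one
  one := by simpa using h.zero
  image := by
    rw [← h.image, ← image_image γ (fun u ↦ 1 - u)]
    simp
  injOn u hu v hv huv := by
    have := h.injOn (x₁ := 1 - u) (x₂ := 1 - v) (by constructor <;> linarith [hu.1, hu.2])
      (by constructor <;> linarith [hv.1, hv.2]) huv
    linarith
  ne u hu := h.ne (1 - u) (by constructor <;> linarith [hu.1, hu.2])

theorem mem (h : IsSimpleLoop γ σ x) {u : ℝ} (hu : u ∈ Ioo (0 : ℝ) 1) : γ u ∈ σ :=
  h.image ▸ mem_image_of_mem γ (Ioo_subset_Icc_self hu)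

theorem exists_eq (h : IsSimpleLoop γ σ x) {z : Y} (hz : z ∈ σ) (hzx : z ≠ x) :
    ∃ u ∈ Ioo (0 : ℝ) 1, γ u = z := by
  rw [← h.image] at hz
  obtain ⟨u, hu, rfl⟩ := hz
  refine ⟨u, ⟨hu.1.lt_of_ne ?_, hu.2.lt_of_ne ?_⟩, rfl⟩
  · rintro rfl
    exact hzx h.zero
  · rintro rfl
    exact hzx h.one

theorem subset_diff (h : IsSimpleLoop γ σ x) {s : ℝ} (hs : s ∈ Ioo (0 : ℝ) 1) :
    γ '' Ioo 0 s ⊆ σ \ {x, γ s} := by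
  rintro _ ⟨u, hu, rfl⟩
  have hu1 : u ∈ Ioo (0 : ℝ) 1 := ⟨hu.1, hu.2.trans hs.2⟩
  refine ⟨h.mem hu1, ?_⟩
  rintro (h1 | h1)
  · exact h.ne u hu1 h1
  · exact hu.2.ne (h.injOn hu1 hs h1)

/-- Removing the base point and `γ s` from a simple loop, the arc `γ '' Ioo 0 s` is a connected
component of what remains. -/
theorem connectedComponentIn_eq [T2Space Y] (h : IsSimpleLoop γ σ x) {r s : ℝ}
    (hs : s ∈ Ioo (0 : ℝ) 1) (hr : r ∈ Ioo 0 s) :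
    connectedComponentIn (σ \ {x, γ s}) (γ r) = γ '' Ioo 0 s := by
  have hsub : Ioo 0 s ⊆ Icc (0 : ℝ) 1 := fun u hu ↦ ⟨hu.1.le, (hu.2.trans hs.2).le⟩
  have hrσ : γ r ∈ γ '' Ioo 0 s := mem_image_of_mem γ hr
  apply Subset.antisymm
  · set C := connectedComponentIn (σ \ {x, γ s}) (γ r)
    have hC : C ⊆ σ \ {x, γ s} := connectedComponentIn_subset _ _
    have hrC : γ r ∈ C := mem_connectedComponentIn (h.subset_diff hs hrσ)
    have hA : IsClosed (γ '' Icc 0 s) := (isCompact_Icc.image_of_continuousOn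
      (h.continuous.mono (Icc_subset_Icc_right hs.2.le))).isClosed
    have hB : IsClosed (γ '' Icc s 1) := (isCompact_Icc.image_of_continuousOn
      (h.continuous.mono (Icc_subset_Icc_left hs.1.le))).isClosed
    have mem_left : ∀ z ∈ C, z ∈ γ '' Icc 0 s → z ∈ γ '' Ioo 0 s := by
      rintro _ hz ⟨u, hu, rfl⟩
      refine ⟨u, ⟨hu.1.lt_of_ne ?_, hu.2.lt_of_ne ?_⟩, rfl⟩
      · rintro rfl
        exact (hC hz).2 (Or.inl h.zero)
      · rintro rfl
        exact (hC hz).2 (Or.inr rfl)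
    have mem_right : ∀ z ∈ C, z ∈ γ '' Icc s 1 → z ∈ γ '' Ioo s 1 := by
      rintro _ hz ⟨u, hu, rfl⟩
      refine ⟨u, ⟨hu.1.lt_of_ne ?_, hu.2.lt_of_ne ?_⟩, rfl⟩
      · rintro rfl
        exact (hC hz).2 (Or.inr rfl)
      · rintro rfl
        exact (hC hz).2 (Or.inl h.one)
    have hdisj : ∀ z, z ∈ γ '' Ioo 0 s → z ∉ γ '' Ioo s 1 := by
      rintro _ ⟨u, hu, rfl⟩ ⟨v, hv, huv⟩
      have := h.injOn ⟨hs.1.trans hv.1, hv.2⟩ ⟨hu.1, hu.2.trans hs.2⟩ huv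
      linarith [hu.2, hv.1]
    have hcover : C ⊆ γ '' Icc 0 s ∪ γ '' Icc s 1 := by
      rw [← image_union, Icc_union_Icc_eq_Icc hs.1.le hs.2.le, h.image]
      exact hC.trans sdiff_subset
    have hempty : C ∩ (γ '' Icc 0 s ∩ γ '' Icc s 1) = ∅ := by
      refine eq_empty_of_forall_notMem ?_
      rintro z ⟨hz, hzA, hzB⟩
      exact hdisj z (mem_left z hz hzA) (mem_right z hz hzB)
    rcases isPreconnected_iff_subset_of_disjoint_closed.1 isPreconnected_connectedComponentIn
      _ _ hA hB hcover hempty with hCA | hCB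
    · exact fun z hz ↦ mem_left z hz (hCA hz)
    · exact absurd (mem_right _ hrC (hCB hrC)) (hdisj _ hrσ)
  · exact (isPreconnected_Ioo.image _ (h.continuous.mono hsub)).subset_connectedComponentIn
      hrσ (h.subset_diff hs)

theorem exists_arc (h : IsSimpleLoop γ σ x) {y w : Y} (hy : y ∈ σ) (hyx : y ≠ x)
    (hw : w ∈ σ \ {x, y}) :
    ∃ (γ' : ℝ → Y) (r s : ℝ), IsSimpleLoop γ' σ x ∧ s ∈ Ioo (0 : ℝ) 1 ∧ r ∈ Ioo 0 s ∧
      γ' s = y ∧ γ' r = w := by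
  obtain ⟨s, hs, hsy⟩ := h.exists_eq hy hyx
  obtain ⟨r, hr, hrw⟩ := h.exists_eq hw.1 fun hwx ↦ hw.2 (Or.inl hwx)
  have hrs : r ≠ s := by
    rintro rfl
    exact hw.2 (Or.inr (hrw.symm.trans hsy))
  rcases hrs.lt_or_gt with hlt | hlt
  · exact ⟨γ, r, s, h, hs, ⟨hr.1, hlt⟩, hsy, hrw⟩
  · refine ⟨_, 1 - r, 1 - s, h.reverse, ?_, ?_, by simpa using hsy, by simpa using hrw⟩
    · constructor <;> linarith [hs.1, hs.2]
    · constructor <;> linarith [hr.2]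

end

end IsSimpleLoop

/-- A Ptolemy equality for `x, p, q, y` forces `dist x p ≠ dist x q` when `q` is closer to `x`
than `y` is. -/
theorem dist_ne_dist_of_ptolemy {Y : Type*} [MetricSpace Y] {x p q y : Y} (hpq : p ≠ q)
    (hlt : dist x q < dist x y)
    (h : dist x q * dist p y = dist x p * dist q y + dist x y * dist p q) :
    dist x p ≠ dist x q := by
  intro heq
  have htri : dist p y ≤ dist p q + dist q y := dist_triangle p q y
  have hpos : 0 < dist p q := dist_pos.2 hpq
  have h1 := mul_le_mul_of_nonneg_left htri (dist_nonneg (x := x) (y := q))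
  have h2 := mul_lt_mul_of_pos_right hlt hpos
  rw [heq] at h
  linarith


/-- Lemma 9.1, distance parameterization of a Ptolemy circle.
Let `Y` be a metric space and `σ ⊆ Y` a subset homeomorphic to the circle `S¹`
satisfying the Ptolemy equality for all quadruples of distinct points `(x,y,z,u)` of `σ`
in which the pair `(x,z)` separates the pair `(y,u)`.  Let `x, y ∈ σ` with
`a = d(x,y) > 0` and let `σ₊` be one of the connected components of `σ∖{x,y}`.
Then for every `0 < t < a` there is exactly one point `p ∈ σ₊` with `d(x,p) = t`. -/
theorem stmt_16 {Y : Type*} [MetricSpace Y] (σ : Set Y)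
    (hhomeo : Nonempty (σ ≃ₜ Metric.sphere (0 : ℂ) 1))
    (hpt : ∀ x ∈ σ, ∀ y ∈ σ, ∀ z ∈ σ, ∀ u ∈ σ,
      x ≠ y → x ≠ z → x ≠ u → y ≠ z → y ≠ u → z ≠ u →
      u ∉ connectedComponentIn (σ \ {x, z}) y →
      dist x z * dist y u = dist x y * dist z u + dist x u * dist y z)
    (x y : Y) (hx : x ∈ σ) (hy : y ∈ σ) (a : ℝ) (ha : a = dist x y) (hapos : 0 < a)
    (w : Y) (hw : w ∈ σ \ {x, y})
    (σp : Set Y) (hσp : σp = connectedComponentIn (σ \ {x, y}) w)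
    (t : ℝ) (ht0 : 0 < t) (hta : t < a) :
    ∃! p : Y, p ∈ σp ∧ dist x p = t := by
  subst ha hσp
  obtain ⟨e⟩ := hhomeo
  obtain ⟨γ₀, hγ₀⟩ := IsSimpleLoop.exists_of_homeomorph e hx
  obtain ⟨γ, r, s, hγ, hs, hr, rfl, rfl⟩ := hγ₀.exists_arc hy (dist_pos.1 hapos).symm hw
  rw [hγ.connectedComponentIn_eq hs hr]
  have key : ∀ u v : ℝ, 0 < u → u < v → v < s → dist x (γ v) = t → dist x (γ u) ≠ t := by
    intro u v hu huv hvs hv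
    have hu1 : u ∈ Ioo (0 : ℝ) 1 := ⟨hu, huv.trans (hvs.trans hs.2)⟩
    have hv1 : v ∈ Ioo (0 : ℝ) 1 := ⟨hu.trans huv, hvs.trans hs.2⟩
    have hpq : γ u ≠ γ v := fun h ↦ huv.ne (hγ.injOn hu1 hv1 h)
    have hus : γ u ≠ γ s := fun h ↦ (huv.trans hvs).ne (hγ.injOn hu1 hs h)
    have hvs' : γ v ≠ γ s := fun h ↦ hvs.ne (hγ.injOn hv1 hs h)
    rw [← hv] at hta ⊢
    refine dist_ne_dist_of_ptolemy hpq hta ?_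
    refine hpt x hx _ (hγ.mem hu1) _ (hγ.mem hv1) _ hy (hγ.ne u hu1).symm (hγ.ne v hv1).symm
      (hγ.ne s hs).symm hpq hus hvs' ?_
    rw [hγ.connectedComponentIn_eq hv1 ⟨hu, huv⟩]
    rintro ⟨u', hu', h⟩
    have := hγ.injOn ⟨hu'.1, hu'.2.trans hv1.2⟩ hs h
    linarith [hu'.2]
  have hcont : ContinuousOn (fun u ↦ dist x (γ u)) (Icc 0 s) :=
    (continuous_const.dist continuous_id).comp_continuousOn
      (hγ.continuous.mono (Icc_subset_Icc_right hs.2.le))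
  obtain ⟨u, hu, hut⟩ := intermediate_value_Ioo hs.1.le hcont
    (show t ∈ Ioo (dist x (γ 0)) (dist x (γ s)) from ⟨by rwa [hγ.zero, dist_self], hta⟩)
  refine ⟨γ u, ⟨mem_image_of_mem γ hu, hut⟩, ?_⟩
  rintro _ ⟨⟨v, hv, rfl⟩, hvt⟩
  rcases lt_trichotomy v u with hlt | rfl | hlt
  · exact absurd hvt (key v u hv.1 hlt hu.2 hut)
  · rfl
  · exact absurd hut (key u v hu.1 hlt hv.2 hvt)
end

section
/- Let Y be a metric space, y ∈ Y, a > 0, I ⊆ ℝ an interval, and γ : I → Y a map such that for all s, t ∈ I with s < t one has t·d(γ(s),y) − s·d(γ(t),y) = a·d(γ(s),γ(t)). Then the function t ↦ d(γ(t),y) is concave on I. -/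
/-- concavity part of Lemma 9.2.  Let `Y` be a metric space,
`y ∈ Y`, `a > 0`, `I ⊆ ℝ` an interval and `γ : I → Y` a map such that for all
`s, t ∈ I` with `s < t` one has `t·d(γ(s),y) − s·d(γ(t),y) = a·d(γ(s),γ(t))`.
Then `t ↦ d(γ(t),y)` is concave on `I`. -/
theorem stmt_17 {Y : Type*} [MetricSpace Y] (y : Y) (a : ℝ) (ha : 0 < a)
    (I : Set ℝ) (hI : Convex ℝ I) (γ : ℝ → Y)
    (hid : ∀ s ∈ I, ∀ t ∈ I, s < t →
      t * dist (γ s) y - s * dist (γ t) y = a * dist (γ s) (γ t)) :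
    ConcaveOn ℝ I (fun t => dist (γ t) y) := by
  refine concaveOn_of_slope_anti_adjacent hI fun {s r t} hs ht hsr hrt => ?_
  have hr : r ∈ I := hI.ordConnected.out hs ht ⟨hsr.le, hrt.le⟩
  have htri := mul_le_mul_of_nonneg_left (dist_triangle (γ s) (γ r) (γ t)) ha.le
  rw [mul_add, ← hid s hs t ht (hsr.trans hrt), ← hid s hs r hr hsr, ← hid r hr t ht hrt] at htri
  rw [div_le_div_iff₀ (sub_pos.2 hrt) (sub_pos.2 hsr)]
  linarith
end
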